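/- Let w ≡ 0 (mod 6) and let λ_0 ≥ λ_1 ≥ λ_2 ≥ λ_3 be non-negative integers, not all equal, with λ_0 + λ_1 + λ_2 + λ_3 = w/3. With σ_2 and σ_3 the second and third elementary symmetric functions of λ_0,…,λ_3, set A_0 = −w^2/24 + σ_2 + 5/72, B_0 = −w^3/216 + w^2/72 + ((w−2)/6)σ_2 − σ_3 − 5/216, and C_0 = (λ_0 − (w−3)/12)(λ_1 − (w−3)/12)(λ_2 − (w−3)/12)(λ_3 − (w−3)/12). If f(z) = q^{λ_0}∑_{n≥0}a(n)q^n with a(0) ≠ 0 is a holomorphic solution of ∂_{w−3}^4 f + A_0 E_4 ∂_{w−3}^2 f + B_0 E_6 ∂_{w−3} f + C_0 E_4^2 f = 0, then f is a balanced quasimodular form of weight w and depth 3. -/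

import Mathlib

open Complex UpperHalfPlane Finset
open scoped Manifold MatrixGroups Real

noncomputable section

/-- The nome `q = e^{2πiz}`. -/
def qexp (z : ℍ) : ℂ := Complex.exp (2 * Real.pi * Complex.I * z)

/-- The normalized Eisenstein series `E_k` (for even `k ≥ 2`), defined via its
`q`-expansion `E_k = 1 - (2k/B_k) ∑_{n ≥ 1} σ_{k-1}(n) q^n`. -/
def Eis (k : ℕ) (z : ℍ) : ℂ :=
  1 - (2 * k / ((bernoulli k : ℚ) : ℂ)) *
    ∑' n : ℕ, (ArithmeticFunction.sigma (k - 1) (n + 1) : ℂ) * qexp z ^ (n + 1)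

/-- The modular discriminant `Δ = (E_4³ − E_6²)/1728`. -/
def Disc (z : ℍ) : ℂ := (Eis 4 z ^ 3 - Eis 6 z ^ 2) / 1728

/-- The space of holomorphic modular forms of weight `w` for the full modular group,
as a set of functions on `ℍ`. -/
def Mset (w : ℤ) : Set (ℍ → ℂ) :=
  {f | ∃ F : ModularForm (⊤ : Subgroup SL(2, ℤ)) w, ⇑F = f}

/-- The set of quasimodular forms of weight `w` and depth `≤ r`:
functions of the form `∑_{ℓ=0}^r E_2^ℓ h_ℓ` with `h_ℓ ∈ M_{w-2ℓ}`. -/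
def QMset (w : ℤ) (r : ℕ) : Set (ℍ → ℂ) :=
  {f | ∃ h : ℕ → ℍ → ℂ, (∀ ℓ ≤ r, h ℓ ∈ Mset (w - 2 * ℓ)) ∧
        ∀ z, f z = ∑ ℓ ∈ Finset.range (r + 1), Eis 2 z ^ ℓ * h ℓ z}

/-- `QM_w^r` as a `ℂ`-subspace of the functions on `ℍ`. -/
def QM (w : ℤ) (r : ℕ) : Submodule ℂ (ℍ → ℂ) := Submodule.span ℂ (QMset w r)

/-- `dim QM_w^r`. -/
def dimQM (w : ℤ) (r : ℕ) : ℕ := Module.finrank ℂ (QM w r)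

/-- The complex derivative of a function on `ℍ` (via an extension to `ℂ`; since `ℍ` is
open in `ℂ` this agrees with the complex derivative for holomorphic `f`). -/
def hderiv (f : ℍ → ℂ) (z : ℍ) : ℂ :=
  deriv (fun w : ℂ => if h : 0 < w.im then f ⟨w, h⟩ else 0) z

/-- The normalized derivative `f' = (2πi)⁻¹ df/dz = q df/dq`. -/
def qderiv (f : ℍ → ℂ) (z : ℍ) : ℂ := (2 * Real.pi * Complex.I)⁻¹ * hderiv f z

/-- The Serre derivative `∂_w f = f' - (w/12) E_2 f`. -/
def serre (w : ℤ) (f : ℍ → ℂ) (z : ℍ) : ℂ :=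
  qderiv f z - ((w : ℂ) / 12) * Eis 2 z * f z

/-- Iterated Serre derivatives: `∂_w^0 f = f`, `∂_w^{k+1} f = ∂_{w+2k}(∂_w^k f)`. -/
def serreIter (w : ℤ) : ℕ → (ℍ → ℂ) → (ℍ → ℂ)
  | 0, f => f
  | (k + 1), f => serre (w + 2 * k) (serreIter w k f)

/-- `z ↦ -1/z` as a map `ℍ → ℍ`. -/
def Sact (z : ℍ) : ℍ :=
  ⟨-(z : ℂ)⁻¹, by
    have h0 : (z : ℂ) ≠ 0 := z.ne_zero
    have : (-(z : ℂ)⁻¹).im = (z : ℂ).im / Complex.normSq (z : ℂ) := by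
      rw [Complex.neg_im, Complex.inv_im]; ring
    rw [this]
    exact div_pos z.im_pos (Complex.normSq_pos.mpr h0)⟩

/-- `z ↦ z + 1` as a map `ℍ → ℍ`. -/
def Tact (z : ℍ) : ℍ := ⟨(z : ℂ) + 1, by simpa using z.im_pos⟩

/-- `g` has a `q`-expansion with vanishing order exactly `ν` at `i∞`:
`g = q^ν ∑_{n≥0} a(n) qⁿ` with `a(0) ≠ 0`. -/
def HasQExpansionAt (g : ℍ → ℂ) (ν : ℕ) : Prop :=
  ∃ a : ℕ → ℂ, a 0 ≠ 0 ∧ ∀ z : ℍ, HasSum (fun n : ℕ => a n * qexp z ^ (ν + n)) (g z)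

/-- The quasimodular forms `g_ℓ` attached to `f = ∑_{ℓ=0}^r E_2^ℓ h_ℓ`, defined by
`C(r,ℓ) g_ℓ = (6/(πi))^ℓ ∑_{m=0}^{r-ℓ} C(ℓ+m,m) E_2^m h_{ℓ+m}`. -/
def gOf (r : ℕ) (h : ℕ → ℍ → ℂ) (ℓ : ℕ) (z : ℍ) : ℂ :=
  ((r.choose ℓ : ℂ))⁻¹ * (6 / ((Real.pi : ℂ) * Complex.I)) ^ ℓ *
    ∑ m ∈ Finset.range (r - ℓ + 1), (((ℓ + m).choose m : ℕ) : ℂ) * Eis 2 z ^ m * h (ℓ + m) z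

/-- `f` is a balanced quasimodular form of weight `w` and depth `r`. -/
def IsBalancedQM (w : ℤ) (r : ℕ) (f : ℍ → ℂ) : Prop :=
  ∃ h : ℕ → ℍ → ℂ, ∃ lam : ℕ → ℕ,
    (∀ ℓ ≤ r, h ℓ ∈ Mset (w - 2 * ℓ)) ∧ h r ≠ 0 ∧
    (∀ z, f z = ∑ ℓ ∈ Finset.range (r + 1), Eis 2 z ^ ℓ * h ℓ z) ∧
    (∀ ℓ ≤ r, HasQExpansionAt (gOf r h ℓ) (lam ℓ)) ∧
    (∀ i j, i ≤ j → j ≤ r → lam j ≤ lam i) ∧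
    (∀ ℓ ≤ r, lam ℓ < dimQM (w - 2 * ℓ) (r - ℓ)) ∧
    (∑ ℓ ∈ Finset.range (r + 1), lam ℓ) = dimQM w r - 1

/-- `f` is the normalized extremal quasimodular form of weight `w` and depth `r`:
`f ∈ QM_w^r` with `q`-expansion `q^{dim QM_w^r - 1}(1 + O(q))`. -/
def IsNormalizedExtremalQM (w : ℤ) (r : ℕ) (f : ℍ → ℂ) : Prop :=
  f ∈ QM w r ∧ ∃ a : ℕ → ℂ, a 0 = 1 ∧
    ∀ z : ℍ, HasSum (fun n : ℕ => a n * qexp z ^ (dimQM w r - 1 + n)) (f z)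

/-- `f 0, …, f (n-1)` is a fundamental system of solutions of the linear differential
equation `K g = 0`: holomorphic linearly independent solutions spanning all
holomorphic solutions. -/
def IsFundamentalSystem {n : ℕ} (K : (ℍ → ℂ) → (ℍ → ℂ)) (f : Fin n → ℍ → ℂ) : Prop :=
  (∀ i, MDifferentiable 𝓘(ℂ) 𝓘(ℂ) (f i)) ∧ (∀ i, K (f i) = 0) ∧
    LinearIndependent ℂ f ∧
    ∀ g : ℍ → ℂ, MDifferentiable 𝓘(ℂ) 𝓘(ℂ) g → K g = 0 → g ∈ Submodule.span ℂ (Set.range f)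


/-- `F = (f_0, …, f_r)ᵀ` is a quasimodular vector of weight `w` and dimension `r+1`:
all components are holomorphic and there is a quasimodular form `f = ∑_{ℓ=0}^s E_2^ℓ h_ℓ`
of weight `w` and depth `s ≤ r` such that
`f_k(z) = ∑_{ℓ=0}^{min(k,s)} C(k,ℓ) z^{k-ℓ} g_ℓ(z)` for the attached forms `g_ℓ`. -/
def IsQuasimodularVector (w : ℤ) (r : ℕ) (F : Fin (r + 1) → ℍ → ℂ) : Prop :=
  (∀ k, MDifferentiable 𝓘(ℂ) 𝓘(ℂ) (F k)) ∧
  ∃ s : ℕ, s ≤ r ∧ ∃ h : ℕ → ℍ → ℂ,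
    (∀ ℓ ≤ s, h ℓ ∈ Mset (w - 2 * ℓ)) ∧ (s = 0 ∨ h s ≠ 0) ∧
    ∀ (k : Fin (r + 1)) (z : ℍ),
      F k z = ∑ ℓ ∈ Finset.range (min (k : ℕ) s + 1),
        (((k : ℕ).choose ℓ : ℕ) : ℂ) * (z : ℂ) ^ ((k : ℕ) - ℓ) * gOf s h ℓ z

/-- The modular Wronskian `W(z) = det(F, ∂_{w-r}F, …, ∂_{w-r}^r F)`. -/
def modularWronskian (w : ℤ) (r : ℕ) (F : Fin (r + 1) → ℍ → ℂ) (z : ℍ) : ℂ :=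
  Matrix.det (Matrix.of fun (k j : Fin (r + 1)) => serreIter (w - r) (j : ℕ) (F k) z)

end

/-- The derivation `θ = X d/dX` of power series. -/
noncomputable def theta : Derivation ℂ (PowerSeries ℂ) (PowerSeries ℂ) :=
  (PowerSeries.X : PowerSeries ℂ) • PowerSeries.derivative ℂ

lemma coeff_theta (F : PowerSeries ℂ) (n : ℕ) :
    PowerSeries.coeff n (theta F) = n * PowerSeries.coeff n F := by
  rcases n with _ | n
  · simp [theta]
  · simp [theta, PowerSeries.coeff_succ_X_mul, PowerSeries.coeff_derivative, mul_comm]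

/-- `f` is the sum of the `q`-series `F` on the upper half plane. -/
def IsQS (f : ℍ → ℂ) (F : PowerSeries ℂ) : Prop :=
  ∀ z : ℍ, HasSum (fun n : ℕ => PowerSeries.coeff n F * qexp z ^ n) (f z)

lemma qexp_eq_qParam (z : ℍ) : qexp z = Function.Periodic.qParam 1 z := by
  simp [qexp, Function.Periodic.qParam]

lemma norm_qexp_lt_one (z : ℍ) : ‖qexp z‖ < 1 := by
  rw [qexp_eq_qParam]; exact Function.Periodic.norm_qParam_lt_one one_pos z.im_pos

lemma exists_qexp_eq {x : ℂ} (hx : x ≠ 0) (h1 : ‖x‖ < 1) : ∃ z : ℍ, qexp z = x := by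
  have him : 0 < (Function.Periodic.invQParam 1 x).im := by
    rw [Function.Periodic.im_invQParam]
    have := Real.log_neg (norm_pos_iff.2 hx) h1
    have hp : 0 < 1 / (2 * π) := by positivity
    rw [neg_div]
    nlinarith
  refine ⟨⟨_, him⟩, ?_⟩
  rw [qexp_eq_qParam]
  exact Function.Periodic.qParam_right_inv one_ne_zero hx

namespace IsQS

variable {f g : ℍ → ℂ} {F G : PowerSeries ℂ}

lemma add (hf : IsQS f F) (hg : IsQS g G) : IsQS (fun z => f z + g z) (F + G) := fun z => by
  simpa [add_mul] using (hf z).add (hg z)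

lemma sub (hf : IsQS f F) (hg : IsQS g G) : IsQS (fun z => f z - g z) (F - G) := fun z => by
  simpa [sub_mul] using (hf z).sub (hg z)

lemma smul (a : ℂ) (hf : IsQS f F) : IsQS (fun z => a * f z) (a • F) := fun z => by
  simpa [mul_assoc] using (hf z).mul_left a

lemma zero : IsQS (fun _ => 0) 0 := fun z => by simp

lemma one : IsQS (fun _ => 1) 1 := fun z => by
  have := hasSum_single (f := fun n : ℕ => PowerSeries.coeff n (1 : PowerSeries ℂ) * qexp z ^ n) 0
    (fun n hn => by simp [PowerSeries.coeff_one, hn])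
  simpa using this

lemma mul (hf : IsQS f F) (hg : IsQS g G) : IsQS (fun z => f z * g z) (F * G) := fun z => by
  have h1 := (hf z).summable.norm
  have h2 := (hg z).summable.norm
  have h3 := tsum_mul_tsum_eq_tsum_sum_antidiagonal_of_summable_norm h1 h2
  have h4 := (summable_norm_sum_mul_antidiagonal_of_summable_norm h1 h2).of_norm.hasSum
  rw [← h3, (hf z).tsum_eq, (hg z).tsum_eq] at h4
  convert! h4 using 2 with n
  rw [PowerSeries.coeff_mul, Finset.sum_mul]
  refine Finset.sum_congr rfl fun p hp => ?_
  rw [← Finset.HasAntidiagonal.mem_antidiagonal.1 hp, pow_add]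
  ring

lemma pow (hf : IsQS f F) (n : ℕ) : IsQS (fun z => f z ^ n) (F ^ n) := by
  induction n with
  | zero => simpa using IsQS.one
  | succ n ih => simpa [pow_succ] using ih.mul hf

lemma sum {ι : Type*} (s : Finset ι) {f : ι → ℍ → ℂ} {F : ι → PowerSeries ℂ}
    (h : ∀ i ∈ s, IsQS (f i) (F i)) : IsQS (fun z => ∑ i ∈ s, f i z) (∑ i ∈ s, F i) := by
  classical
  induction s using Finset.induction_on with
  | empty => simpa using IsQS.zero
  | insert a s ha ih =>
    simp only [Finset.sum_insert ha]
    exact (h a (by simp)).add (ih fun i hi => h i (by simp [hi]))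

lemma funext_of_eq (hf : IsQS f F) (hg : IsQS g F) : f = g :=
  funext fun z => (hf z).unique (hg z)

lemma summable_coeff (hf : IsQS f F) {x : ℂ} (hx : ‖x‖ < 1) :
    Summable fun n : ℕ => PowerSeries.coeff n F * x ^ n := by
  by_cases h0 : x = 0
  · refine summable_of_ne_finset_zero (s := {0}) fun n hn => ?_
    have : n ≠ 0 := by simpa using hn
    simp [h0, this]
  · obtain ⟨z, rfl⟩ := exists_qexp_eq h0 hx
    exact (hf z).summable

lemma hasDerivAt_tsum (hf : IsQS f F) {x : ℂ} (hx : ‖x‖ < 1) :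
    HasDerivAt (fun y : ℂ => ∑' n : ℕ, PowerSeries.coeff n F * y ^ n)
      (∑' n : ℕ, PowerSeries.coeff n F * (n * x ^ (n - 1))) x := by
  obtain ⟨r, hxr, hr1⟩ := exists_between hx
  obtain ⟨R, hrR, hR1⟩ := exists_between hr1
  have hr0 : 0 < r := (norm_nonneg x).trans_lt hxr
  have hR0 : 0 < R := hr0.trans hrR
  have hs : Summable fun n : ℕ => ‖PowerSeries.coeff n F‖ * R ^ n := by
    have := (hf.summable_coeff (x := (R : ℂ)) (by simpa [abs_of_pos hR0] using hR1)).norm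
    simpa [abs_of_pos hR0] using this
  obtain ⟨C, hC⟩ := hs.tendsto_atTop_zero.bddAbove_range
  have hC' : ∀ n : ℕ, ‖PowerSeries.coeff n F‖ * R ^ n ≤ C := fun n => hC ⟨n, rfl⟩
  have hgeo : Summable fun n : ℕ => (n : ℝ) ^ 1 * (r / R) ^ n :=
    summable_pow_mul_geometric_of_norm_lt_one 1 (by
      rw [Real.norm_of_nonneg (by positivity), div_lt_one hR0]; exact hrR)
  refine hasDerivAt_tsum_of_isPreconnected (t := Metric.ball (0 : ℂ) r) (y₀ := 0)
    (g := fun n (y : ℂ) => PowerSeries.coeff n F * y ^ n)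
    (g' := fun n (y : ℂ) => PowerSeries.coeff n F * (n * y ^ (n - 1)))
    (u := fun n : ℕ => C / r * ((n : ℝ) ^ 1 * (r / R) ^ n)) (hgeo.mul_left _) Metric.isOpen_ball
    (convex_ball _ _).isPreconnected (fun n y _ => (hasDerivAt_pow n y).const_mul _) ?_
    (by simpa using hr0) (hf.summable_coeff (by simp)) (by simpa using hxr)
  intro n y hy
  rcases n with _ | n
  · simp
  · have hy' : ‖y‖ ≤ r := by simpa using (Metric.mem_ball.1 hy).le
    have h1 : ‖y‖ ^ n ≤ r ^ n := by gcongr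
    have h2 := hC' (n + 1)
    have h3 : ‖PowerSeries.coeff (n + 1) F‖ ≤ C / R ^ (n + 1) := by
      rw [le_div_iff₀ (by positivity)]; exact h2
    calc ‖PowerSeries.coeff (n + 1) F * (((n + 1 : ℕ) : ℂ) * y ^ (n + 1 - 1))‖
        = ‖PowerSeries.coeff (n + 1) F‖ * ((n + 1 : ℕ) * ‖y‖ ^ n) := by
          rw [norm_mul, norm_mul, norm_pow, Complex.norm_natCast]; simp
      _ ≤ C / R ^ (n + 1) * ((n + 1 : ℕ) * r ^ n) := by
          have := (norm_nonneg _).trans h3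
          gcongr
      _ = C / r * (((n + 1 : ℕ) : ℝ) ^ 1 * (r / R) ^ (n + 1)) := by
          rw [div_pow, pow_succ r n]; field_simp

lemma hasDerivAt (hf : IsQS f F) (z : ℍ) :
    HasDerivAt (f ∘ ofComplex)
      ((∑' n : ℕ, PowerSeries.coeff n F * (n * qexp z ^ (n - 1))) *
        (qexp z * (2 * π * Complex.I))) z := by
  have h1 : HasDerivAt (fun w : ℂ => Complex.exp (2 * π * Complex.I * w)) (qexp z * (2 * π * Complex.I)) z := by
    have := ((hasDerivAt_id (z : ℂ)).const_mul (2 * π * Complex.I)).cexp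
    simpa [qexp] using this
  have h2 := HasDerivAt.comp (z : ℂ) (hf.hasDerivAt_tsum (norm_qexp_lt_one z)) h1
  refine h2.congr_of_eventuallyEq ?_
  filter_upwards [isOpen_upperHalfPlaneSet.mem_nhds z.im_pos] with w hw
  have := (hf ⟨w, hw⟩).tsum_eq
  simp only [Function.comp_apply, ofComplex_apply_of_im_pos hw]
  rw [← this]; rfl

lemma mdifferentiable (hf : IsQS f F) : MDifferentiable 𝓘(ℂ) 𝓘(ℂ) f := fun z =>
  mdifferentiableAt_iff.2 (hf.hasDerivAt z).differentiableAt

lemma hderiv_eq (f : ℍ → ℂ) (z : ℍ) : hderiv f z = deriv (f ∘ ofComplex) z := by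
  unfold hderiv
  refine Filter.EventuallyEq.deriv_eq ?_
  filter_upwards [isOpen_upperHalfPlaneSet.mem_nhds z.im_pos] with w hw
  have hw' : 0 < w.im := hw
  simp [hw', ofComplex_apply_of_im_pos hw']

lemma qderiv (hf : IsQS f F) : IsQS (qderiv f) (theta F) := fun z => by
  have hs : Summable fun n : ℕ => PowerSeries.coeff n (theta F) * qexp z ^ n := by
    obtain ⟨r, hxr, hr1⟩ := exists_between (norm_qexp_lt_one z)
    have hr0 : 0 < r := (norm_nonneg _).trans_lt hxr
    have hs := (hf.summable_coeff (x := (r : ℂ)) (by simpa [abs_of_pos hr0] using hr1)).norm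
    obtain ⟨C, hC⟩ := hs.tendsto_atTop_zero.bddAbove_range
    have hC' : ∀ n : ℕ, ‖PowerSeries.coeff n F * (r : ℂ) ^ n‖ ≤ C := fun n => hC ⟨n, rfl⟩
    have hgeo : Summable fun n : ℕ => (n : ℝ) ^ 1 * (‖qexp z‖ / r) ^ n :=
      summable_pow_mul_geometric_of_norm_lt_one 1 (by
        rw [Real.norm_of_nonneg (by positivity), div_lt_one hr0]; exact hxr)
    refine Summable.of_norm_bounded (hgeo.mul_left C) fun n => ?_
    have := hC' n
    rw [norm_mul, norm_pow, Complex.norm_real, Real.norm_of_nonneg hr0.le,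
      ← le_div_iff₀ (by positivity)] at this
    rw [coeff_theta, norm_mul, norm_mul, norm_pow, Complex.norm_natCast]
    calc (n : ℝ) * ‖PowerSeries.coeff n F‖ * ‖qexp z‖ ^ n
        ≤ n * (C / r ^ n) * ‖qexp z‖ ^ n := by gcongr
      _ = C * ((n : ℝ) ^ 1 * (‖qexp z‖ / r) ^ n) := by rw [div_pow]; field_simp
  convert! hs.hasSum using 1
  rw [_root_.qderiv, hderiv_eq, (hf.hasDerivAt z).deriv]
  have hpi : (2 * π * Complex.I : ℂ) ≠ 0 := by simp [Real.pi_ne_zero]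
  calc (2 * π * Complex.I : ℂ)⁻¹ * ((∑' n : ℕ, PowerSeries.coeff n F * (n * qexp z ^ (n - 1))) *
        (qexp z * (2 * π * Complex.I)))
      = (∑' n : ℕ, PowerSeries.coeff n F * (n * qexp z ^ (n - 1))) * qexp z := by
        field_simp
    _ = _ := by
        rw [← tsum_mul_right]
        refine tsum_congr fun n => ?_
        rw [coeff_theta]
        rcases n with _ | n
        · simp
        · simp [pow_succ]; ring

lemma isBoundedAtImInfty (hf : IsQS f F) : IsBoundedAtImInfty f :=
  isBoundedAtImInfty_of_hasSum_qExpansion (h := 1) one_pos (c := fun n => PowerSeries.coeff n F)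
    fun z => by simpa [qexp_eq_qParam] using hf z

lemma add_one (hf : IsQS f F) (z : ℍ) : f ((1 : ℝ) +ᵥ z) = f z := by
  refine (hf _).unique ?_
  have : qexp ((1 : ℝ) +ᵥ z) = qexp z := by
    simp [qexp, mul_add, Complex.exp_add]
  rw [this]; exact hf z

lemma periodic (hf : IsQS f F) : Function.Periodic (f ∘ ofComplex) (1 : ℝ) := by
  intro w
  by_cases hw : 0 < w.im
  · have h1 : 0 < (w + (1 : ℝ)).im := by simpa using hw
    have := hf.add_one ⟨w, hw⟩
    simp only [Function.comp_apply, ofComplex_apply_of_im_pos hw, ofComplex_apply_of_im_pos h1]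
    rw [← this]
    congr 1
    ext
    simp [add_comm]
  · have h1 : (w + (1 : ℝ)).im ≤ 0 := by simpa using hw
    rw [Function.comp_apply, Function.comp_apply, ofComplex_apply_of_im_nonpos h1,
      ofComplex_apply_of_im_nonpos (not_lt.1 hw)]

lemma hasSum_qParam (hf : IsQS f F) (z : ℍ) : HasSum
    (fun n : ℕ => PowerSeries.coeff n F • Function.Periodic.qParam 1 (z : ℂ) ^ n) (f z) := by
  simpa [qexp_eq_qParam] using hf z

lemma unique (hf : IsQS f F) (hg : IsQS f G) : F = G := by
  have h1 : AnalyticAt ℂ (cuspFunction 1 f) 0 :=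
    analyticAt_cuspFunction_zero one_pos hf.periodic hf.mdifferentiable hf.isBoundedAtImInfty
  have h2 := (hasFPowerSeriesOnBall_cuspFunction one_pos h1 hf.hasSum_qParam).hasFPowerSeriesAt
  have h3 := (hasFPowerSeriesOnBall_cuspFunction one_pos h1 hg.hasSum_qParam).hasFPowerSeriesAt
  ext n
  simpa using congr_arg (FormalMultilinearSeries.coeff · n) (h2.eq_formalMultilinearSeries h3)

end IsQS

/-- The `q`-series of the Eisenstein series `E_k`. -/
noncomputable def eisSeries (k : ℕ) : PowerSeries ℂ :=
  PowerSeries.mk fun n => if n = 0 then 1 else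
    -(2 * k / ((bernoulli k : ℚ) : ℂ)) * (ArithmeticFunction.sigma (k - 1) n : ℂ)

lemma isQS_Eis {k : ℕ} (hk : 1 ≤ k) : IsQS (Eis k) (eisSeries k) := fun z => by
  have hS : Summable fun n : ℕ ↦
      (ArithmeticFunction.sigma (k - 1) (n + 1) : ℂ) * qexp z ^ (n + 1) :=
    (summable_nat_add_iff 1).mpr (EisensteinSeries.summable_sigma_mul_cexp_pow (k := k) hk z)
  rw [← hasSum_nat_add_iff' 1]
  convert! (hS.mul_left (-(2 * k / ((bernoulli k : ℚ) : ℂ)))).hasSum using 1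
  · ext n
    simp [eisSeries, mul_assoc]
  · rw [Eis, tsum_mul_left]
    simp [eisSeries]

lemma bernoulli_two' : bernoulli 2 = 1 / 6 := by
  rw [bernoulli_eq_bernoulli'_of_ne_one (by norm_num), bernoulli'_two]

lemma bernoulli_four : bernoulli 4 = -1 / 30 := by
  rw [bernoulli_eq_bernoulli'_of_ne_one (by norm_num), bernoulli'_four]

lemma bernoulli_six : bernoulli 6 = 1 / 42 := by
  rw [bernoulli_eq_bernoulli'_of_ne_one (by norm_num)]
  have h5 : bernoulli' 5 = 0 := bernoulli'_eq_zero_of_odd (by decide) (by norm_num)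
  rw [bernoulli'_def]
  simp [Finset.sum_range_succ, h5, Nat.choose]
  norm_num

lemma coeff_eisSeries_zero (k : ℕ) : PowerSeries.coeff 0 (eisSeries k) = 1 := by simp [eisSeries]

lemma coeff_eisSeries_two_one : PowerSeries.coeff 1 (eisSeries 2) = -24 := by
  simp [eisSeries]; norm_num

lemma coeff_eisSeries_four_one : PowerSeries.coeff 1 (eisSeries 4) = 240 := by
  simp [eisSeries, bernoulli_four]; norm_num

lemma coeff_eisSeries_six_one : PowerSeries.coeff 1 (eisSeries 6) = -504 := by
  simp [eisSeries, bernoulli_six]; norm_num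

lemma Eis_two_eq : Eis 2 = EisensteinSeries.E2 := by
  funext z
  rw [EisensteinSeries.E2_eq_tsum_cexp, Eis,
    tsum_pnat_eq_tsum_succ (f := fun n ↦ (ArithmeticFunction.sigma 1 n : ℂ) *
      cexp (2 * π * Complex.I * z) ^ n)]
  simp only [bernoulli_two', qexp]
  norm_num

lemma Eis_eq_E {k : ℕ} (hk : 3 ≤ k) (hk2 : Even k) : Eis k = ModularForm.E hk := by
  funext z
  rw [EisensteinSeries.q_expansion_bernoulli hk hk2, Eis]
  simp only [zpow_natCast]
  rw [tsum_pnat_eq_tsum_succ (f := fun n ↦ (ArithmeticFunction.sigma (k - 1) n : ℂ) *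
      cexp (2 * π * Complex.I * z) ^ n)]
  rfl

section
open scoped ModularForm

/-- Build a level one modular form from slash invariance and a `q`-series. -/
noncomputable def modularFormOfQS {k : ℤ} {f : ℍ → ℂ} {F : PowerSeries ℂ} (hf : IsQS f F)
    (hs : ∀ γ : SL(2, ℤ), f ∣[k] γ = f) : ModularForm 𝒮ℒ k where
  toFun := f
  slash_action_eq' := fun _ ⟨γ, hγ⟩ ↦ hγ ▸ hs γ
  holo' := hf.mdifferentiable
  bdd_at_cusps' {c} hc := by
    rw [Subgroup.IsArithmetic.isCusp_iff_isCusp_SL2Z] at hc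
    rw [OnePoint.isBoundedAt_iff_forall_SL2Z hc]
    intro γ _
    rw [hs γ]
    exact hf.isBoundedAtImInfty

lemma ModularForm.slash_eq_self {k : ℤ} (f : ModularForm 𝒮ℒ k) (γ : SL(2, ℤ)) :
    ⇑f ∣[k] γ = ⇑f :=
  f.slash_action_eq' _ ⟨γ, rfl⟩

lemma ModularForm.isQS_qExpansion {k : ℤ} (f : ModularForm 𝒮ℒ k) : IsQS f (qExpansion 1 f) :=
  fun z => by
    simpa [qexp_eq_qParam] using
      ModularForm.hasSum_qExpansion (f := f) one_pos one_mem_strictPeriods_SL z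

end

/-- The space of `q`-expansions of level one modular forms of weight `k`. -/
noncomputable def MF (k : ℤ) : Submodule ℂ (PowerSeries ℂ) where
  carrier := {F | ∃ f : ModularForm 𝒮ℒ k, IsQS f F}
  zero_mem' := ⟨0, fun z => by simp⟩
  add_mem' := by
    rintro F G ⟨f, hf⟩ ⟨g, hg⟩
    exact ⟨f + g, hf.add hg⟩
  smul_mem' := by
    rintro a F ⟨f, hf⟩
    exact ⟨a • f, fun z => by simpa using hf.smul a z⟩

namespace MF

lemma mul {j k : ℤ} {F G : PowerSeries ℂ} (hF : F ∈ MF j) (hG : G ∈ MF k) : F * G ∈ MF (j + k) := by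
  obtain ⟨f, hf⟩ := hF
  obtain ⟨g, hg⟩ := hG
  exact ⟨f.mul g, hf.mul hg⟩

lemma cast {j k : ℤ} {F : PowerSeries ℂ} (hF : F ∈ MF j) (h : j = k) : F ∈ MF k := h ▸ hF

lemma eisSeries_mem {k : ℕ} (hk : 3 ≤ k) (hk2 : Even k) : eisSeries k ∈ MF k :=
  ⟨ModularForm.E hk, by rw [← Eis_eq_E hk hk2]; exact isQS_Eis (by lia)⟩

lemma e4_mem : eisSeries 4 ∈ MF 4 := eisSeries_mem (by norm_num) (by decide)

lemma e6_mem : eisSeries 6 ∈ MF 6 := eisSeries_mem (by norm_num) (by decide)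

lemma sturm {k : ℤ} {F : PowerSeries ℂ} (hF : F ∈ MF k) {n : ℕ} (hn : k < 12 * n)
    (hd : PowerSeries.X ^ n ∣ F) : F = 0 := by
  rcases lt_or_ge k 0 with hk | hk
  · obtain ⟨f, hf⟩ := hF
    have : f = 0 := rank_zero_iff_forall_zero.mp (ModularForm.levelOne_neg_weight_rank_zero hk) f
    subst this
    exact hf.unique fun z => by simp
  obtain ⟨f, hf⟩ := hF
  have h1 := hf.unique f.isQS_qExpansion
  have : f = 0 := by
    apply ModularForm.sturm_bound_levelOne
    rw [← h1]
    refine lt_of_lt_of_le ?_ (PowerSeries.X_pow_dvd_iff.1 hd |> PowerSeries.nat_le_order F n)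
    have : k.toNat / 12 < n := by omega
    exact_mod_cast this
  subst this
  exact hf.unique fun z => by simp

/-- The Serre derivative of weight `k` on power series. -/
noncomputable def _root_.serrePS (k : ℂ) (F : PowerSeries ℂ) : PowerSeries ℂ :=
  theta F - (k / 12) • (eisSeries 2 * F)

lemma serre_mem {k : ℤ} {F : PowerSeries ℂ} (hF : F ∈ MF k) : serrePS k F ∈ MF (k + 2) := by
  obtain ⟨f, hf⟩ := hF
  have h : IsQS (Derivative.serreDerivative k f) (serrePS k F) := by
    have h1 := hf.qderiv.sub (((isQS_Eis (k := 2) (by norm_num)).mul hf).smul ((k : ℂ) / 12))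
    convert! h1 using 1
    funext z
    rw [Derivative.serreDerivative_apply, Eis_two_eq, Derivative.normalizedDerivOfComplex,
      qderiv, IsQS.hderiv_eq]
    ring
  exact ⟨modularFormOfQS h fun γ => Derivative.serreDerivative_slash_invariant
    hf.mdifferentiable (f.slash_eq_self γ), h⟩

end MF

section
open scoped ModularForm

lemma E2_slash_S (z : ℍ) : (EisensteinSeries.E2 ∣[(2 : ℤ)] ModularGroup.S) z =
    EisensteinSeries.E2 z + 6 / (π * Complex.I) * (z : ℂ)⁻¹ := by
  have hpi : (π : ℂ) ≠ 0 := by simp [Real.pi_ne_zero]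
  rw [EisensteinSeries.E2_slash_action]
  simp only [Pi.sub_apply, Pi.smul_apply, EisensteinSeries.D2_S, riemannZeta_two, smul_eq_mul]
  have hz := z.ne_zero
  field_simp
  linear_combination (-6) * Complex.I_sq

/-- The weight four function `D E₂ - E₂² / 12`. -/
noncomputable def derivE2 (z : ℍ) : ℂ :=
  Derivative.normalizedDerivOfComplex EisensteinSeries.E2 z - 12⁻¹ * EisensteinSeries.E2 z ^ 2

lemma normalizedDeriv_inv (a : ℂ) (z : ℍ) :
    Derivative.normalizedDerivOfComplex (fun z : ℍ => a * (z : ℂ)⁻¹) z =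
      (2 * π * Complex.I)⁻¹ * (-a * ((z : ℂ) ^ 2)⁻¹) := by
  rw [Derivative.normalizedDerivOfComplex]
  congr 1
  have h : HasDerivAt (fun w : ℂ => a * w⁻¹) (a * -((z : ℂ) ^ 2)⁻¹) z :=
    (hasDerivAt_inv z.ne_zero).const_mul a
  rw [neg_mul_comm, ← h.deriv]
  refine Filter.EventuallyEq.deriv_eq ?_
  filter_upwards [isOpen_upperHalfPlaneSet.mem_nhds z.im_pos] with w hw
  simp [ofComplex_apply_of_im_pos hw]

lemma derivE2_slash_S : derivE2 ∣[(4 : ℤ)] ModularGroup.S = derivE2 := by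
  have hE := E2_mdifferentiable
  have h1 := Derivative.normalizedDerivOfComplex_SL_slash (k := 2) hE (γ := ModularGroup.S)
  have hfun : EisensteinSeries.E2 ∣[(2 : ℤ)] ModularGroup.S =
      EisensteinSeries.E2 + fun z : ℍ => 6 / (π * Complex.I) * (z : ℂ)⁻¹ :=
    funext E2_slash_S
  have hmd : MDifferentiable 𝓘(ℂ) 𝓘(ℂ) (fun z : ℍ => 6 / (π * Complex.I) * (z : ℂ)⁻¹) := by
    intro z
    rw [mdifferentiableAt_iff]
    have h : DifferentiableAt ℂ (fun w : ℂ => 6 / (π * Complex.I) * w⁻¹) (z : ℂ) :=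
      (differentiableAt_inv z.ne_zero).const_mul _
    refine h.congr_of_eventuallyEq ?_
    filter_upwards [isOpen_upperHalfPlaneSet.mem_nhds z.im_pos] with w hw
    simp [ofComplex_apply_of_im_pos hw]
  funext z
  have h2 := congrFun h1 z
  rw [hfun, Derivative.normalizedDerivOfComplex_add _ _ hE hmd] at h2
  simp only [Pi.add_apply, Pi.sub_apply, normalizedDeriv_inv] at h2
  have h3 : ((EisensteinSeries.E2 ^ 2) ∣[(4 : ℤ)] ModularGroup.S) z =
      (EisensteinSeries.E2 z + 6 / (π * Complex.I) * (z : ℂ)⁻¹) ^ 2 := by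
    have := congrFun (ModularForm.mul_slash_SL2 2 2 ModularGroup.S EisensteinSeries.E2
      EisensteinSeries.E2) z
    rw [← pow_two] at this
    rw [show (4 : ℤ) = 2 + 2 by norm_num, this, Pi.mul_apply, E2_slash_S, pow_two]
  have h4 : (derivE2 ∣[(4 : ℤ)] ModularGroup.S) z =
      (Derivative.normalizedDerivOfComplex EisensteinSeries.E2 ∣[(4 : ℤ)] ModularGroup.S) z
        - 12⁻¹ * ((EisensteinSeries.E2 ^ 2) ∣[(4 : ℤ)] ModularGroup.S) z := by
    simp only [ModularForm.SL_slash_apply, derivE2, Pi.pow_apply]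
    ring
  have hd : denom ModularGroup.S z = z := by simp [ModularGroup.denom_S]
  have hS : ((ModularGroup.S 1 0 : ℤ) : ℂ) = 1 := by simp [ModularGroup.S]
  rw [hd] at h2
  rw [h4, h3, derivE2]
  have hpi : (π : ℂ) ≠ 0 := by simp [Real.pi_ne_zero]
  have hz := z.ne_zero
  have h5 : (Derivative.normalizedDerivOfComplex EisensteinSeries.E2 ∣[(4 : ℤ)] ModularGroup.S) z =
    Derivative.normalizedDerivOfComplex EisensteinSeries.E2 z +
      (2 * π * Complex.I)⁻¹ * (-(6 / (π * Complex.I)) * ((z : ℂ) ^ 2)⁻¹) +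
      2 * (2 * π * Complex.I)⁻¹ * (1 / z) *
        (EisensteinSeries.E2 z + 6 / (π * Complex.I) * (z : ℂ)⁻¹) := by
    rw [h2]
    norm_num [hS]
  rw [h5]
  field_simp
  ring

lemma isQS_derivE2 : IsQS derivE2 (theta (eisSeries 2) - (12⁻¹ : ℂ) • eisSeries 2 ^ 2) := by
  have h := isQS_Eis (k := 2) (by norm_num)
  convert! h.qderiv.sub ((h.pow 2).smul (12⁻¹ : ℂ)) using 1
  funext z
  rw [derivE2, Eis_two_eq, Derivative.normalizedDerivOfComplex, qderiv, IsQS.hderiv_eq]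

lemma slash_T_of_isQS {f : ℍ → ℂ} {F : PowerSeries ℂ} (hf : IsQS f F) (k : ℤ) :
    f ∣[k] ModularGroup.T = f := by
  funext z
  rw [ModularForm.SL_slash_apply, UpperHalfPlane.modular_T_smul, hf.add_one]
  have h : denom (ModularGroup.T : GL (Fin 2) ℝ) z = 1 := by
    rw [ModularGroup.denom_apply]
    simp [ModularGroup.T]
  rw [h]
  simp

lemma theta_E2 : theta (eisSeries 2) = (12⁻¹ : ℂ) • (eisSeries 2 ^ 2 - eisSeries 4) := by
  have h1 : theta (eisSeries 2) - (12⁻¹ : ℂ) • eisSeries 2 ^ 2 ∈ MF 4 :=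
    ⟨modularFormOfQS isQS_derivE2 (SlashInvariantForm.slash_action_generators_SL2Z
      derivE2_slash_S (slash_T_of_isQS isQS_derivE2 4)), isQS_derivE2⟩
  have h2 := (MF 4).add_mem h1 ((MF 4).smul_mem (12⁻¹ : ℂ) MF.e4_mem)
  have h3 := MF.sturm h2 (n := 1) (by norm_num) (by
    rw [pow_one, PowerSeries.X_dvd_iff, ← PowerSeries.coeff_zero_eq_constantCoeff_apply]
    simp only [map_add, map_sub, PowerSeries.coeff_smul, coeff_theta, coeff_eisSeries_zero]
    rw [pow_two, PowerSeries.coeff_mul]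
    simp [coeff_eisSeries_zero])
  rw [smul_sub, ← sub_eq_zero, ← h3]
  abel

end

lemma IsQS.add_natCast {f : ℍ → ℂ} {F : PowerSeries ℂ} (hf : IsQS f F) (n : ℕ) (z : ℍ) :
    f ((n : ℝ) +ᵥ z) = f z := by
  induction n with
  | zero => simp
  | succ n ih => rw [← ih, ← hf.add_one ((n : ℝ) +ᵥ z), vadd_vadd, Nat.cast_succ, add_comm]

lemma Eis_two_S_smul (z : ℍ) : Eis 2 (ModularGroup.S • z) =
    (z : ℂ) ^ 2 * (Eis 2 z + 6 / (π * Complex.I) * (z : ℂ)⁻¹) := by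
  have h := E2_slash_S z
  rw [ModularForm.SL_slash_apply, ModularGroup.denom_S] at h
  rw [Eis_two_eq, ← h]
  have hz := z.ne_zero
  simp
  field_simp

lemma ModularForm.S_smul_eq {k : ℤ} (f : ModularForm 𝒮ℒ k) (z : ℍ) :
    f (ModularGroup.S • z) = (z : ℂ) ^ k * f z := by
  have h := congrFun (f.slash_eq_self ModularGroup.S) z
  rw [ModularForm.SL_slash_apply, ModularGroup.denom_S] at h
  rw [← h]
  have hz := zpow_ne_zero k z.ne_zero
  simp
  field_simp

/-- The linear map `(h_ℓ) ↦ ∑ E₂^ℓ h_ℓ`. -/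
noncomputable def quasiMap (w : ℤ) (r : ℕ) :
    ((ℓ : Fin (r + 1)) → ModularForm 𝒮ℒ (w - 2 * (ℓ : ℕ))) →ₗ[ℂ] (ℍ → ℂ) where
  toFun h z := ∑ ℓ : Fin (r + 1), Eis 2 z ^ (ℓ : ℕ) * h ℓ z
  map_add' h h' := by
    funext z
    simp [mul_add, Finset.sum_add_distrib]
  map_smul' a h := by
    funext z
    simp only [Pi.smul_apply, _root_.smul_apply, smul_eq_mul, RingHom.id_apply,
      Finset.mul_sum]
    exact Finset.sum_congr rfl fun ℓ _ => by ring

lemma quasiMap_injective (w : ℤ) (r : ℕ) : Function.Injective (quasiMap w r) := by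
  rw [← LinearMap.ker_eq_bot, LinearMap.ker_eq_bot']
  intro h hh
  have h0 : ∀ z : ℍ, ∑ ℓ : Fin (r + 1), Eis 2 z ^ (ℓ : ℕ) * h ℓ z = 0 := fun z => congrFun hh z
  have h1 : ∀ z : ℍ, ∑ ℓ : Fin (r + 1),
      (Eis 2 z + 6 / (π * Complex.I) * (z : ℂ)⁻¹) ^ (ℓ : ℕ) * h ℓ z = 0 := by
    intro z
    have hz := zpow_ne_zero w z.ne_zero
    refine (mul_eq_zero.1 ?_).resolve_left hz
    rw [← h0 (ModularGroup.S • z), Finset.mul_sum]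
    refine Finset.sum_congr rfl fun ℓ _ => ?_
    rw [Eis_two_S_smul, ModularForm.S_smul_eq, mul_pow, ← pow_mul, zpow_sub₀ z.ne_zero]
    have hz2 := z.ne_zero
    have : (z : ℂ) ^ (2 * ((ℓ : ℕ) : ℤ)) = (z : ℂ) ^ (2 * (ℓ : ℕ)) := by
      rw [← zpow_natCast]; push_cast; rfl
    rw [this]
    field_simp
  have hpi : (π : ℂ) ≠ 0 := by simp [Real.pi_ne_zero]
  have h2 : ∀ z : ℍ, ∀ ℓ, h ℓ z = 0 := by
    intro z
    set Q : Polynomial ℂ := ∑ ℓ : Fin (r + 1), Polynomial.C (h ℓ z) * Polynomial.X ^ (ℓ : ℕ)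
      with hQ
    have hroot : ∀ n : ℕ, Q.eval (Eis 2 z + 6 / (π * Complex.I) * ((n : ℂ) + z)⁻¹) = 0 := by
      intro n
      have := h1 ((n : ℝ) +ᵥ z)
      rw [(isQS_Eis (k := 2) (by norm_num)).add_natCast] at this
      rw [hQ, Polynomial.eval_finsetSum, ← this]
      refine Finset.sum_congr rfl fun ℓ _ => ?_
      rw [(h ℓ).isQS_qExpansion.add_natCast]
      rw [Polynomial.eval_mul, Polynomial.eval_C, Polynomial.eval_pow, Polynomial.eval_X, mul_comm,
        UpperHalfPlane.coe_vadd, Complex.ofReal_natCast]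
    have hne : ∀ n : ℕ, (n : ℂ) + z ≠ 0 := fun n => by
      have := ((n : ℝ) +ᵥ z).ne_zero
      simpa using this
    have hQ0 : Q = 0 := by
      refine Polynomial.eq_zero_of_infinite_isRoot Q (Set.infinite_of_injective_forall_mem
        (f := fun n : ℕ => Eis 2 z + 6 / (π * Complex.I) * ((n : ℂ) + z)⁻¹) ?_ hroot)
      intro a b hab
      have h6 : (6 / (π * Complex.I) : ℂ) ≠ 0 := by
        simp [Real.pi_ne_zero]
      have := mul_left_cancel₀ h6 (add_left_cancel hab)
      have := inv_injective this
      simpa using this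
    intro ℓ
    have := congrArg (fun P : Polynomial ℂ => P.coeff (ℓ : ℕ)) hQ0
    simp only [hQ, Polynomial.finsetSum_coeff, Polynomial.coeff_C_mul, Polynomial.coeff_X_pow,
      Polynomial.coeff_zero] at this
    rw [Finset.sum_eq_single ℓ] at this
    · simpa using this
    · intro b _ hb
      have : (ℓ : ℕ) ≠ b := fun h => hb (Fin.ext h.symm)
      simp [this]
    · simp
  funext ℓ
  ext z
  exact h2 z ℓ

lemma mem_Mset_iff {w : ℤ} {f : ℍ → ℂ} : f ∈ Mset w ↔ ∃ F : ModularForm 𝒮ℒ w, ⇑F = f := by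
  have hΓ : ((⊤ : Subgroup SL(2, ℤ)) : Subgroup (GL (Fin 2) ℝ)) = 𝒮ℒ :=
    (MonoidHom.range_eq_map _).symm
  constructor
  · rintro ⟨F, rfl⟩
    exact ⟨ModularForm.mcast rfl F hΓ.symm, rfl⟩
  · rintro ⟨F, rfl⟩
    exact ⟨ModularForm.mcast rfl F hΓ, rfl⟩

lemma QM_eq_range (w : ℤ) (r : ℕ) : QM w r = LinearMap.range (quasiMap w r) := by
  have : QMset w r = LinearMap.range (quasiMap w r) := by
    ext f
    constructor
    · rintro ⟨h, hh, hf⟩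
      have hh' := fun ℓ : Fin (r + 1) => mem_Mset_iff.1 (hh ℓ (by lia))
      choose F hF using hh'
      refine ⟨F, funext fun z => ?_⟩
      rw [hf z, Finset.sum_range]
      change ∑ ℓ : Fin (r + 1), Eis 2 z ^ (ℓ : ℕ) * F ℓ z = _
      exact Finset.sum_congr rfl fun ℓ _ => by rw [hF]
    · rintro ⟨F, rfl⟩
      refine ⟨fun ℓ => if hℓ : ℓ < r + 1 then F ⟨ℓ, hℓ⟩ else 0, fun ℓ hℓ => ?_, fun z => ?_⟩
      · have hℓ' : ℓ < r + 1 := by lia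
        simp only [hℓ', dite_true]
        exact mem_Mset_iff.2 ⟨F ⟨ℓ, hℓ'⟩, rfl⟩
      · rw [Finset.sum_range]
        change ∑ ℓ : Fin (r + 1), Eis 2 z ^ (ℓ : ℕ) * F ℓ z = _
        exact Finset.sum_congr rfl fun ℓ _ => by
          beta_reduce
          rw [dif_pos ℓ.isLt]
  rw [QM, this, Submodule.span_eq]

lemma dimQM_eq (w : ℤ) (r : ℕ) :
    dimQM w r = ∑ ℓ : Fin (r + 1), Module.finrank ℂ (ModularForm 𝒮ℒ (w - 2 * (ℓ : ℕ))) := by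
  rw [dimQM, QM_eq_range, LinearMap.finrank_range_of_inj (quasiMap_injective w r),
    Module.finrank_pi_fintype]

lemma finrank_modularForm {k : ℤ} (j : ℕ) (h : k = j) (hj : Even j) :
    Module.finrank ℂ (ModularForm 𝒮ℒ k) = if j % 12 = 2 then j / 12 else j / 12 + 1 := by
  subst h
  have := ModularForm.dimension_level_one j hj
  rw [Module.finrank, this]
  have h2 : (j ≡ 2 [MOD 12]) ↔ j % 12 = 2 := Iff.rfl
  simp only [h2]
  split_ifs <;> simp

lemma serrePS_eq (k : ℂ) (F : PowerSeries ℂ) :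
    serrePS k F = theta F - PowerSeries.C (k / 12) * (eisSeries 2 * F) := by
  rw [serrePS, PowerSeries.smul_eq_C_mul]

/-- The Serre derivative on vectors, with the nilpotent part shifting the index. -/
noncomputable def serreVec (k : ℂ) (y : ℕ → PowerSeries ℂ) : ℕ → PowerSeries ℂ
  | 0 => serrePS k (y 0)
  | (ℓ + 1) => serrePS k (y (ℓ + 1)) + y ℓ

/-- Iterated Serre derivative on vectors. -/
noncomputable def serreVecIter (k : ℂ) (y : ℕ → PowerSeries ℂ) : ℕ → ℕ → PowerSeries ℂ
  | 0 => y
  | (j + 1) => serreVec (k + 2 * j) (serreVecIter k y j)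

/-- The vector attached to the quasimodular form `∑ E₂^ℓ h_ℓ` of depth at most three. -/
def IsVecOf (h y : ℕ → PowerSeries ℂ) : Prop :=
  y 0 = h 0 + eisSeries 2 * h 1 + eisSeries 2 ^ 2 * h 2 + eisSeries 2 ^ 3 * h 3 ∧
  y 1 = 4 * (h 1 + 2 * eisSeries 2 * h 2 + 3 * eisSeries 2 ^ 2 * h 3) ∧
  y 2 = 24 * (h 2 + 3 * eisSeries 2 * h 3) ∧
  y 3 = 288 * h 3

/-- The modular coefficients of the Serre derivative of a quasimodular vector. -/
noncomputable def serreTuple (w : ℤ) (h : ℕ → PowerSeries ℂ) : ℕ → PowerSeries ℂ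
  | 0 => serrePS w (h 0) - PowerSeries.C (1 / 12) * (eisSeries 4 * h 1)
  | 1 => serrePS (w - 2) (h 1) + PowerSeries.C (3 / 12) * h 0 -
      PowerSeries.C (2 / 12) * (eisSeries 4 * h 2)
  | 2 => serrePS (w - 4) (h 2) + PowerSeries.C (2 / 12) * h 1 -
      PowerSeries.C (3 / 12) * (eisSeries 4 * h 3)
  | 3 => serrePS (w - 6) (h 3) + PowerSeries.C (1 / 12) * h 2
  | _ => 0

/-- `h` is a tuple of modular forms of weights `w - 2 ℓ`, `ℓ ≤ 3`. -/
def IsTuple (w : ℤ) (h : ℕ → PowerSeries ℂ) : Prop := ∀ ℓ ≤ 3, h ℓ ∈ MF (w - 2 * (ℓ : ℕ))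

lemma MF.C_mul {k : ℤ} {F : PowerSeries ℂ} (hF : F ∈ MF k) (a : ℂ) : PowerSeries.C a * F ∈ MF k := by
  rw [← PowerSeries.smul_eq_C_mul]; exact (MF k).smul_mem a hF

lemma IsTuple.serre {w : ℤ} {h : ℕ → PowerSeries ℂ} (hh : IsTuple w h) :
    IsTuple (w + 2) (serreTuple w h) := by
  have h0 := hh 0 (by norm_num)
  have h1 := hh 1 (by norm_num)
  have h2 := hh 2 (by norm_num)
  have h3 := hh 3 (by norm_num)
  have s0 := MF.serre_mem h0
  have s1 := MF.serre_mem h1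
  have s2 := MF.serre_mem h2
  have s3 := MF.serre_mem h3
  have e1 := MF.mul MF.e4_mem h1
  have e2 := MF.mul MF.e4_mem h2
  have e3 := MF.mul MF.e4_mem h3
  push_cast at s0 s1 s2 s3
  norm_num at s0 s1 s2 s3
  intro ℓ hℓ
  interval_cases ℓ
  · exact Submodule.sub_mem _ (MF.cast s0 (by ring)) (MF.C_mul (MF.cast e1 (by push_cast; ring)) _)
  · exact Submodule.sub_mem _ (Submodule.add_mem _ (MF.cast s1 (by push_cast; ring))
      (MF.C_mul (MF.cast h0 (by push_cast; ring)) _)) (MF.C_mul (MF.cast e2 (by push_cast; ring)) _)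
  · exact Submodule.sub_mem _ (Submodule.add_mem _ (MF.cast s2 (by push_cast; ring))
      (MF.C_mul (MF.cast h1 (by push_cast; ring)) _)) (MF.C_mul (MF.cast e3 (by push_cast; ring)) _)
  · exact Submodule.add_mem _ (MF.cast s3 (by push_cast; ring))
      (MF.C_mul (MF.cast h2 (by push_cast; ring)) _)

lemma theta_E2' : theta (eisSeries 2) = PowerSeries.C (12⁻¹ : ℂ) * (eisSeries 2 ^ 2 - eisSeries 4) := by
  rw [theta_E2, PowerSeries.smul_eq_C_mul]

lemma C_inv_twelve : (12 : PowerSeries ℂ) * PowerSeries.C (12⁻¹ : ℂ) = 1 := by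
  rw [← map_ofNat (PowerSeries.C (R := ℂ)) 12, ← map_mul]; norm_num

lemma theta_ofNat (n : ℕ) [n.AtLeastTwo] : theta (OfNat.ofNat n : PowerSeries ℂ) = 0 := by
  rw [← map_ofNat (PowerSeries.C (R := ℂ)) n]
  exact theta.map_algebraMap _

lemma IsVecOf.serre {w : ℤ} {h y : ℕ → PowerSeries ℂ} (hy : IsVecOf h y) :
    IsVecOf (serreTuple w h) (serreVec (w - 3) y) := by
  obtain ⟨y0, y1, y2, y3⟩ := hy
  have hC := C_inv_twelve
  have t2 : theta (2 : PowerSeries ℂ) = 0 := theta_ofNat 2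
  have t3 : theta (3 : PowerSeries ℂ) = 0 := theta_ofNat 3
  have t4 : theta (4 : PowerSeries ℂ) = 0 := theta_ofNat 4
  have t24 : theta (24 : PowerSeries ℂ) = 0 := theta_ofNat 24
  have t288 : theta (288 : PowerSeries ℂ) = 0 := theta_ofNat 288
  refine ⟨?_, ?_, ?_, ?_⟩ <;>
  simp only [serreVec, serreTuple, serrePS_eq, y0, y1, y2, y3, div_eq_mul_inv, map_mul, map_sub,
    map_add, Derivation.leibniz, Derivation.leibniz_pow, theta_E2', smul_eq_mul, map_ofNat,
    t2, t3, t4, t24, t288, nsmul_eq_mul, map_one]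
  · push_cast
    ring
  · push_cast
    linear_combination (-(h 0 + eisSeries 2 * h 1 + eisSeries 2 ^ 2 * h 2 + eisSeries 2 ^ 3 * h 3)) * hC
  · linear_combination (-4 * (h 1 + 2 * eisSeries 2 * h 2 + 3 * eisSeries 2 ^ 2 * h 3)) * hC
  · linear_combination (-24*(h 2 + 3 * eisSeries 2 * h 3)) * hC

lemma X_pow_dvd_theta {n : ℕ} {F : PowerSeries ℂ} (h : PowerSeries.X ^ n ∣ F) :
    PowerSeries.X ^ n ∣ theta F := by
  rw [PowerSeries.X_pow_dvd_iff] at h ⊢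
  intro m hm
  rw [coeff_theta, h m hm, mul_zero]

lemma X_pow_dvd_serrePS {n : ℕ} {F : PowerSeries ℂ} (k : ℂ) (h : PowerSeries.X ^ n ∣ F) :
    PowerSeries.X ^ n ∣ serrePS k F := by
  rw [serrePS_eq]
  exact dvd_sub (X_pow_dvd_theta h) (Dvd.dvd.mul_left (Dvd.dvd.mul_left h _) _)

/-- Componentwise lower bounds for the vanishing orders of a vector. -/
def OrdGE (lam : ℕ → ℕ) (y : ℕ → PowerSeries ℂ) : Prop :=
  ∀ ℓ ≤ 3, PowerSeries.X ^ lam ℓ ∣ y ℓ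

lemma OrdGE.serreVec {lam : ℕ → ℕ} {y : ℕ → PowerSeries ℂ} (hl : ∀ ℓ < 3, lam (ℓ + 1) ≤ lam ℓ)
    (h : OrdGE lam y) (k : ℂ) : OrdGE lam (serreVec k y) := by
  rintro (_ | ℓ) hℓ
  · exact X_pow_dvd_serrePS k (h 0 hℓ)
  · exact dvd_add (X_pow_dvd_serrePS k (h _ hℓ))
      ((pow_dvd_pow _ (hl ℓ (by lia))).trans (h ℓ (by lia)))

lemma OrdGE.serreVecIter {lam : ℕ → ℕ} {y : ℕ → PowerSeries ℂ}
    (hl : ∀ ℓ < 3, lam (ℓ + 1) ≤ lam ℓ) (h : OrdGE lam y) (k : ℂ) (j : ℕ) :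
    OrdGE lam (serreVecIter k y j) := by
  induction j with
  | zero => exact h
  | succ j ih => exact ih.serreVec hl _

/-- Iterates of `serreTuple`. -/
noncomputable def serreTupleIter (w : ℤ) (h : ℕ → PowerSeries ℂ) : ℕ → ℕ → PowerSeries ℂ
  | 0 => h
  | (j + 1) => serreTuple (w + 2 * j) (serreTupleIter w h j)

lemma IsTuple.serreIter {w : ℤ} {h : ℕ → PowerSeries ℂ} (hh : IsTuple w h) (j : ℕ) :
    IsTuple (w + 2 * j) (serreTupleIter w h j) := by
  induction j with
  | zero => simpa [serreTupleIter] using hh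
  | succ j ih =>
    have := ih.serre
    rw [show w + 2 * ((j + 1 : ℕ) : ℤ) = w + 2 * j + 2 by push_cast; ring]
    exact this

lemma IsVecOf.serreIter {w : ℤ} {h y : ℕ → PowerSeries ℂ} (hy : IsVecOf h y) (j : ℕ) :
    IsVecOf (serreTupleIter w h j) (serreVecIter (w - 3) y j) := by
  induction j with
  | zero => exact hy
  | succ j ih =>
    have := ih.serre (w := w + 2 * j)
    simp only [serreTupleIter, serreVecIter]
    convert! this using 2
    push_cast
    ring

lemma MF.one_mem : (1 : PowerSeries ℂ) ∈ MF 0 :=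
  ⟨1, IsQS.one⟩

lemma MF.prod {ι : Type*} (s : Finset ι) (k : ι → ℤ) (F : ι → PowerSeries ℂ)
    (h : ∀ i ∈ s, F i ∈ MF (k i)) : ∏ i ∈ s, F i ∈ MF (∑ i ∈ s, k i) := by
  classical
  induction s using Finset.induction_on with
  | empty => simpa using MF.one_mem
  | insert a s ha ih =>
    rw [Finset.prod_insert ha, Finset.sum_insert ha]
    exact MF.mul (h a (by simp)) (ih fun i hi => h i (by simp [hi]))

/-- A combination of `x`, `y` with vanishing leading part cannot be a square. -/
lemma wronskian_ne_sq {x : PowerSeries ℂ} (hx : x ≠ 0) (y : PowerSeries ℂ) :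
    x * theta y - y * theta x ≠ x ^ 2 := by
  intro h
  obtain ⟨n, u, hu, rfl⟩ : ∃ (n : ℕ) (u : PowerSeries ℂ), PowerSeries.coeff 0 u ≠ 0 ∧
      x = PowerSeries.X ^ n * u := by
    refine ⟨x.order.toNat, PowerSeries.divXPowOrder x, ?_, ?_⟩
    · rw [PowerSeries.coeff_zero_eq_constantCoeff_apply]
      exact fun h0 => hx (PowerSeries.constantCoeff_divXPowOrder_eq_zero_iff.1 h0)
    · exact (PowerSeries.X_pow_order_mul_divXPowOrder).symm
  have hinv : u * u⁻¹ = 1 := PowerSeries.mul_inv_cancel u (by simpa using hu)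
  obtain ⟨v, rfl⟩ : ∃ v, y = v * u := ⟨y * u⁻¹, by rw [mul_assoc, mul_comm u⁻¹, hinv, mul_one]⟩
  have hX : theta ((PowerSeries.X : PowerSeries ℂ) ^ n) =
      (n : PowerSeries ℂ) * PowerSeries.X ^ n := by
    ext m
    rw [coeff_theta, ← map_natCast (PowerSeries.C (R := ℂ)), PowerSeries.coeff_C_mul,
      PowerSeries.coeff_X_pow]
    split_ifs with hm
    · rw [hm]
    · simp
  have hu0 : u ≠ 0 := by rintro rfl; simp at hu
  have h2 : (PowerSeries.X ^ n * u ^ 2) * (theta v - (n : PowerSeries ℂ) * v) =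
      (PowerSeries.X ^ n * u ^ 2) * PowerSeries.X ^ n := by
    simp only [Derivation.leibniz, smul_eq_mul, hX] at h
    linear_combination h
  have h3 := mul_left_cancel₀ (mul_ne_zero (pow_ne_zero _ PowerSeries.X_ne_zero)
    (pow_ne_zero _ hu0)) h2
  have h4 := congrArg (PowerSeries.coeff n) h3
  rw [map_sub, coeff_theta, ← map_natCast (PowerSeries.C (R := ℂ)), PowerSeries.coeff_C_mul,
    PowerSeries.coeff_X_pow] at h4
  simp at h4

/-- The bilinear pairing on the first four components. -/
noncomputable def dot (c v : ℕ → PowerSeries ℂ) : PowerSeries ℂ := ∑ ℓ ∈ range 4, c ℓ * v ℓ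

lemma dot_serreVec {c v : ℕ → PowerSeries ℂ} (h4 : c 4 = 0) (k : ℂ) :
    dot (fun ℓ => theta (c ℓ) - c (ℓ + 1)) v =
      theta (dot c v) - PowerSeries.C (k / 12) * eisSeries 2 * dot c v - dot c (serreVec k v) := by
  simp only [dot, sum_range_succ, sum_range_zero, serreVec, serrePS_eq, map_add,
    Derivation.leibniz, smul_eq_mul, h4, zero_add]
  ring

lemma eq_zero_of_dot (y : ℕ → PowerSeries ℂ) (k : ℂ) (t : ℕ) : ∀ (n : ℕ) (c : ℕ → PowerSeries ℂ),
    t ≤ 3 → t < n → (∀ ℓ, t < ℓ → c ℓ = 0) → c t ≠ 0 →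
    (∀ j < n, dot c (serreVecIter k y j) = 0) → y 0 = 0 := by
  induction t with
  | zero =>
    intro n c _ hn hc hc0 h
    have := h 0 hn
    simp only [dot, serreVecIter, sum_range_succ, sum_range_zero, hc 1 one_pos, hc 2 two_pos,
      hc 3 three_pos] at this
    simpa [hc0] using this
  | succ t ih =>
    rintro (_ | n) c ht hn hc hct h
    · lia
    · refine ih n (fun ℓ => c (t + 1) * (theta (c ℓ) - c (ℓ + 1)) - theta (c (t + 1)) * c ℓ)
        (by lia) (by lia) ?_ ?_ ?_
      · intro ℓ hℓ
        rcases (show t + 1 ≤ ℓ from hℓ).eq_or_lt with rfl | h'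
        · simp only [hc (t + 1 + 1) (by lia)]
          ring
        · simp [hc ℓ h', hc (ℓ + 1) (by lia)]
      · intro h0
        apply wronskian_ne_sq hct (c t)
        linear_combination h0
      · intro j hj
        have e := dot_serreVec (v := serreVecIter k y j) (hc 4 (by lia)) (k + 2 * j)
        have e1 := h j (by lia)
        have e2 := h (j + 1) (by lia)
        rw [show serreVecIter k y (j + 1) = serreVec (k + 2 * j) (serreVecIter k y j) from rfl] at e2
        rw [e1, e2] at e
        simp only [map_zero, mul_zero, sub_zero] at e
        have : dot (fun ℓ => c (t + 1) * (theta (c ℓ) - c (ℓ + 1)) - theta (c (t + 1)) * c ℓ)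
            (serreVecIter k y j) = c (t + 1) * dot (fun ℓ => theta (c ℓ) - c (ℓ + 1))
              (serreVecIter k y j) - theta (c (t + 1)) * dot c (serreVecIter k y j) := by
          simp only [dot, mul_sum, ← sum_sub_distrib]
          exact sum_congr rfl fun _ _ => by ring
        rw [this, e, e1]
        simp

/-- The vectors attached to quasimodular forms of weight `w` and depth at most three. -/
def IsQ (w : ℤ) (y : ℕ → PowerSeries ℂ) : Prop := ∃ h, IsTuple w h ∧ IsVecOf h y

/-- Change of basis from the modular coefficients to the vector. -/
noncomputable def vecMatrix : Matrix (Fin 4) (Fin 4) (PowerSeries ℂ) :=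
  !![1, 0, 0, 0; eisSeries 2, 4, 0, 0; eisSeries 2 ^ 2, 8 * eisSeries 2, 24, 0;
    eisSeries 2 ^ 3, 12 * eisSeries 2 ^ 2, 72 * eisSeries 2, 288]

lemma det_vecMatrix : vecMatrix.det = 27648 := by
  simp [vecMatrix, Matrix.det_succ_row_zero, Fin.sum_univ_succ]
  norm_num

/-- Zero estimate for quasimodular vectors. -/
theorem zero_estimate {w : ℤ} {y : ℕ → PowerSeries ℂ} (hy : IsQ w y) {lam : ℕ → ℕ}
    (hl : ∀ ℓ < 3, lam (ℓ + 1) ≤ lam ℓ) (ho : OrdGE lam y)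
    (hw : w < 3 * (lam 0 + lam 1 + lam 2 + lam 3)) : y 0 = 0 := by
  obtain ⟨h, hh, hv⟩ := hy
  set Y : Matrix (Fin 4) (Fin 4) (PowerSeries ℂ) :=
    fun j ℓ => serreVecIter (w - 3) y j ℓ with hY
  set H : Matrix (Fin 4) (Fin 4) (PowerSeries ℂ) := fun j ℓ => serreTupleIter w h j ℓ with hH
  have hYH : Y = H * vecMatrix := by
    ext1 j ℓ
    obtain ⟨e0, e1, e2, e3⟩ := hv.serreIter (w := w) j
    rw [Matrix.mul_apply, Fin.sum_univ_four]
    fin_cases ℓ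
    · simp [hY, hH, vecMatrix, e0]; ring
    · simp [hY, hH, vecMatrix, e1]; ring
    · simp [hY, hH, vecMatrix, e2]; ring
    · simp [hY, hH, vecMatrix, e3]; ring
  have hHm : H.det ∈ MF (4 * w) := by
    rw [Matrix.det_apply]
    refine Submodule.sum_mem _ fun σ _ => ?_
    have : ∏ i, H (σ i) i ∈ MF (4 * w) := by
      refine MF.cast (MF.prod univ (fun i : Fin 4 => w + 2 * ((σ i : ℕ) : ℤ) - 2 * ((i : ℕ) : ℤ)) _
        fun i _ => hh.serreIter (σ i) i (by lia)) ?_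
      rw [sum_sub_distrib, sum_add_distrib, Equiv.sum_comp σ (fun i : Fin 4 => 2 * ((i : ℕ) : ℤ))]
      simp
    rcases Int.units_eq_one_or (Equiv.Perm.sign σ) with e | e <;> rw [e]
    · simpa using this
    · simpa using this
  have hYd : PowerSeries.X ^ (lam 0 + lam 1 + lam 2 + lam 3) ∣ Y.det := by
    rw [Matrix.det_apply]
    refine dvd_sum fun σ _ => ?_
    have : PowerSeries.X ^ (lam 0 + lam 1 + lam 2 + lam 3) ∣ ∏ i, Y (σ i) i := by
      have e : (PowerSeries.X : PowerSeries ℂ) ^ (lam 0 + lam 1 + lam 2 + lam 3) =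
          ∏ i : Fin 4, PowerSeries.X ^ lam i := by
        rw [Fin.prod_univ_four]; simp [pow_add]
      rw [e]
      exact prod_dvd_prod_of_dvd _ _ fun i _ => ho.serreVecIter hl _ (σ i) i (by lia)
    rcases Int.units_eq_one_or (Equiv.Perm.sign σ) with e | e <;> rw [e]
    · simpa using this
    · simpa using this
  have hd : Y.det = H.det * 27648 := by rw [hYH, Matrix.det_mul, det_vecMatrix]
  have hu : IsUnit (27648 : PowerSeries ℂ) := by
    rw [← map_ofNat (PowerSeries.C (R := ℂ)) 27648]
    exact (IsUnit.mk0 (27648 : ℂ) (by norm_num)).map _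
  rw [hd, hu.dvd_mul_right] at hYd
  have hH0 := MF.sturm hHm (by push_cast; linarith) hYd
  rw [hH0, zero_mul] at hd
  obtain ⟨c, hc, hYc⟩ := Matrix.exists_mulVec_eq_zero_iff.2 hd
  set c' : ℕ → PowerSeries ℂ := fun ℓ => if h : ℓ < 4 then c ⟨ℓ, h⟩ else 0 with hc'
  have hdot : ∀ j < 4, dot c' (serreVecIter (w - 3) y j) = 0 := by
    intro j hj
    have := congrFun hYc ⟨j, hj⟩
    rw [Matrix.mulVec, dotProduct, Fin.sum_univ_four] at this
    simp only [dot, sum_range_succ, sum_range_zero, hc']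
    simp only [hY] at this
    simpa [mul_comm] using this
  have key : ∃ t ≤ 3, c' t ≠ 0 ∧ ∀ ℓ, t < ℓ → c' ℓ = 0 := by
    have h5 : ∀ ℓ, 3 < ℓ → c' ℓ = 0 := fun ℓ hℓ => by simp [hc', show ¬ ℓ < 4 by lia]
    by_cases a3 : c' 3 = 0
    · have h4 : ∀ ℓ, 2 < ℓ → c' ℓ = 0 := fun ℓ hℓ => by
        rcases (show 3 ≤ ℓ from hℓ).eq_or_lt with rfl | h
        exacts [a3, h5 _ h]
      by_cases a2 : c' 2 = 0
      · have h3 : ∀ ℓ, 1 < ℓ → c' ℓ = 0 := fun ℓ hℓ => by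
          rcases (show 2 ≤ ℓ from hℓ).eq_or_lt with rfl | h
          exacts [a2, h4 _ h]
        by_cases a1 : c' 1 = 0
        · have h2 : ∀ ℓ, 0 < ℓ → c' ℓ = 0 := fun ℓ hℓ => by
            rcases (show 1 ≤ ℓ from hℓ).eq_or_lt with rfl | h
            exacts [a1, h3 _ h]
          by_cases a0 : c' 0 = 0
          · exfalso
            apply hc
            ext1 i
            fin_cases i
            exacts [a0, a1, a2, a3]
          · exact ⟨0, by lia, a0, h2⟩
        · exact ⟨1, by lia, a1, h3⟩
      · exact ⟨2, by lia, a2, h4⟩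
    · exact ⟨3, le_rfl, a3, h5⟩
  obtain ⟨t, ht, hct, hc0⟩ := key
  exact eq_zero_of_dot y (w - 3) t 4 c' ht (by lia) hc0 hct hdot

namespace IsQ

variable {w : ℤ} {y v : ℕ → PowerSeries ℂ}

lemma add (hy : IsQ w y) (hv : IsQ w v) : IsQ w (fun ℓ => y ℓ + v ℓ) := by
  obtain ⟨h, hh, a0, a1, a2, a3⟩ := hy
  obtain ⟨g, hg, b0, b1, b2, b3⟩ := hv
  refine ⟨fun ℓ => h ℓ + g ℓ, fun ℓ hℓ => Submodule.add_mem _ (hh ℓ hℓ) (hg ℓ hℓ), ?_, ?_, ?_, ?_⟩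
  · simp only [a0, b0]; ring
  · simp only [a1, b1]; ring
  · simp only [a2, b2]; ring
  · simp only [a3, b3]; ring

lemma mul_left {j : ℤ} {F : PowerSeries ℂ} (hF : F ∈ MF j) (hy : IsQ w y) :
    IsQ (w + j) (fun ℓ => F * y ℓ) := by
  obtain ⟨h, hh, a0, a1, a2, a3⟩ := hy
  refine ⟨fun ℓ => F * h ℓ, fun ℓ hℓ => MF.cast (MF.mul hF (hh ℓ hℓ)) (by ring), ?_, ?_, ?_, ?_⟩
  · simp only [a0]; ring
  · simp only [a1]; ring
  · simp only [a2]; ring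
  · simp only [a3]; ring

lemma C_mul (hy : IsQ w y) (a : ℂ) : IsQ w (fun ℓ => PowerSeries.C a * y ℓ) := by
  have := hy.mul_left (MF.C_mul MF.one_mem a)
  simpa using this

lemma cast {w' : ℤ} (hy : IsQ w y) (h : w = w') : IsQ w' y := h ▸ hy

lemma iter (hy : IsQ w y) (j : ℕ) : IsQ (w + 2 * j) (serreVecIter (w - 3) y j) := by
  obtain ⟨h, hh, hv⟩ := hy
  exact ⟨_, hh.serreIter j, hv.serreIter j⟩

lemma eq_zero (hy : IsQ w y) (h0 : y 0 = 0) : ∀ ℓ ≤ 3, y ℓ = 0 := by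
  obtain ⟨h, hh, a0, a1, a2, a3⟩ := hy
  have hh' := fun ℓ : Fin 4 => hh ℓ (by lia)
  choose F hF using hh'
  have hE := isQS_Eis (k := 2) (by norm_num)
  have key : quasiMap w 3 F = 0 := by
    refine IsQS.funext_of_eq (F := 0) ?_ IsQS.zero
    rw [← h0, a0]
    have := (((hF 0).add (hE.mul (hF 1))).add ((hE.pow 2).mul (hF 2))).add ((hE.pow 3).mul (hF 3))
    convert! this using 1
    funext z
    change ∑ ℓ : Fin 4, Eis 2 z ^ (ℓ : ℕ) * F ℓ z = _
    simp [Fin.sum_univ_four]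
  have hF0 : F = 0 := quasiMap_injective w 3 (by rw [key, map_zero])
  have hz : ∀ ℓ : Fin 4, h ℓ = 0 := by
    intro ℓ
    have h2 := hF ℓ
    rw [hF0] at h2
    exact h2.unique fun z => by simp
  have z0 : h 0 = 0 := hz 0
  have z1 : h 1 = 0 := hz 1
  have z2 : h 2 = 0 := hz 2
  have z3 : h 3 = 0 := hz 3
  intro ℓ hℓ
  interval_cases ℓ
  · exact h0
  · rw [a1, z1, z2, z3]; simp
  · rw [a2, z2, z3]; simp
  · rw [a3, z3]; simp

end IsQ

/-- The vector attached to a tuple of power series. -/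
noncomputable def vecOf (h : ℕ → PowerSeries ℂ) : ℕ → PowerSeries ℂ
  | 0 => h 0 + eisSeries 2 * h 1 + eisSeries 2 ^ 2 * h 2 + eisSeries 2 ^ 3 * h 3
  | 1 => 4 * (h 1 + 2 * eisSeries 2 * h 2 + 3 * eisSeries 2 ^ 2 * h 3)
  | 2 => 24 * (h 2 + 3 * eisSeries 2 * h 3)
  | 3 => 288 * h 3
  | _ => 0

lemma isVecOf_vecOf (h : ℕ → PowerSeries ℂ) : IsVecOf h (vecOf h) := ⟨rfl, rfl, rfl, rfl⟩

lemma vecOf_add (h g : ℕ → PowerSeries ℂ) (ℓ : ℕ) : vecOf (h + g) ℓ = vecOf h ℓ + vecOf g ℓ := by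
  rcases ℓ with _ | _ | _ | _ | ℓ <;> simp [vecOf] <;> ring

lemma vecOf_smul (a : ℂ) (h : ℕ → PowerSeries ℂ) (ℓ : ℕ) : vecOf (a • h) ℓ = a • vecOf h ℓ := by
  rcases ℓ with _ | _ | _ | _ | ℓ <;> simp [vecOf, PowerSeries.smul_eq_C_mul] <;> ring

/-- The `q`-expansion as a linear map. -/
noncomputable def qSeries (k : ℤ) : ModularForm 𝒮ℒ k →ₗ[ℂ] PowerSeries ℂ where
  toFun f := qExpansion 1 f
  map_add' f g := (f + g).isQS_qExpansion.unique (f.isQS_qExpansion.add g.isQS_qExpansion)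
  map_smul' a f := (a • f).isQS_qExpansion.unique (f.isQS_qExpansion.smul a)

/-- The power series tuple attached to a tuple of modular forms. -/
noncomputable def tupleSeries (w : ℤ) :
    ((ℓ : Fin 4) → ModularForm 𝒮ℒ (w - 2 * (ℓ : ℕ))) →ₗ[ℂ] (ℕ → PowerSeries ℂ) where
  toFun F ℓ := if h : ℓ < 4 then qSeries _ (F ⟨ℓ, h⟩) else 0
  map_add' F G := by
    funext ℓ
    by_cases h : ℓ < 4 <;> simp [h]
  map_smul' a F := by
    funext ℓ
    by_cases h : ℓ < 4 <;> simp [h]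

lemma isTuple_tupleSeries {w : ℤ} (F : (ℓ : Fin 4) → ModularForm 𝒮ℒ (w - 2 * (ℓ : ℕ))) :
    IsTuple w (tupleSeries w F) := by
  intro ℓ hℓ
  have h : ℓ < 4 := by lia
  refine ⟨F ⟨ℓ, h⟩, ?_⟩
  have : tupleSeries w F ℓ = qExpansion 1 (F ⟨ℓ, h⟩) := by
    simp [tupleSeries, h, qSeries]
  rw [this]
  exact ModularForm.isQS_qExpansion _

/-- The order conditions as a linear map. -/
noncomputable def ordMap (w : ℤ) (lam : ℕ → ℕ) :
    ((ℓ : Fin 4) → ModularForm 𝒮ℒ (w - 2 * (ℓ : ℕ))) →ₗ[ℂ] ((Σ ℓ : Fin 4, Fin (lam ℓ)) → ℂ) where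
  toFun F i := PowerSeries.coeff (i.2 : ℕ) (vecOf (tupleSeries w F) (i.1 : ℕ))
  map_add' F G := by
    funext i
    simp [vecOf_add]
  map_smul' a F := by
    funext i
    simp [vecOf_smul]

lemma finrank_tuple (m : ℕ) (hm : 0 < m) : Module.finrank ℂ
    ((ℓ : Fin 4) → ModularForm 𝒮ℒ ((6 * m : ℤ) - 2 * (ℓ : ℕ))) = 2 * m + 1 := by
  rw [Module.finrank_pi_fintype, Fin.sum_univ_four]
  rw [finrank_modularForm (6 * m) (by push_cast; simp) (by rw [Nat.even_iff]; lia),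
    finrank_modularForm (6 * m - 2) (by simp; lia) (by rw [Nat.even_iff]; lia),
    finrank_modularForm (6 * m - 4) (by simp; lia) (by rw [Nat.even_iff]; lia),
    finrank_modularForm (6 * m - 6) (by simp; lia) (by rw [Nat.even_iff]; lia)]
  split_ifs <;> omega

theorem exists_isQ_ordGE (m : ℕ) (lam : ℕ → ℕ) (hl : lam 0 + lam 1 + lam 2 + lam 3 = 2 * m) :
    ∃ y, IsQ (6 * m) y ∧ y 0 ≠ 0 ∧ OrdGE lam y := by
  rcases Nat.eq_zero_or_pos m with rfl | hm
  · refine ⟨vecOf fun ℓ => if ℓ = 0 then 1 else 0,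
      ⟨_, fun ℓ _ => ?_, isVecOf_vecOf _⟩, by simp [vecOf], fun ℓ hℓ => ?_⟩
    · split_ifs with h
      · subst h; exact MF.cast MF.one_mem (by simp)
      · exact Submodule.zero_mem _
    · have : lam ℓ = 0 := by interval_cases ℓ <;> lia
      simp [this]
  have hlt : Module.finrank ℂ ((Σ ℓ : Fin 4, Fin (lam ℓ)) → ℂ) < Module.finrank ℂ
      ((ℓ : Fin 4) → ModularForm 𝒮ℒ ((6 * m : ℤ) - 2 * (ℓ : ℕ))) := by
    rw [finrank_tuple m hm, Module.finrank_fintype_fun_eq_card, Fintype.card_sigma,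
      Fin.sum_univ_four]
    simp
    lia
  obtain ⟨F, hF, hF0⟩ := (Submodule.ne_bot_iff _).1
    (LinearMap.ker_ne_bot_of_finrank_lt (f := ordMap (6 * m) lam) hlt)
  have hQ : IsQ (6 * m) (vecOf (tupleSeries (6 * m) F)) :=
    ⟨_, isTuple_tupleSeries F, isVecOf_vecOf _⟩
  refine ⟨_, hQ, fun h0 => hF0 ?_, fun ℓ hℓ => ?_⟩
  · have hz := hQ.eq_zero h0
    have u (n : ℕ) [n.AtLeastTwo] : (OfNat.ofNat n : PowerSeries ℂ) ≠ 0 := by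
      rw [← map_ofNat (PowerSeries.C (R := ℂ)) n, Ne, map_eq_zero_iff _ PowerSeries.C_injective]
      exact OfNat.ofNat_ne_zero n
    have e3 : tupleSeries (6 * m) F 3 = 0 := by
      have := hz 3 le_rfl
      simpa [vecOf, u] using this
    have e2 : tupleSeries (6 * m) F 2 = 0 := by
      have := hz 2 (by lia)
      simpa [vecOf, e3, u] using this
    have e1 : tupleSeries (6 * m) F 1 = 0 := by
      have := hz 1 (by lia)
      simpa [vecOf, e3, e2, u] using this
    have e0 : tupleSeries (6 * m) F 0 = 0 := by
      have := hz 0 (by lia)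
      simpa [vecOf, e3, e2, e1] using this
    funext ℓ
    have : tupleSeries (6 * m) F ℓ = 0 := by
      fin_cases ℓ
      exacts [e0, e1, e2, e3]
    have h2 : tupleSeries (6 * m) F ℓ = qExpansion 1 (F ℓ) := by
      simp [tupleSeries, qSeries]
    rw [h2] at this
    have h3 := (F ℓ).isQS_qExpansion
    rw [this] at h3
    exact DFunLike.coe_injective (h3.funext_of_eq IsQS.zero)
  · rw [PowerSeries.X_pow_dvd_iff]
    intro n hn
    exact congrFun (LinearMap.mem_ker.1 hF) ⟨⟨ℓ, by lia⟩, ⟨n, hn⟩⟩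

section Coefficients

variable {n : ℕ} {F G : PowerSeries ℂ}

lemma coeff_mul_of_X_pow_dvd (h : PowerSeries.X ^ n ∣ G) :
    PowerSeries.coeff n (F * G) = PowerSeries.coeff 0 F * PowerSeries.coeff n G := by
  obtain ⟨H, rfl⟩ := h
  rw [show F * (PowerSeries.X ^ n * H) = PowerSeries.X ^ n * (F * H) by ring]
  have e (K : PowerSeries ℂ) : PowerSeries.coeff n (PowerSeries.X ^ n * K) =
      PowerSeries.coeff 0 K := by simpa using PowerSeries.coeff_X_pow_mul K n 0
  rw [e, e]
  simp

lemma coeff_succ_mul_of_X_pow_dvd (h : PowerSeries.X ^ n ∣ G) :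
    PowerSeries.coeff (n + 1) (F * G) = PowerSeries.coeff 0 F * PowerSeries.coeff (n + 1) G +
      PowerSeries.coeff 1 F * PowerSeries.coeff n G := by
  obtain ⟨H, rfl⟩ := h
  rw [show F * (PowerSeries.X ^ n * H) = PowerSeries.X ^ n * (F * H) by ring]
  have e (K : PowerSeries ℂ) : PowerSeries.coeff n (PowerSeries.X ^ n * K) =
      PowerSeries.coeff 0 K := by simpa using PowerSeries.coeff_X_pow_mul K n 0
  have e1 (K : PowerSeries ℂ) : PowerSeries.coeff (n + 1) (PowerSeries.X ^ n * K) =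
      PowerSeries.coeff 1 K := by simpa [add_comm] using PowerSeries.coeff_X_pow_mul K n 1
  rw [e1, e1, e, PowerSeries.coeff_mul]
  simp [Finset.Nat.antidiagonal_succ]

lemma X_pow_succ_dvd (h : PowerSeries.X ^ n ∣ F) (h0 : PowerSeries.coeff n F = 0) :
    PowerSeries.X ^ (n + 1) ∣ F := by
  rw [PowerSeries.X_pow_dvd_iff] at h ⊢
  intro m hm
  rcases (Nat.lt_succ_iff.1 hm).eq_or_lt with rfl | h'
  exacts [h0, h m h']

lemma coeff_eq_zero_of_dvd {m : ℕ} (h : PowerSeries.X ^ n ∣ F) (hm : m < n) :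
    PowerSeries.coeff m F = 0 := PowerSeries.X_pow_dvd_iff.1 h m hm

lemma coeff_serrePS (k : ℂ) (h : PowerSeries.X ^ n ∣ F) :
    PowerSeries.coeff n (serrePS k F) = (n - k / 12) * PowerSeries.coeff n F := by
  rw [serrePS_eq, map_sub, coeff_theta, PowerSeries.coeff_C_mul, coeff_mul_of_X_pow_dvd h,
    coeff_eisSeries_zero]
  ring

lemma coeff_succ_serrePS (k : ℂ) (h : PowerSeries.X ^ n ∣ F) :
    PowerSeries.coeff (n + 1) (serrePS k F) = (n + 1 - k / 12) * PowerSeries.coeff (n + 1) F +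
      2 * k * PowerSeries.coeff n F := by
  rw [serrePS_eq, map_sub, coeff_theta, PowerSeries.coeff_C_mul, coeff_succ_mul_of_X_pow_dvd h,
    coeff_eisSeries_zero, coeff_eisSeries_two_one]
  push_cast
  ring

end Coefficients

/-- The action of the Serre derivative on leading coefficients. -/
noncomputable def serreLead (u : ℂ) (c : ℕ → ℂ) : ℕ → ℂ
  | 0 => u * c 0
  | (ℓ + 1) => u * c (ℓ + 1) + c ℓ

/-- The action of iterated Serre derivatives on leading coefficients. -/
noncomputable def serreLeadIter (u : ℂ) (c : ℕ → ℂ) : ℕ → ℕ → ℂ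
  | 0 => c
  | (i + 1) => serreLead (u - i / 6) (serreLeadIter u c i)

section Lead

variable {n ℓ : ℕ} {y : ℕ → PowerSeries ℂ}

lemma dvd_serreVec (h : ∀ j ≤ ℓ, PowerSeries.X ^ n ∣ y j) (k : ℂ) :
    ∀ j ≤ ℓ, PowerSeries.X ^ n ∣ serreVec k y j := by
  rintro (_ | j) hj
  · exact X_pow_dvd_serrePS k (h 0 hj)
  · exact dvd_add (X_pow_dvd_serrePS k (h _ hj)) (h j (by lia))

lemma dvd_serreVecIter (h : ∀ j ≤ ℓ, PowerSeries.X ^ n ∣ y j) (k : ℂ) (i : ℕ) :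
    ∀ j ≤ ℓ, PowerSeries.X ^ n ∣ serreVecIter k y i j := by
  induction i with
  | zero => exact h
  | succ i ih => exact dvd_serreVec ih _

lemma coeff_serreVecIter (h : ∀ j ≤ ℓ, PowerSeries.X ^ n ∣ y j) (k : ℂ) (i : ℕ) :
    ∀ j ≤ ℓ, PowerSeries.coeff n (serreVecIter k y i j) =
      serreLeadIter (n - k / 12) (fun j => PowerSeries.coeff n (y j)) i j := by
  induction i with
  | zero => intro j _; rfl
  | succ i ih =>
    have hd := dvd_serreVecIter h k i
    rintro (_ | j) hj
    · simp only [serreVecIter, serreVec, serreLeadIter, serreLead]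
      rw [coeff_serrePS _ (hd 0 hj), ih 0 hj]
      ring
    · simp only [serreVecIter, serreVec, serreLeadIter, serreLead]
      rw [map_add, coeff_serrePS _ (hd _ hj), ih _ hj, ih j (by lia)]
      ring

end Lead

/-- The action of iterated Serre derivatives on the first two coefficients. -/
noncomputable def serrePairIter (k : ℂ) (n : ℕ) (c : ℂ × ℂ) : ℕ → ℂ × ℂ
  | 0 => c
  | (i + 1) => ((n - (k + 2 * i) / 12) * (serrePairIter k n c i).1,
      (n + 1 - (k + 2 * i) / 12) * (serrePairIter k n c i).2 +
        2 * (k + 2 * i) * (serrePairIter k n c i).1)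

section Pair

variable {n ℓ : ℕ} {y : ℕ → PowerSeries ℂ}

lemma serreVecIter_pair (h : PowerSeries.X ^ n ∣ y ℓ)
    (hlt : ∀ j < ℓ, PowerSeries.X ^ (n + 2) ∣ y j) (k : ℂ) (i : ℕ) :
    PowerSeries.X ^ n ∣ serreVecIter k y i ℓ ∧
    (∀ j < ℓ, PowerSeries.X ^ (n + 2) ∣ serreVecIter k y i j) ∧
    (PowerSeries.coeff n (serreVecIter k y i ℓ), PowerSeries.coeff (n + 1) (serreVecIter k y i ℓ)) =
      serrePairIter k n (PowerSeries.coeff n (y ℓ), PowerSeries.coeff (n + 1) (y ℓ)) i := by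
  induction i with
  | zero => exact ⟨h, hlt, rfl⟩
  | succ i ih =>
    obtain ⟨h1, h2, h3⟩ := ih
    have h4 : ∀ j < ℓ, PowerSeries.X ^ (n + 2) ∣ serreVecIter k y (i + 1) j := by
      intro j hj
      exact dvd_serreVec (ℓ := j) (fun j' hj' => h2 j' (by lia)) _ j le_rfl
    have h5 : ∃ G, PowerSeries.X ^ (n + 2) ∣ G ∧ serreVecIter k y (i + 1) ℓ =
        serrePS (k + 2 * i) (serreVecIter k y i ℓ) + G := by
      rcases ℓ with _ | ℓ
      · exact ⟨0, dvd_zero _, by simp [serreVecIter, serreVec]⟩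
      · exact ⟨_, h2 ℓ (by lia), rfl⟩
    obtain ⟨G, hG, e⟩ := h5
    refine ⟨?_, h4, ?_⟩
    · rw [e]
      exact dvd_add (X_pow_dvd_serrePS _ h1) ((pow_dvd_pow _ (by lia)).trans hG)
    · rw [e, serrePairIter, ← h3, map_add, map_add, coeff_serrePS _ h1, coeff_succ_serrePS _ h1,
        coeff_eq_zero_of_dvd hG (by lia), coeff_eq_zero_of_dvd hG (by lia), add_zero, add_zero]

end Pair

/-- Symbol of the weight raising operator. -/
noncomputable def sym (S c3 g1 g0 s : ℂ) : ℂ :=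
  c3 * s ^ 3 - c3 * (3 * S / 4 - 1 / 4) * s ^ 2 + g1 * s + g0

/-- Derivative of the symbol. -/
noncomputable def dsym (S c3 g1 s : ℂ) : ℂ :=
  3 * c3 * s ^ 2 - 2 * c3 * (3 * S / 4 - 1 / 4) * s + g1

/-- Half the second derivative of the symbol. -/
noncomputable def ddsym (S c3 s : ℂ) : ℂ := 3 * c3 * s - c3 * (3 * S / 4 - 1 / 4)

/-- The operator raising the weight by six with symbol `sym`. -/
noncomputable def opR (S : ℕ) (c3 g1 g0 : ℂ) (y : ℕ → PowerSeries ℂ) (ℓ : ℕ) : PowerSeries ℂ :=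
  PowerSeries.C c3 * serreVecIter (3 * S - 3) y 3 ℓ +
  PowerSeries.C (6 * (sym S c3 g1 g0 ((S - 1) / 4 + 1 / 6) - sym S c3 g1 g0 ((S - 1) / 4))) *
    (eisSeries 4 * serreVecIter (3 * S - 3) y 1 ℓ) +
  PowerSeries.C (sym S c3 g1 g0 ((S - 1) / 4)) * (eisSeries 6 * serreVecIter (3 * S - 3) y 0 ℓ)

section OpR

variable {S : ℕ} {c3 g1 g0 : ℂ} {y : ℕ → PowerSeries ℂ}

lemma IsQ.opR (hy : IsQ (3 * S) y) (c3 g1 g0 : ℂ) : IsQ (3 * (S + 2 : ℕ)) (opR S c3 g1 g0 y) := by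
  have h3 := hy.iter 3
  have h1 := (hy.iter 1).mul_left MF.e4_mem
  have h0 := (hy.iter 0).mul_left MF.e6_mem
  push_cast at h3 h1 h0
  refine ((IsQ.cast (h3.C_mul _) ?_).add (IsQ.cast (h1.C_mul _) ?_)).add
    (IsQ.cast (h0.C_mul _) ?_) <;> push_cast <;> ring

lemma OrdGE.opR {lam : ℕ → ℕ} (hl : ∀ ℓ < 3, lam (ℓ + 1) ≤ lam ℓ) (h : OrdGE lam y) :
    OrdGE lam (opR S c3 g1 g0 y) := fun ℓ hℓ =>
  dvd_add (dvd_add (Dvd.dvd.mul_left (h.serreVecIter hl _ _ ℓ hℓ) _)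
    (Dvd.dvd.mul_left (Dvd.dvd.mul_left (h.serreVecIter hl _ _ ℓ hℓ) _) _))
    (Dvd.dvd.mul_left (Dvd.dvd.mul_left (h.serreVecIter hl _ _ ℓ hℓ) _) _)

lemma coeff_opR {n ℓ : ℕ} (h : ∀ j ≤ ℓ, PowerSeries.X ^ n ∣ y j) :
    PowerSeries.coeff n (opR S c3 g1 g0 y ℓ) =
      c3 * serreLeadIter (n - (S - 1) / 4) (fun j => PowerSeries.coeff n (y j)) 3 ℓ +
      6 * (sym S c3 g1 g0 ((S - 1) / 4 + 1 / 6) - sym S c3 g1 g0 ((S - 1) / 4)) *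
        serreLeadIter (n - (S - 1) / 4) (fun j => PowerSeries.coeff n (y j)) 1 ℓ +
      sym S c3 g1 g0 ((S - 1) / 4) * PowerSeries.coeff n (y ℓ) := by
  have hd := fun i => dvd_serreVecIter h (3 * S - 3) i ℓ le_rfl
  rw [opR, map_add, map_add, PowerSeries.coeff_C_mul, PowerSeries.coeff_C_mul,
    PowerSeries.coeff_C_mul, coeff_mul_of_X_pow_dvd (hd 1), coeff_mul_of_X_pow_dvd (hd 0),
    coeff_eisSeries_zero, coeff_eisSeries_zero, coeff_serreVecIter h _ _ ℓ le_rfl,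
    coeff_serreVecIter h _ _ ℓ le_rfl,
    show ((n : ℂ) - (3 * S - 3) / 12) = n - (S - 1) / 4 by ring]
  simp [serreVecIter]

lemma coeff_opR_zero {n : ℕ} (h : PowerSeries.X ^ n ∣ y 0) :
    PowerSeries.coeff n (opR S c3 g1 g0 y 0) =
      sym S c3 g1 g0 n * PowerSeries.coeff n (y 0) := by
  rw [coeff_opR (fun j hj => by obtain rfl : j = 0 := by lia
                                exact h)]
  simp only [serreLeadIter, serreLead, sym]
  push_cast
  ring

lemma coeff_opR_one {n : ℕ} (h : ∀ j ≤ 1, PowerSeries.X ^ n ∣ y j) :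
    PowerSeries.coeff n (opR S c3 g1 g0 y 1) =
      sym S c3 g1 g0 n * PowerSeries.coeff n (y 1) + dsym S c3 g1 n * PowerSeries.coeff n (y 0) := by
  rw [coeff_opR h]
  simp only [serreLeadIter, serreLead, sym, dsym]
  push_cast
  ring

lemma coeff_opR_two {n : ℕ} (h : ∀ j ≤ 2, PowerSeries.X ^ n ∣ y j) :
    PowerSeries.coeff n (opR S c3 g1 g0 y 2) =
      sym S c3 g1 g0 n * PowerSeries.coeff n (y 2) + dsym S c3 g1 n * PowerSeries.coeff n (y 1) +
      ddsym S c3 n * PowerSeries.coeff n (y 0) := by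
  rw [coeff_opR h]
  simp only [serreLeadIter, serreLead, sym, dsym, ddsym]
  push_cast
  ring

lemma coeff_opR_three {n : ℕ} (h : ∀ j ≤ 3, PowerSeries.X ^ n ∣ y j) :
    PowerSeries.coeff n (opR S c3 g1 g0 y 3) =
      sym S c3 g1 g0 n * PowerSeries.coeff n (y 3) + dsym S c3 g1 n * PowerSeries.coeff n (y 2) +
      ddsym S c3 n * PowerSeries.coeff n (y 1) + c3 * PowerSeries.coeff n (y 0) := by
  rw [coeff_opR h]
  simp only [serreLeadIter, serreLead, sym, dsym, ddsym]
  push_cast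
  ring

end OpR

/-- The fourth order operator with exponents `a, b, c, d`. -/
noncomputable def opL (a b c d : ℂ) (y : ℕ → PowerSeries ℂ) (ℓ : ℕ) : PowerSeries ℂ :=
  serreVecIter (3 * (a + b + c + d) - 3) y 4 ℓ +
  PowerSeries.C (-(3 * (a + b + c + d)) ^ 2 / 24 +
    (a * b + a * c + a * d + b * c + b * d + c * d) + 5 / 72) *
    (eisSeries 4 * serreVecIter (3 * (a + b + c + d) - 3) y 2 ℓ) +
  PowerSeries.C (-(3 * (a + b + c + d)) ^ 3 / 216 + (3 * (a + b + c + d)) ^ 2 / 72 +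
    ((3 * (a + b + c + d)) - 2) / 6 * (a * b + a * c + a * d + b * c + b * d + c * d) -
    (a * b * c + a * b * d + a * c * d + b * c * d) - 5 / 216) *
    (eisSeries 6 * serreVecIter (3 * (a + b + c + d) - 3) y 1 ℓ) +
  PowerSeries.C ((a - (3 * (a + b + c + d) - 3) / 12) * (b - (3 * (a + b + c + d) - 3) / 12) *
    (c - (3 * (a + b + c + d) - 3) / 12) * (d - (3 * (a + b + c + d) - 3) / 12)) *
    (eisSeries 4 ^ 2 * serreVecIter (3 * (a + b + c + d) - 3) y 0 ℓ)

section OpL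

variable {y : ℕ → PowerSeries ℂ}

lemma IsQ.opL {a b c d : ℕ} (hy : IsQ (3 * (a + b + c + d : ℕ)) y) :
    IsQ (3 * (a + b + c + d : ℕ) + 8) (opL a b c d y) := by
  have h4 := hy.iter 4
  have h2 := (hy.iter 2).mul_left MF.e4_mem
  have h1 := (hy.iter 1).mul_left MF.e6_mem
  have h0 := (hy.iter 0).mul_left (pow_two (eisSeries 4) ▸ MF.mul MF.e4_mem MF.e4_mem)
  push_cast at h4 h2 h1 h0
  refine (((IsQ.cast h4 ?_).add (IsQ.cast (h2.C_mul _) ?_)).add (IsQ.cast (h1.C_mul _) ?_)).add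
    (IsQ.cast (h0.C_mul _) ?_) <;> push_cast <;> ring

lemma OrdGE.opL {lam : ℕ → ℕ} (hl : ∀ ℓ < 3, lam (ℓ + 1) ≤ lam ℓ) (h : OrdGE lam y)
    (a b c d : ℂ) : OrdGE lam (opL a b c d y) := fun ℓ hℓ =>
  dvd_add (dvd_add (dvd_add (h.serreVecIter hl _ _ ℓ hℓ)
    (Dvd.dvd.mul_left (Dvd.dvd.mul_left (h.serreVecIter hl _ _ ℓ hℓ) _) _))
    (Dvd.dvd.mul_left (Dvd.dvd.mul_left (h.serreVecIter hl _ _ ℓ hℓ) _) _))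
    (Dvd.dvd.mul_left (Dvd.dvd.mul_left (h.serreVecIter hl _ _ ℓ hℓ) _) _)

lemma coeff_opL {a b c d : ℂ} {n ℓ : ℕ} (h : ∀ j ≤ ℓ, PowerSeries.X ^ n ∣ y j) :
    PowerSeries.coeff n (opL a b c d y ℓ) =
      serreLeadIter (n - (3 * (a + b + c + d) - 3) / 12) (fun j => PowerSeries.coeff n (y j)) 4 ℓ +
      (-(3 * (a + b + c + d)) ^ 2 / 24 +
        (a * b + a * c + a * d + b * c + b * d + c * d) + 5 / 72) *
      serreLeadIter (n - (3 * (a + b + c + d) - 3) / 12) (fun j => PowerSeries.coeff n (y j)) 2 ℓ +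
      (-(3 * (a + b + c + d)) ^ 3 / 216 + (3 * (a + b + c + d)) ^ 2 / 72 +
        ((3 * (a + b + c + d)) - 2) / 6 * (a * b + a * c + a * d + b * c + b * d + c * d) -
        (a * b * c + a * b * d + a * c * d + b * c * d) - 5 / 216) *
      serreLeadIter (n - (3 * (a + b + c + d) - 3) / 12) (fun j => PowerSeries.coeff n (y j)) 1 ℓ +
      ((a - (3 * (a + b + c + d) - 3) / 12) * (b - (3 * (a + b + c + d) - 3) / 12) *
        (c - (3 * (a + b + c + d) - 3) / 12) * (d - (3 * (a + b + c + d) - 3) / 12)) *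
      PowerSeries.coeff n (y ℓ) := by
  have hd := fun i => dvd_serreVecIter h (3 * (a + b + c + d) - 3) i ℓ le_rfl
  rw [opL, map_add, map_add, map_add, PowerSeries.coeff_C_mul, PowerSeries.coeff_C_mul,
    PowerSeries.coeff_C_mul, coeff_mul_of_X_pow_dvd (hd 2), coeff_mul_of_X_pow_dvd (hd 1),
    coeff_mul_of_X_pow_dvd (hd 0),
    coeff_eisSeries_zero, coeff_eisSeries_zero, coeff_serreVecIter h _ _ ℓ le_rfl,
    coeff_serreVecIter h _ _ ℓ le_rfl, coeff_serreVecIter h _ _ ℓ le_rfl]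
  have e : PowerSeries.coeff 0 (eisSeries 4 ^ 2) = 1 := by
    have := coeff_eisSeries_zero 4
    rw [PowerSeries.coeff_zero_eq_constantCoeff_apply] at this ⊢
    rw [map_pow, this, one_pow]
  rw [e]
  simp [serreVecIter]

lemma coeff_opL_zero {a b c d : ℂ} {n : ℕ} (h : PowerSeries.X ^ n ∣ y 0) :
    PowerSeries.coeff n (opL a b c d y 0) =
      (n - a) * (n - b) * (n - c) * (n - d) * PowerSeries.coeff n (y 0) := by
  rw [coeff_opL (fun j hj => by obtain rfl : j = 0 := by lia
                                exact h)]
  simp only [serreLeadIter, serreLead]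
  push_cast
  ring

lemma coeff_opL_one {a b c d : ℂ} {n : ℕ} (h : ∀ j ≤ 1, PowerSeries.X ^ n ∣ y j) :
    PowerSeries.coeff n (opL a b c d y 1) =
      (n - a) * (n - b) * (n - c) * (n - d) * PowerSeries.coeff n (y 1) +
      ((n - b) * (n - c) * (n - d) + (n - a) * (n - c) * (n - d) + (n - a) * (n - b) * (n - d) +
        (n - a) * (n - b) * (n - c)) * PowerSeries.coeff n (y 0) := by
  rw [coeff_opL h]
  simp only [serreLeadIter, serreLead]
  push_cast
  ring

lemma coeff_opL_two {a b c d : ℂ} {n : ℕ} (h : ∀ j ≤ 2, PowerSeries.X ^ n ∣ y j) :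
    PowerSeries.coeff n (opL a b c d y 2) =
      (n - a) * (n - b) * (n - c) * (n - d) * PowerSeries.coeff n (y 2) +
      ((n - b) * (n - c) * (n - d) + (n - a) * (n - c) * (n - d) + (n - a) * (n - b) * (n - d) +
        (n - a) * (n - b) * (n - c)) * PowerSeries.coeff n (y 1) +
      ((n - a) * (n - b) + (n - a) * (n - c) + (n - a) * (n - d) + (n - b) * (n - c) +
        (n - b) * (n - d) + (n - c) * (n - d)) * PowerSeries.coeff n (y 0) := by
  rw [coeff_opL h]
  simp only [serreLeadIter, serreLead]
  push_cast
  ring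

lemma coeff_opL_three {a b c d : ℂ} {n : ℕ} (h : ∀ j ≤ 3, PowerSeries.X ^ n ∣ y j) :
    PowerSeries.coeff n (opL a b c d y 3) =
      (n - a) * (n - b) * (n - c) * (n - d) * PowerSeries.coeff n (y 3) +
      ((n - b) * (n - c) * (n - d) + (n - a) * (n - c) * (n - d) + (n - a) * (n - b) * (n - d) +
        (n - a) * (n - b) * (n - c)) * PowerSeries.coeff n (y 2) +
      ((n - a) * (n - b) + (n - a) * (n - c) + (n - a) * (n - d) + (n - b) * (n - c) +
        (n - b) * (n - d) + (n - c) * (n - d)) * PowerSeries.coeff n (y 1) +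
      ((n - a) + (n - b) + (n - c) + (n - d)) * PowerSeries.coeff n (y 0) := by
  rw [coeff_opL h]
  simp only [serreLeadIter, serreLead]
  push_cast
  ring

end OpL

/-- The sequence starting with `a, b, c, d`. -/
def seq4 (a b c d : ℕ) : ℕ → ℕ
  | 0 => a
  | 1 => b
  | 2 => c
  | _ => d

/-- Nonzero quasimodular vectors with maximal vanishing orders `a ≥ b ≥ c ≥ d`. -/
structure Bal (a b c d : ℕ) (y : ℕ → PowerSeries ℂ) : Prop where
  isQ : IsQ (3 * (a + b + c + d : ℕ)) y
  ne_zero : y 0 ≠ 0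
  ord : OrdGE (seq4 a b c d) y
  le_ab : b ≤ a
  le_bc : c ≤ b
  le_cd : d ≤ c

lemma seq4_antitone {a b c d : ℕ} (h1 : b ≤ a) (h2 : c ≤ b) (h3 : d ≤ c) :
    ∀ ℓ < 3, seq4 a b c d (ℓ + 1) ≤ seq4 a b c d ℓ := by
  intro ℓ hℓ
  interval_cases ℓ
  exacts [h1, h2, h3]

lemma ordGE_seq4 {a b c d : ℕ} {y : ℕ → PowerSeries ℂ} :
    OrdGE (seq4 a b c d) y ↔ PowerSeries.X ^ a ∣ y 0 ∧ PowerSeries.X ^ b ∣ y 1 ∧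
      PowerSeries.X ^ c ∣ y 2 ∧ PowerSeries.X ^ d ∣ y 3 := by
  constructor
  · intro h
    exact ⟨h 0 (by lia), h 1 (by lia), h 2 (by lia), h 3 (by lia)⟩
  · rintro ⟨h0, h1, h2, h3⟩ ℓ hℓ
    interval_cases ℓ
    exacts [h0, h1, h2, h3]

lemma zero_of_ord {w : ℤ} {a b c d : ℕ} {y : ℕ → PowerSeries ℂ} (hy : IsQ w y) (h1 : b ≤ a)
    (h2 : c ≤ b) (h3 : d ≤ c) (hw : w < 3 * (a + b + c + d : ℕ))
    (k0 : PowerSeries.X ^ a ∣ y 0) (k1 : PowerSeries.X ^ b ∣ y 1)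
    (k2 : PowerSeries.X ^ c ∣ y 2) (k3 : PowerSeries.X ^ d ∣ y 3) : y 0 = 0 := by
  refine zero_estimate hy (seq4_antitone h1 h2 h3) (ordGE_seq4.2 ⟨k0, k1, k2, k3⟩) ?_
  simp only [seq4]
  push_cast at hw
  exact hw

lemma exists_bal {a b c d : ℕ} (h1 : b ≤ a) (h2 : c ≤ b) (h3 : d ≤ c) (he : Even (a + b + c + d)) :
    ∃ y, Bal a b c d y := by
  obtain ⟨m, hm⟩ := he
  obtain ⟨y, hy, h0, ho⟩ := exists_isQ_ordGE m (seq4 a b c d) (by simp only [seq4]; lia)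
  exact ⟨y, hy.cast (by rw [hm]; push_cast; ring), h0, ho, h1, h2, h3⟩

namespace Bal

variable {a b c d : ℕ} {y v : ℕ → PowerSeries ℂ}

lemma ord0 (h : Bal a b c d y) : PowerSeries.X ^ a ∣ y 0 := h.ord 0 (by lia)
lemma ord1 (h : Bal a b c d y) : PowerSeries.X ^ b ∣ y 1 := h.ord 1 (by lia)
lemma ord2 (h : Bal a b c d y) : PowerSeries.X ^ c ∣ y 2 := h.ord 2 (by lia)
lemma ord3 (h : Bal a b c d y) : PowerSeries.X ^ d ∣ y 3 := h.ord 3 (by lia)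

lemma dvd1 (h : Bal a b c d y) : ∀ j ≤ 1, PowerSeries.X ^ b ∣ y j := by
  intro j hj
  interval_cases j
  exacts [(pow_dvd_pow _ h.le_ab).trans h.ord0, h.ord1]

lemma dvd2 (h : Bal a b c d y) : ∀ j ≤ 2, PowerSeries.X ^ c ∣ y j := by
  intro j hj
  interval_cases j
  exacts [(pow_dvd_pow _ (h.le_bc.trans h.le_ab)).trans h.ord0,
    (pow_dvd_pow _ h.le_bc).trans h.ord1, h.ord2]

lemma dvd3 (h : Bal a b c d y) : ∀ j ≤ 3, PowerSeries.X ^ d ∣ y j := by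
  intro j hj
  interval_cases j
  exacts [(pow_dvd_pow _ (h.le_cd.trans (h.le_bc.trans h.le_ab))).trans h.ord0,
    (pow_dvd_pow _ (h.le_cd.trans h.le_bc)).trans h.ord1, (pow_dvd_pow _ h.le_cd).trans h.ord2,
    h.ord3]

lemma coeff0_ne (h : Bal a b c d y) : PowerSeries.coeff a (y 0) ≠ 0 := fun h0 =>
  h.ne_zero (zero_of_ord h.isQ (h.le_ab.trans a.le_succ) h.le_bc h.le_cd (by push_cast; lia)
    (X_pow_succ_dvd h.ord0 h0) h.ord1 h.ord2 h.ord3)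

lemma coeff1_ne (h : Bal a b c d y) (hlt : b < a) : PowerSeries.coeff b (y 1) ≠ 0 := fun h0 =>
  h.ne_zero (zero_of_ord h.isQ hlt (h.le_bc.trans b.le_succ) h.le_cd (by push_cast; lia)
    h.ord0 (X_pow_succ_dvd h.ord1 h0) h.ord2 h.ord3)

lemma coeff2_ne (h : Bal a b c d y) (hlt : c < b) : PowerSeries.coeff c (y 2) ≠ 0 := fun h0 =>
  h.ne_zero (zero_of_ord h.isQ h.le_ab hlt (h.le_cd.trans c.le_succ) (by push_cast; lia)
    h.ord0 h.ord1 (X_pow_succ_dvd h.ord2 h0) h.ord3)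

lemma coeff3_ne (h : Bal a b c d y) (hlt : d < c) : PowerSeries.coeff d (y 3) ≠ 0 := fun h0 =>
  h.ne_zero (zero_of_ord h.isQ h.le_ab h.le_bc hlt (by push_cast; lia)
    h.ord0 h.ord1 h.ord2 (X_pow_succ_dvd h.ord3 h0))

lemma eq_mul (h : Bal a b c d y) (h' : Bal a b c d v) :
    ∃ t : ℂ, ∀ ℓ ≤ 3, v ℓ = PowerSeries.C t * y ℓ := by
  set t := PowerSeries.coeff a (v 0) / PowerSeries.coeff a (y 0) with ht
  have hQ := h'.isQ.add (h.isQ.C_mul (-t))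
  have h0 : v 0 + PowerSeries.C (-t) * y 0 = 0 := by
    refine zero_of_ord hQ (h.le_ab.trans a.le_succ) h.le_bc h.le_cd (by push_cast; lia)
      (X_pow_succ_dvd (dvd_add h'.ord0 (h.ord0.mul_left _)) ?_) (dvd_add h'.ord1 (h.ord1.mul_left _))
      (dvd_add h'.ord2 (h.ord2.mul_left _)) (dvd_add h'.ord3 (h.ord3.mul_left _))
    rw [map_add, PowerSeries.coeff_C_mul, ht]
    have := h.coeff0_ne
    field_simp
    ring
  refine ⟨t, fun ℓ hℓ => ?_⟩
  have := hQ.eq_zero h0 ℓ hℓ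
  rw [map_neg] at this
  linear_combination this

lemma opL_eq_zero (h : Bal a b c d y) : ∀ ℓ ≤ 3, opL a b c d y ℓ = 0 := by
  have ho := OrdGE.opL (seq4_antitone h.le_ab h.le_bc h.le_cd) h.ord a b c d
  rw [ordGE_seq4] at ho
  obtain ⟨o0, o1, o2, o3⟩ := ho
  have e0 : PowerSeries.coeff a (opL a b c d y 0) = 0 := by
    rw [coeff_opL_zero h.ord0]; ring
  have z10 : b = a ∨ PowerSeries.coeff b (y 0) = 0 := h.le_ab.eq_or_lt.imp id fun hlt =>
    coeff_eq_zero_of_dvd h.ord0 hlt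
  have z20 : (c = a ∧ c = b) ∨ PowerSeries.coeff c (y 0) = 0 := by
    by_cases e : c = a
    · exact Or.inl ⟨e, le_antisymm h.le_bc (h.le_ab.trans e.ge)⟩
    · exact Or.inr (coeff_eq_zero_of_dvd h.ord0 (lt_of_le_of_ne (h.le_bc.trans h.le_ab) e))
  have z21 : c = b ∨ PowerSeries.coeff c (y 1) = 0 := h.le_bc.eq_or_lt.imp id fun hlt =>
    coeff_eq_zero_of_dvd h.ord1 hlt
  have z32 : d = c ∨ PowerSeries.coeff d (y 2) = 0 := h.le_cd.eq_or_lt.imp id fun hlt =>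
    coeff_eq_zero_of_dvd h.ord2 hlt
  have z31 : (d = b ∧ d = c) ∨ PowerSeries.coeff d (y 1) = 0 := by
    by_cases e : d = b
    · exact Or.inl ⟨e, le_antisymm h.le_cd (h.le_bc.trans e.ge)⟩
    · exact Or.inr (coeff_eq_zero_of_dvd h.ord1 (lt_of_le_of_ne (h.le_cd.trans h.le_bc) e))
  have z30 : (d = a ∧ d = b ∧ d = c) ∨ PowerSeries.coeff d (y 0) = 0 := by
    have := h.le_ab
    have := h.le_bc
    have := h.le_cd
    by_cases e : d = a
    · exact Or.inl ⟨e, by lia, by lia⟩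
    · exact Or.inr (coeff_eq_zero_of_dvd h.ord0 (by lia))
  have e1 : PowerSeries.coeff b (opL a b c d y 1) = 0 := by
    rw [coeff_opL_one h.dvd1]
    rcases z10 with rfl | e
    · ring
    · rw [e]; ring
  have e2 : PowerSeries.coeff c (opL a b c d y 2) = 0 := by
    rw [coeff_opL_two h.dvd2]
    rcases z21 with rfl | f
    · rcases z20 with ⟨rfl, _⟩ | e
      · ring
      · rw [e]; ring
    · rcases z20 with ⟨rfl, rfl⟩ | e
      · ring
      · rw [e, f]; ring
  have e3 : PowerSeries.coeff d (opL a b c d y 3) = 0 := by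
    rw [coeff_opL_three h.dvd3]
    have t1 : ((d : ℂ) - a) * PowerSeries.coeff d (y 0) = 0 := by
      rcases z30 with ⟨e, -, -⟩ | e <;> simp [e]
    have t2 : ((d : ℂ) - b) * PowerSeries.coeff d (y 0) = 0 := by
      rcases z30 with ⟨-, e, -⟩ | e <;> simp [e]
    have t3 : ((d : ℂ) - c) * PowerSeries.coeff d (y 0) = 0 := by
      rcases z30 with ⟨-, -, e⟩ | e <;> simp [e]
    have t4 : ((d : ℂ) - b) * PowerSeries.coeff d (y 1) = 0 := by
      rcases z31 with ⟨e, -⟩ | e <;> simp [e]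
    have t5 : ((d : ℂ) - c) * PowerSeries.coeff d (y 1) = 0 := by
      rcases z31 with ⟨-, e⟩ | e <;> simp [e]
    have t6 : ((d : ℂ) - c) * PowerSeries.coeff d (y 2) = 0 := by
      rcases z32 with e | e <;> simp [e]
    linear_combination t1 + t2 + t3 + (d - a) * t4 + (d - a) * t5 + (d - b) * t5 +
      (d - a) * (d - b) * t6
  refine IsQ.eq_zero h.isQ.opL (zero_of_ord h.isQ.opL (Nat.succ_le_succ h.le_ab)
    (Nat.succ_le_succ h.le_bc) (Nat.succ_le_succ h.le_cd) (by push_cast; lia)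
    (X_pow_succ_dvd o0 e0) (X_pow_succ_dvd o1 e1) (X_pow_succ_dvd o2 e2) (X_pow_succ_dvd o3 e3))

end Bal

section Second

variable {y : ℕ → PowerSeries ℂ} {n ℓ : ℕ}

lemma coeff_succ_opR {S : ℕ} {c3 g1 g0 : ℂ} (h : PowerSeries.X ^ n ∣ y ℓ)
    (hlt : ∀ j < ℓ, PowerSeries.X ^ (n + 2) ∣ y j) {p : ℕ → ℂ × ℂ}
    (hp : p = serrePairIter (3 * S - 3) n
      (PowerSeries.coeff n (y ℓ), PowerSeries.coeff (n + 1) (y ℓ))) :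
    PowerSeries.coeff (n + 1) (opR S c3 g1 g0 y ℓ) = c3 * (p 3).2 +
      6 * (sym S c3 g1 g0 ((S - 1) / 4 + 1 / 6) - sym S c3 g1 g0 ((S - 1) / 4)) *
        ((p 1).2 + 240 * (p 1).1) +
      sym S c3 g1 g0 ((S - 1) / 4) * ((p 0).2 - 504 * (p 0).1) := by
  have H := serreVecIter_pair h hlt (3 * S - 3)
  rw [← hp] at H
  have H1 := fun i => congrArg Prod.fst (H i).2.2
  have H2 := fun i => congrArg Prod.snd (H i).2.2
  dsimp only at H1 H2
  rw [opR, map_add, map_add, PowerSeries.coeff_C_mul, PowerSeries.coeff_C_mul,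
    PowerSeries.coeff_C_mul, coeff_succ_mul_of_X_pow_dvd (H 1).1,
    coeff_succ_mul_of_X_pow_dvd (H 0).1, coeff_eisSeries_zero, coeff_eisSeries_zero,
    coeff_eisSeries_four_one, coeff_eisSeries_six_one, H1, H1, H2, H2, H2]
  ring

lemma coeff_zero_one_E4_sq : PowerSeries.coeff 0 (eisSeries 4 ^ 2) = 1 ∧
    PowerSeries.coeff 1 (eisSeries 4 ^ 2) = 480 := by
  rw [pow_two, PowerSeries.coeff_mul, PowerSeries.coeff_mul]
  simp [Finset.Nat.antidiagonal_succ, coeff_eisSeries_zero, coeff_eisSeries_four_one]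
  norm_num

lemma coeff_succ_opL {a b c d : ℂ} (h : PowerSeries.X ^ n ∣ y ℓ)
    (hlt : ∀ j < ℓ, PowerSeries.X ^ (n + 2) ∣ y j) {p : ℕ → ℂ × ℂ}
    (hp : p = serrePairIter (3 * (a + b + c + d) - 3) n
      (PowerSeries.coeff n (y ℓ), PowerSeries.coeff (n + 1) (y ℓ))) :
    PowerSeries.coeff (n + 1) (opL a b c d y ℓ) = (p 4).2 +
      (-(3 * (a + b + c + d)) ^ 2 / 24 +
        (a * b + a * c + a * d + b * c + b * d + c * d) + 5 / 72) * ((p 2).2 + 240 * (p 2).1) +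
      (-(3 * (a + b + c + d)) ^ 3 / 216 + (3 * (a + b + c + d)) ^ 2 / 72 +
        ((3 * (a + b + c + d)) - 2) / 6 * (a * b + a * c + a * d + b * c + b * d + c * d) -
        (a * b * c + a * b * d + a * c * d + b * c * d) - 5 / 216) *
        ((p 1).2 - 504 * (p 1).1) +
      ((a - (3 * (a + b + c + d) - 3) / 12) * (b - (3 * (a + b + c + d) - 3) / 12) *
        (c - (3 * (a + b + c + d) - 3) / 12) * (d - (3 * (a + b + c + d) - 3) / 12)) *
        ((p 0).2 + 480 * (p 0).1) := by
  have H := serreVecIter_pair h hlt (3 * (a + b + c + d) - 3)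
  rw [← hp] at H
  have H1 := fun i => congrArg Prod.fst (H i).2.2
  have H2 := fun i => congrArg Prod.snd (H i).2.2
  dsimp only at H1 H2
  rw [opL, map_add, map_add, map_add, PowerSeries.coeff_C_mul, PowerSeries.coeff_C_mul,
    PowerSeries.coeff_C_mul, coeff_succ_mul_of_X_pow_dvd (H 2).1,
    coeff_succ_mul_of_X_pow_dvd (H 1).1, coeff_succ_mul_of_X_pow_dvd (H 0).1,
    coeff_zero_one_E4_sq.1, coeff_zero_one_E4_sq.2, coeff_eisSeries_zero, coeff_eisSeries_zero,
    coeff_eisSeries_four_one, coeff_eisSeries_six_one, H1, H1, H1, H2, H2, H2, H2]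
  ring

end Second

/-- Leading coefficient of the symbol raising one exponent by two. -/
noncomputable def raiseN (x y : ℝ) : ℝ :=
  6 * ((3 * x - 3 * y + 4) * (x + y + 1) * (x + 1)) +
  6 * ((3 * x - 3 * y + 2) * (x + y + 1) * (x + 1)) +
  4 * ((3 * x - 3 * y + 2) * (3 * x - 3 * y + 4) * (x + 1)) -
  (3 * x - 3 * y + 2) * (3 * x - 3 * y + 4) * (x + y + 1)

/-- Denominator of the symbol raising one exponent by two. -/
noncomputable def raiseD (x y : ℝ) : ℝ :=
  (3 * x - 3 * y + 2) * (3 * x - 3 * y + 4) * (x + y + 1) * (x + 1)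

/-- The operator `opR` with symbol expanded around `t`. -/
noncomputable def opT (S t : ℕ) (c3 h1 h0 : ℝ) : (ℕ → PowerSeries ℂ) → ℕ → PowerSeries ℂ :=
  opR S c3 (3 * c3 * t ^ 2 + 2 * c3 * (3 * S / 4 - 1 / 4 - 3 * t) * t + h1)
    (-c3 * t ^ 3 - c3 * (3 * S / 4 - 1 / 4 - 3 * t) * t ^ 2 - h1 * t + h0)

/-- The operator raising the exponent `t + x` by two. -/
noncomputable def opTwo (S t : ℕ) (x y : ℝ) : (ℕ → PowerSeries ℂ) → ℕ → PowerSeries ℂ :=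
  opT S t (raiseN x y) ((3 * y - x - 1) / 4 * (x * raiseN x y - raiseD x y))
    (x * ((3 * y - x - 1) / 4) * raiseD x y)

lemma opL_congr {a b c d a' b' c' d' : ℂ} (h1 : a + b + c + d = a' + b' + c' + d')
    (h2 : a * b + a * c + a * d + b * c + b * d + c * d =
      a' * b' + a' * c' + a' * d' + b' * c' + b' * d' + c' * d')
    (h3 : a * b * c + a * b * d + a * c * d + b * c * d =
      a' * b' * c' + a' * b' * d' + a' * c' * d' + b' * c' * d')
    (h4 : a * b * c * d = a' * b' * c' * d') : opL a b c d = opL a' b' c' d' := by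
  funext y ℓ
  have h5 (k : ℂ) : (a - k) * (b - k) * (c - k) * (d - k) =
      (a' - k) * (b' - k) * (c' - k) * (d' - k) := by
    linear_combination h4 - k * h3 + k ^ 2 * h2 - k ^ 3 * h1
  rw [opL, opL, h1, h2, h3, h5]

lemma coeff_succ_opTwo_eq_zero {S t n ℓ : ℕ} {y : ℕ → PowerSeries ℂ} {x z : ℝ}
    (hS : (S : ℂ) = 4 * t + x + z) (hn : (n : ℂ) = t + x) (h : PowerSeries.X ^ n ∣ y ℓ)
    (hlt : ∀ j < ℓ, PowerSeries.X ^ (n + 2) ∣ y j)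
    (hL : opL (t + x) (t + z) t t y ℓ = 0) (hxz : x - z + 1 ≠ 0) (hx : x + 1 ≠ 0) :
    PowerSeries.coeff (n + 1) (opTwo S t x z y ℓ) = 0 := by
  have hP : ((x : ℂ) - z + 1) * (x + 1) ^ 2 ≠ 0 := by
    exact_mod_cast mul_ne_zero hxz (pow_ne_zero 2 hx)
  have e := congrArg (PowerSeries.coeff (n + 1)) hL
  rw [coeff_succ_opL h hlt rfl, map_zero] at e
  rw [opTwo, opT, coeff_succ_opR h hlt rfl]
  generalize PowerSeries.coeff n (y ℓ) = c at *
  generalize PowerSeries.coeff (n + 1) (y ℓ) = c' at *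
  simp only [serrePairIter, raiseN, raiseD, sym] at e ⊢
  push_cast at e ⊢
  rw [hn] at e ⊢
  rw [hS]
  generalize (t : ℂ) = t at *
  generalize (x : ℂ) = x at *
  generalize (z : ℂ) = z at *
  refine (mul_eq_zero.1 ?_).resolve_left hP
  linear_combination ((6 * ((3 * x - 3 * z + 4) * (x + z + 1) * (x + 1)) +
      6 * ((3 * x - 3 * z + 2) * (x + z + 1) * (x + 1)) +
      4 * ((3 * x - 3 * z + 2) * (3 * x - 3 * z + 4) * (x + 1)) -
      (3 * x - 3 * z + 2) * (3 * x - 3 * z + 4) * (x + z + 1)) *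
      ((x + 1) ^ 2 - (3 * z - x - 1) / 4 * (x + 1)) - (3 * z - x - 1) / 4 *
      ((3 * x - 3 * z + 2) * (3 * x - 3 * z + 4) * (x + z + 1) * (x + 1))) * e

section Leading

variable {S t n ℓ : ℕ} {y : ℕ → PowerSeries ℂ}

lemma coeff_opR_of_lt {c3 g1 g0 : ℂ} (hℓ : ℓ ≤ 3) (h : PowerSeries.X ^ n ∣ y ℓ)
    (hlt : ∀ j < ℓ, PowerSeries.X ^ (n + 1) ∣ y j) :
    PowerSeries.coeff n (opR S c3 g1 g0 y ℓ) = sym S c3 g1 g0 n * PowerSeries.coeff n (y ℓ) := by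
  have hd : ∀ j ≤ ℓ, PowerSeries.X ^ n ∣ y j := fun j hj => hj.eq_or_lt.elim (fun e => e ▸ h)
    fun hlt' => (pow_dvd_pow _ n.le_succ).trans (hlt j hlt')
  have hz : ∀ j < ℓ, PowerSeries.coeff n (y j) = 0 := fun j hj =>
    coeff_eq_zero_of_dvd (hlt j hj) n.lt_succ_self
  interval_cases ℓ
  · rw [coeff_opR_zero h]
  · rw [coeff_opR_one hd, hz 0 (by lia)]; ring
  · rw [coeff_opR_two hd, hz 0 (by lia), hz 1 (by lia)]; ring
  · rw [coeff_opR_three hd, hz 0 (by lia), hz 1 (by lia), hz 2 (by lia)]; ring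

lemma coeff_opR_succ_of_lt {c3 g1 g0 : ℂ} (hℓ : ℓ + 1 ≤ 3) (h : PowerSeries.X ^ n ∣ y ℓ)
    (h' : PowerSeries.X ^ n ∣ y (ℓ + 1)) (hlt : ∀ j < ℓ, PowerSeries.X ^ (n + 1) ∣ y j) :
    PowerSeries.coeff n (opR S c3 g1 g0 y (ℓ + 1)) =
      sym S c3 g1 g0 n * PowerSeries.coeff n (y (ℓ + 1)) +
      dsym S c3 g1 n * PowerSeries.coeff n (y ℓ) := by
  have hd : ∀ j ≤ ℓ + 1, PowerSeries.X ^ n ∣ y j := by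
    intro j hj
    rcases lt_trichotomy j ℓ with hj' | rfl | hj'
    · exact (pow_dvd_pow _ n.le_succ).trans (hlt j hj')
    · exact h
    · obtain rfl : j = ℓ + 1 := by lia
      exact h'
  have hz : ∀ j < ℓ, PowerSeries.coeff n (y j) = 0 := fun j hj =>
    coeff_eq_zero_of_dvd (hlt j hj) n.lt_succ_self
  obtain rfl | rfl | rfl : ℓ = 0 ∨ ℓ = 1 ∨ ℓ = 2 := by lia
  · rw [coeff_opR_one hd]
  · rw [coeff_opR_two hd, hz 0 (by lia)]; ring
  · rw [coeff_opR_three hd, hz 0 (by lia), hz 1 (by lia)]; ring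

variable {c3 h1 h0 : ℝ}

lemma coeff_opT_of_lt (hℓ : ℓ ≤ 3) (h : PowerSeries.X ^ n ∣ y ℓ)
    (hlt : ∀ j < ℓ, PowerSeries.X ^ (n + 1) ∣ y j) {r : ℝ} (hr : (n : ℝ) = t + r) :
    PowerSeries.coeff n (opT S t c3 h1 h0 y ℓ) =
      ((c3 * r ^ 3 - c3 * (3 * S / 4 - 1 / 4 - 3 * t) * r ^ 2 + h1 * r + h0 : ℝ) : ℂ) *
        PowerSeries.coeff n (y ℓ) := by
  have hr' : (n : ℂ) = t + r := by exact_mod_cast congrArg ((↑) : ℝ → ℂ) hr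
  rw [opT, coeff_opR_of_lt hℓ h hlt, sym, hr']
  push_cast
  ring

lemma coeff_opT_succ_of_lt (hℓ : ℓ + 1 ≤ 3) (h : PowerSeries.X ^ n ∣ y ℓ)
    (h' : PowerSeries.X ^ n ∣ y (ℓ + 1)) (hlt : ∀ j < ℓ, PowerSeries.X ^ (n + 1) ∣ y j)
    {r : ℝ} (hr : (n : ℝ) = t + r) :
    PowerSeries.coeff n (opT S t c3 h1 h0 y (ℓ + 1)) =
      ((c3 * r ^ 3 - c3 * (3 * S / 4 - 1 / 4 - 3 * t) * r ^ 2 + h1 * r + h0 : ℝ) : ℂ) *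
        PowerSeries.coeff n (y (ℓ + 1)) +
      ((3 * c3 * r ^ 2 - 2 * c3 * (3 * S / 4 - 1 / 4 - 3 * t) * r + h1 : ℝ) : ℂ) *
        PowerSeries.coeff n (y ℓ) := by
  have hr' : (n : ℂ) = t + r := by exact_mod_cast congrArg ((↑) : ℝ → ℂ) hr
  rw [opT, coeff_opR_succ_of_lt hℓ h h' hlt, sym, dsym, hr']
  push_cast
  ring

end Leading

/-- Every vector in `P` has leading coefficients of index `ℓ`, `ℓ + 1` of ratio `r`. -/
def LeadRatio (P : (ℕ → PowerSeries ℂ) → Prop) (ℓ n : ℕ) (r : ℝ) : Prop :=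
  ∀ y, P y → PowerSeries.coeff n (y (ℓ + 1)) = r * PowerSeries.coeff n (y ℓ)

/-- Vectors in `P` can be mapped to vectors in `Q` shifting the ratio of leading coefficients
by `δ`. -/
def Shift (P Q : (ℕ → PowerSeries ℂ) → Prop) (ℓ n : ℕ) (δ : ℝ) : Prop :=
  ∀ y, P y → ∃ v, Q v ∧ ∃ h : ℂ, h ≠ 0 ∧ PowerSeries.coeff n (v ℓ) = h * PowerSeries.coeff n (y ℓ) ∧
    PowerSeries.coeff n (v (ℓ + 1)) =
      h * (PowerSeries.coeff n (y (ℓ + 1)) + δ * PowerSeries.coeff n (y ℓ))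

lemma LeadRatio.backward {P Q : (ℕ → PowerSeries ℂ) → Prop} {ℓ n : ℕ} {δ r : ℝ}
    (hr : LeadRatio Q ℓ n r) (hs : Shift P Q ℓ n δ) : LeadRatio P ℓ n (r - δ) := by
  intro y hy
  obtain ⟨v, hv, h, h0, e, e'⟩ := hs y hy
  have := hr v hv
  rw [e, e'] at this
  refine mul_left_cancel₀ h0 ?_
  push_cast
  linear_combination this

lemma LeadRatio.forward {P : (ℕ → PowerSeries ℂ) → Prop} {a b c d ℓ n : ℕ} {δ r : ℝ}
    (hr : LeadRatio P ℓ n r) (hs : Shift P (Bal a b c d) ℓ n δ) (hP : ∃ y, P y) (hℓ : ℓ + 1 ≤ 3) :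
    LeadRatio (Bal a b c d) ℓ n (r + δ) := by
  intro u hu
  obtain ⟨y, hy⟩ := hP
  obtain ⟨v, hv, h, h0, e, e'⟩ := hs y hy
  obtain ⟨t, ht⟩ := hv.eq_mul hu
  have := hr y hy
  rw [ht ℓ (by lia), ht _ hℓ, PowerSeries.coeff_C_mul, PowerSeries.coeff_C_mul, e, e', this]
  push_cast
  ring

lemma isQ_opT {a b c d S t : ℕ} {y : ℕ → PowerSeries ℂ} (hy : Bal a b c d y) {c3 h1 h0 : ℝ}
    (hS : S = a + b + c + d) : IsQ (3 * (S + 2 : ℕ)) (opT S t c3 h1 h0 y) := by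
  subst hS
  exact IsQ.opR hy.isQ _ _ _

lemma ord_opT {a b c d S t : ℕ} {y : ℕ → PowerSeries ℂ} (hy : Bal a b c d y) {c3 h1 h0 : ℝ} :
    OrdGE (seq4 a b c d) (opT S t c3 h1 h0 y) :=
  OrdGE.opR (seq4_antitone hy.le_ab hy.le_bc hy.le_cd) hy.ord

/-- The operator `opT` maps `Bal a b c d` to `Bal a' b' c' d'` once the orders are known. -/
lemma bal_opT {a b c d a' b' c' d' S t n ℓ : ℕ} {y : ℕ → PowerSeries ℂ} (hy : Bal a b c d y)
    {c3 h1 h0 : ℝ} (hS : S = a + b + c + d) (hS' : S + 2 = a' + b' + c' + d')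
    (hab : b' ≤ a') (hbc : c' ≤ b') (hcd : d' ≤ c') (hℓ : ℓ ≤ 3)
    (hne : PowerSeries.coeff n (opT S t c3 h1 h0 y ℓ) ≠ 0)
    (ho : OrdGE (seq4 a' b' c' d') (opT S t c3 h1 h0 y)) :
    Bal a' b' c' d' (opT S t c3 h1 h0 y) := by
  have hQ := isQ_opT (t := t) hy (c3 := c3) (h1 := h1) (h0 := h0) hS
  refine ⟨hS' ▸ hQ, fun h => hne ?_, ho, hab, hbc, hcd⟩
  rw [hQ.eq_zero h ℓ hℓ, map_zero]

/-- A shift produced by `opT`. -/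
lemma shift_opT {a b c d a' b' c' d' S t ℓ : ℕ} {c3 h1 h0 δ : ℝ} (hℓ : ℓ + 1 ≤ 3)
    (hh : h0 ≠ 0) (hδ : δ = h1 / h0) (hS : S = a + b + c + d) (hS' : S + 2 = a' + b' + c' + d')
    (hab : b' ≤ a') (hbc : c' ≤ b') (hcd : d' ≤ c')
    (hd : ∀ y, Bal a b c d y → PowerSeries.X ^ t ∣ y ℓ ∧ PowerSeries.X ^ t ∣ y (ℓ + 1) ∧
      (∀ j < ℓ, PowerSeries.X ^ (t + 1) ∣ y j) ∧ PowerSeries.coeff t (y ℓ) ≠ 0)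
    (ho : ∀ y, Bal a b c d y → OrdGE (seq4 a' b' c' d') (opT S t c3 h1 h0 y)) :
    Shift (Bal a b c d) (Bal a' b' c' d') ℓ t δ := by
  intro y hy
  obtain ⟨k, k', hlt, hne⟩ := hd y hy
  have e := coeff_opT_of_lt (S := S) (t := t) (c3 := c3) (h1 := h1) (h0 := h0) (by lia) k hlt
    (r := 0) (by simp)
  have e' := coeff_opT_succ_of_lt (S := S) (t := t) (c3 := c3) (h1 := h1) (h0 := h0) hℓ k k' hlt
    (r := 0) (by simp)
  simp only [ne_eq, OfNat.ofNat_ne_zero, not_false_eq_true, zero_pow, mul_zero, sub_zero,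
    zero_add] at e e'
  have hh' : (h0 : ℂ) ≠ 0 := by exact_mod_cast hh
  refine ⟨_, bal_opT (n := t) (ℓ := ℓ) hy hS hS' hab hbc hcd (by lia) ?_ (ho y hy), h0, hh', e, ?_⟩
  · rw [e]
    exact mul_ne_zero hh' hne
  · rw [e', hδ]
    push_cast
    field_simp

/-- The operator raising the exponents `t + x` and `t + z` by one. -/
noncomputable def opOne (S t : ℕ) (x z : ℝ) : (ℕ → PowerSeries ℂ) → ℕ → PowerSeries ℂ :=
  opT S t 1 (x * z - (x + z + 1) / 4 * (x + z)) (x * z * ((x + z + 1) / 4))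

section OpOne

variable {S t n ℓ : ℕ} {y : ℕ → PowerSeries ℂ} {x z : ℝ}

lemma X_pow_succ_dvd_opOne (hS : (S : ℝ) = 4 * t + x + z) (hℓ : ℓ ≤ 3)
    (ho : PowerSeries.X ^ n ∣ opOne S t x z y ℓ) (h : PowerSeries.X ^ n ∣ y ℓ)
    (hlt : ∀ j < ℓ, PowerSeries.X ^ (n + 1) ∣ y j) (hn : (n : ℝ) = t + x ∨ (n : ℝ) = t + z) :
    PowerSeries.X ^ (n + 1) ∣ opOne S t x z y ℓ := by
  refine X_pow_succ_dvd ho ?_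
  have key : ∀ r : ℝ, (n : ℝ) = t + r → (r - x) * (r - z) = 0 →
      PowerSeries.coeff n (opOne S t x z y ℓ) = 0 := by
    intro r hr h0
    rw [opOne, coeff_opT_of_lt hℓ h hlt hr, hS]
    have : (1 : ℝ) * r ^ 3 - 1 * (3 * (4 * t + x + z) / 4 - 1 / 4 - 3 * t) * r ^ 2 +
        (x * z - (x + z + 1) / 4 * (x + z)) * r + x * z * ((x + z + 1) / 4) = 0 := by
      linear_combination (r + (x + z + 1) / 4) * h0
    rw [this]
    simp
  exact hn.elim (fun hr => key x hr (by ring)) fun hr => key z hr (by ring)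

lemma X_pow_succ_dvd_opOne_succ (hS : (S : ℝ) = 4 * t + x + x) (hℓ : ℓ + 1 ≤ 3)
    (ho : PowerSeries.X ^ n ∣ opOne S t x x y (ℓ + 1)) (h : PowerSeries.X ^ n ∣ y ℓ)
    (h' : PowerSeries.X ^ n ∣ y (ℓ + 1)) (hlt : ∀ j < ℓ, PowerSeries.X ^ (n + 1) ∣ y j)
    (hn : (n : ℝ) = t + x) : PowerSeries.X ^ (n + 1) ∣ opOne S t x x y (ℓ + 1) := by
  refine X_pow_succ_dvd ho ?_
  rw [opOne, coeff_opT_succ_of_lt hℓ h h' hlt hn, hS]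
  rw [← ofReal_zero]
  have e1 : (1 : ℝ) * x ^ 3 - 1 * (3 * (4 * t + x + x) / 4 - 1 / 4 - 3 * t) * x ^ 2 +
      (x * x - (x + x + 1) / 4 * (x + x)) * x + x * x * ((x + x + 1) / 4) = 0 := by ring
  have e2 : (3 : ℝ) * 1 * x ^ 2 - 2 * 1 * (3 * (4 * t + x + x) / 4 - 1 / 4 - 3 * t) * x +
      (x * x - (x + x + 1) / 4 * (x + x)) = 0 := by ring
  rw [e1, e2]
  simp

lemma X_pow_succ_dvd_opTwo (hS : (S : ℝ) = 4 * t + x + z) (hℓ : ℓ ≤ 3)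
    (ho : PowerSeries.X ^ n ∣ opTwo S t x z y ℓ) (h : PowerSeries.X ^ n ∣ y ℓ)
    (hlt : ∀ j < ℓ, PowerSeries.X ^ (n + 2) ∣ y j) (hn : (n : ℝ) = t + x)
    (hL : opL (t + x) (t + z) t t y ℓ = 0) (hxz : x - z + 1 ≠ 0) (hx : x + 1 ≠ 0) :
    PowerSeries.X ^ (n + 2) ∣ opTwo S t x z y ℓ := by
  refine X_pow_succ_dvd (n := n + 1) (X_pow_succ_dvd ho ?_)
    (coeff_succ_opTwo_eq_zero ?_ ?_ h hlt hL hxz hx)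
  · rw [opTwo, coeff_opT_of_lt hℓ h (fun j hj => (pow_dvd_pow _ (by lia)).trans (hlt j hj)) hn, hS]
    have : raiseN x z * x ^ 3 - raiseN x z * (3 * (4 * t + x + z) / 4 - 1 / 4 - 3 * t) * x ^ 2 +
        (3 * z - x - 1) / 4 * (x * raiseN x z - raiseD x z) * x +
        x * ((3 * z - x - 1) / 4) * raiseD x z = 0 := by ring
    rw [this]
    simp
  · exact_mod_cast congrArg ((↑) : ℝ → ℂ) hS
  · exact_mod_cast congrArg ((↑) : ℝ → ℂ) hn

end OpOne

/-- Raising the two smaller exponents by one. -/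
lemma shift_one_low {t c : ℕ} (hc : c < t) :
    Shift (Bal t t c c) (Bal t t (c + 1) (c + 1)) 0 t
      (4 / (2 * ((c : ℝ) - t) + 1) - 2 / ((c : ℝ) - t)) := by
  set x : ℝ := (c : ℝ) - t with hx
  have hx0 : x ≠ 0 := sub_ne_zero.2 (by exact_mod_cast hc.ne)
  have hx1 : 2 * x + 1 ≠ 0 := by
    have : 2 * (c : ℤ) - 2 * t + 1 ≠ 0 := by lia
    have : 2 * (c : ℝ) - 2 * t + 1 ≠ 0 := by exact_mod_cast this
    rw [hx]; convert! this using 1; ring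
  have hS : ((t + t + c + c : ℕ) : ℝ) = 4 * t + x + x := by rw [hx]; push_cast; ring
  have hh : x * x * ((x + x + 1) / 4) ≠ 0 :=
    mul_ne_zero (mul_ne_zero hx0 hx0) (div_ne_zero (by rwa [← two_mul]) (by norm_num))
  refine shift_opT (S := t + t + c + c) (c3 := 1) (ℓ := 0)
    (h1 := x * x - (x + x + 1) / 4 * (x + x)) (by lia) hh ?_ rfl (by lia) (by lia) (by lia) (by lia)
    (fun y hy => ⟨hy.ord0, hy.ord1, by simp, hy.coeff0_ne⟩) (fun y hy => ?_)
  · rw [eq_div_iff hh]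
    field_simp
    ring
  · have o := ordGE_seq4.1 (ord_opT (S := t + t + c + c) (t := t) hy (c3 := 1)
      (h1 := x * x - (x + x + 1) / 4 * (x + x)) (h0 := x * x * ((x + x + 1) / 4)))
    refine ordGE_seq4.2 ⟨o.1, o.2.1, ?_, ?_⟩
    · refine X_pow_succ_dvd_opOne hS (by lia) o.2.2.1 hy.ord2 (fun j hj => ?_) (Or.inl (by rw [hx]; ring))
      interval_cases j
      exacts [(pow_dvd_pow _ hc).trans hy.ord0, (pow_dvd_pow _ hc).trans hy.ord1]
    · refine X_pow_succ_dvd_opOne_succ (ℓ := 2) hS (by lia) o.2.2.2 hy.ord2 hy.ord3 (fun j hj => ?_)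
        (by rw [hx]; ring)
      interval_cases j
      exacts [(pow_dvd_pow _ hc).trans hy.ord0, (pow_dvd_pow _ hc).trans hy.ord1]

/-- Raising the two larger exponents by one. -/
lemma shift_one_high {t k : ℕ} (hk : 1 ≤ k) :
    Shift (Bal (t + k) (t + k) t t) (Bal (t + k + 1) (t + k + 1) t t) 2 t
      (4 / (2 * (k : ℝ) + 1) - 2 / (k : ℝ)) := by
  have hk0 : (k : ℝ) ≠ 0 := by positivity
  have hS : ((t + k + (t + k) + t + t : ℕ) : ℝ) = 4 * t + k + k := by push_cast; ring
  have hh : (k : ℝ) * k * ((k + k + 1) / 4) ≠ 0 := by positivity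
  refine shift_opT (S := t + k + (t + k) + t + t) (c3 := 1) (ℓ := 2)
    (h1 := (k : ℝ) * k - (k + k + 1) / 4 * (k + k)) (by lia) hh ?_ rfl (by lia) (by lia) (by lia)
    (by lia) (fun y hy => ⟨hy.ord2, hy.ord3, fun j hj => ?_, hy.coeff2_ne (by lia)⟩)
    (fun y hy => ?_)
  · have : (k : ℝ) + k + 1 ≠ 0 := by positivity
    field_simp
    ring
  · interval_cases j
    exacts [(pow_dvd_pow _ (by lia)).trans hy.ord0, (pow_dvd_pow _ (by lia)).trans hy.ord1]
  · have o := ordGE_seq4.1 (ord_opT (S := t + k + (t + k) + t + t) (t := t) hy (c3 := 1)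
      (h1 := (k : ℝ) * k - (k + k + 1) / 4 * (k + k)) (h0 := (k : ℝ) * k * ((k + k + 1) / 4)))
    refine ordGE_seq4.2 ⟨?_, ?_, o.2.2.1, o.2.2.2⟩
    · exact X_pow_succ_dvd_opOne hS (by lia) o.1 hy.ord0 (by simp) (Or.inl (by push_cast; ring))
    · exact X_pow_succ_dvd_opOne_succ (ℓ := 0) hS (by lia) o.2.1 hy.ord0 hy.ord1 (by simp)
        (by push_cast; ring)

/-- Raising the largest and the smallest exponent by one. -/
lemma shift_one_mid {t k d : ℕ} (hk : 1 ≤ k) (hd : d < t) (he : Even (k + t + d)) :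
    Shift (Bal (t + k) t t d) (Bal (t + k + 1) t t (d + 1)) 1 t
      (4 / ((k : ℝ) - (t - d) + 1) - 1 / k + 1 / (t - d)) := by
  set z : ℝ := (d : ℝ) - t with hz
  have hz0 : z ≠ 0 := sub_ne_zero.2 (by exact_mod_cast hd.ne)
  have hk0 : (k : ℝ) ≠ 0 := by positivity
  have hz1 : k + z + 1 ≠ 0 := by
    intro h
    have : ((k + d + 1 : ℕ) : ℝ) = t := by rw [hz] at h; push_cast; linarith
    have : k + d + 1 = t := by exact_mod_cast this
    grind
  have hS : ((t + k + t + t + d : ℕ) : ℝ) = 4 * t + k + z := by rw [hz]; push_cast; ring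
  have hh : k * z * ((k + z + 1) / 4) ≠ 0 :=
    mul_ne_zero (mul_ne_zero hk0 hz0) (div_ne_zero hz1 (by norm_num))
  refine shift_opT (S := t + k + t + t + d) (c3 := 1) (ℓ := 1)
    (h1 := k * z - (k + z + 1) / 4 * (k + z)) (by lia) hh ?_ rfl (by lia) (by lia) (by lia) (by lia)
    (fun y hy => ⟨hy.ord1, hy.ord2, fun j hj => ?_, hy.coeff1_ne (by lia)⟩) (fun y hy => ?_)
  · rw [show (t : ℝ) - d = -z by rw [hz]; ring, show (k : ℝ) - -z + 1 = k + z + 1 by ring]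
    field_simp
    ring
  · interval_cases j
    exact (pow_dvd_pow _ (by lia)).trans hy.ord0
  · have o := ordGE_seq4.1 (ord_opT (S := t + k + t + t + d) (t := t) hy (c3 := 1)
      (h1 := k * z - (k + z + 1) / 4 * (k + z)) (h0 := k * z * ((k + z + 1) / 4)))
    refine ordGE_seq4.2 ⟨?_, o.2.1, o.2.2.1, ?_⟩
    · exact X_pow_succ_dvd_opOne hS (by lia) o.1 hy.ord0 (by simp) (Or.inl (by push_cast; ring))
    · refine X_pow_succ_dvd_opOne hS (by lia) o.2.2.2 hy.ord3 (fun j hj => ?_)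
        (Or.inr (by rw [hz]; ring))
      interval_cases j
      exacts [(pow_dvd_pow _ (by lia)).trans hy.ord0, (pow_dvd_pow _ hd).trans hy.ord1,
        (pow_dvd_pow _ hd).trans hy.ord2]

/-- The shift of the ratio of leading coefficients produced by `opTwo`. -/
noncomputable def twoShift (x z : ℝ) : ℝ :=
  6 / (3 * x - 3 * z + 2) + 6 / (3 * x - 3 * z + 4) + 4 / (x + z + 1) - 1 / (x + 1) - 1 / x

section RaiseNe

variable {X Z : ℤ}

lemma raiseD_ne (hX1 : X + 1 ≠ 0) (he : Even (X + Z)) : raiseD X Z ≠ 0 := by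
  have h : (3 * X - 3 * Z + 2) * (3 * X - 3 * Z + 4) * (X + Z + 1) * (X + 1) ≠ 0 :=
    mul_ne_zero (mul_ne_zero (mul_ne_zero (by lia) (by lia)) (by grind)) hX1
  rw [raiseD]
  exact_mod_cast h

lemma opTwo_const_ne (hX : X ≠ 0) (hX1 : X + 1 ≠ 0) (he : Even (X + Z)) :
    (X : ℝ) * ((3 * Z - X - 1) / 4) * raiseD X Z ≠ 0 := by
  have h : 3 * Z - X - 1 ≠ 0 := by grind
  have h' : (3 * Z - X - 1 : ℝ) ≠ 0 := by exact_mod_cast h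
  exact mul_ne_zero (mul_ne_zero (by exact_mod_cast hX) (div_ne_zero h' (by norm_num)))
    (raiseD_ne hX1 he)

lemma raiseN_div_raiseD (hX : X ≠ 0) (hX1 : X + 1 ≠ 0) (he : Even (X + Z)) :
    raiseN X Z / raiseD X Z = twoShift X Z + 1 / X := by
  have h := raiseD_ne hX1 he
  rw [raiseD] at h
  simp only [mul_ne_zero_iff] at h
  obtain ⟨⟨⟨h1, h2⟩, h3⟩, h4⟩ := h
  have hX' : (X : ℝ) ≠ 0 := by exact_mod_cast hX
  rw [raiseN, raiseD, twoShift]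
  generalize (3 * X - 3 * Z + 2 : ℝ) = p at *
  generalize (3 * X - 3 * Z + 4 : ℝ) = q at *
  generalize (X + Z + 1 : ℝ) = r at *
  generalize (X + 1 : ℝ) = s at *
  field_simp
  ring

lemma twoShift_eq (hX : X ≠ 0) (hX1 : X + 1 ≠ 0) (he : Even (X + Z)) :
    twoShift X Z = ((3 * Z - X - 1) / 4 * (X * raiseN X Z - raiseD X Z)) /
      ((X : ℝ) * ((3 * Z - X - 1) / 4) * raiseD X Z) := by
  have h := opTwo_const_ne hX hX1 he
  have h' := h
  simp only [mul_ne_zero_iff] at h'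
  obtain ⟨⟨h1, h2⟩, h3⟩ := h'
  rw [← add_sub_cancel_right (twoShift X Z) (1 / (X : ℝ)), ← raiseN_div_raiseD hX hX1 he]
  generalize (3 * Z - X - 1 : ℝ) / 4 = p at *
  field_simp

end RaiseNe

section RaiseTwo

variable {a b c d t S : ℕ} {X Z : ℤ} {y : ℕ → PowerSeries ℂ}

lemma ord_opTwo_top (hy : Bal a b c d y) (ha : (a : ℤ) = t + X) (hX1 : X + 1 ≠ 0)
    (he : Even (X + Z)) (hS : (S : ℤ) = 4 * t + X + Z)
    (hL : opL a b c d = opL (t + X) (t + Z) t t) :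
    OrdGE (seq4 (a + 2) b c d) (opTwo S t X Z y) := by
  have o := ordGE_seq4.1 (ord_opT (S := S) (t := t) hy (c3 := raiseN X Z)
    (h1 := (3 * Z - X - 1) / 4 * (X * raiseN X Z - raiseD X Z))
    (h0 := X * ((3 * Z - X - 1) / 4) * raiseD X Z))
  have hXZ : X - Z + 1 ≠ 0 := by grind
  refine ordGE_seq4.2 ⟨X_pow_succ_dvd_opTwo ?_ (by lia) o.1 hy.ord0 (by simp) ?_ ?_ ?_ ?_, o.2⟩
  · exact_mod_cast hS
  · exact_mod_cast ha
  · push_cast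
    rw [← hL]
    exact hy.opL_eq_zero 0 (by lia)
  · exact_mod_cast hXZ
  · exact_mod_cast hX1

lemma ord_opTwo_bot (hy : Bal a b c d y) (hcd : d + 2 ≤ c) (hd : (d : ℤ) = t + X) (hX1 : X + 1 ≠ 0)
    (he : Even (X + Z)) (hS : (S : ℤ) = 4 * t + X + Z)
    (hL : opL a b c d = opL (t + X) (t + Z) t t) :
    OrdGE (seq4 a b c (d + 2)) (opTwo S t X Z y) := by
  have o := ordGE_seq4.1 (ord_opT (S := S) (t := t) hy (c3 := raiseN X Z)
    (h1 := (3 * Z - X - 1) / 4 * (X * raiseN X Z - raiseD X Z))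
    (h0 := X * ((3 * Z - X - 1) / 4) * raiseD X Z))
  have hXZ : X - Z + 1 ≠ 0 := by grind
  refine ordGE_seq4.2 ⟨o.1, o.2.1, o.2.2.1,
    X_pow_succ_dvd_opTwo ?_ (by lia) o.2.2.2 hy.ord3 ?_ ?_ ?_ ?_ ?_⟩
  · exact_mod_cast hS
  · exact fun j hj => (pow_dvd_pow _ hcd).trans (hy.dvd2 j (by lia))
  · exact_mod_cast hd
  · push_cast
    rw [← hL]
    exact hy.opL_eq_zero 3 le_rfl
  · exact_mod_cast hXZ
  · exact_mod_cast hX1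

end RaiseTwo

/-- Raising the smallest exponent by two. -/
lemma shift_two_bot {t c d : ℕ} (hdc : d + 2 ≤ c) (hct : c ≤ t) (he : Even (c + d)) :
    Shift (Bal t t c d) (Bal t t c (d + 2)) 0 t (twoShift (d - t) (c - t)) := by
  have hX : (d : ℤ) - t ≠ 0 := by lia
  have hX1 : (d : ℤ) - t + 1 ≠ 0 := by lia
  have hE : Even ((d : ℤ) - t + (c - t)) := by grind
  have e := twoShift_eq hX hX1 hE
  refine shift_opT (by lia) (opTwo_const_ne hX hX1 hE) ?_ rfl (by lia) le_rfl hct hdc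
    (fun y hy => ⟨hy.ord0, hy.ord1, by simp, hy.coeff0_ne⟩)
    (fun y hy => ord_opTwo_bot hy hdc (by ring) hX1 hE (by push_cast; ring)
      (opL_congr ?_ ?_ ?_ ?_))
  · rw [← e]
    push_cast
    rfl
  all_goals push_cast; ring

/-- Raising the largest exponent by two, block in the last two exponents. -/
lemma shift_two_top_high {t k m : ℕ} (hm : 1 ≤ m) (hk : m ≤ k) (he : Even (k + m)) :
    Shift (Bal (t + k) (t + m) t t) (Bal (t + k + 2) (t + m) t t) 2 t (twoShift k m) := by
  have hX : (k : ℤ) ≠ 0 := by lia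
  have hX1 : (k : ℤ) + 1 ≠ 0 := by lia
  have hE : Even ((k : ℤ) + m) := by exact_mod_cast he
  have e := twoShift_eq hX hX1 hE
  refine shift_opT (by lia) (opTwo_const_ne hX hX1 hE) ?_ rfl (by lia) (by lia) (by lia) le_rfl
    (fun y hy => ⟨hy.ord2, hy.ord3, fun j hj => (pow_dvd_pow _ (by lia)).trans (hy.dvd1 j (by lia)),
      hy.coeff2_ne (by lia)⟩)
    (fun y hy => ord_opTwo_top hy (by push_cast; ring) hX1 hE (by push_cast; ring)
      (opL_congr ?_ ?_ ?_ ?_))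
  · rw [← e]
    push_cast
    rfl
  all_goals push_cast; ring

/-- Raising the largest exponent by two, block in the middle. -/
lemma shift_two_top_mid {t k d : ℕ} (hk : 1 ≤ k) (hd : d ≤ t) (he : Even (k + t + d)) :
    Shift (Bal (t + k) t t d) (Bal (t + k + 2) t t d) 1 t (twoShift k (d - t)) := by
  have hX : (k : ℤ) ≠ 0 := by lia
  have hX1 : (k : ℤ) + 1 ≠ 0 := by lia
  have hE : Even ((k : ℤ) + (d - t)) := by grind
  have e := twoShift_eq hX hX1 hE
  refine shift_opT (by lia) (opTwo_const_ne hX hX1 hE) ?_ rfl (by lia) (by lia) (by lia) hd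
    (fun y hy => ⟨hy.ord1, hy.ord2, fun j hj => ?_, hy.coeff1_ne (by lia)⟩)
    (fun y hy => ord_opTwo_top hy (by push_cast; ring) hX1 hE (by push_cast; ring)
      (opL_congr ?_ ?_ ?_ ?_))
  · rw [← e]
    push_cast
    rfl
  · obtain rfl : j = 0 := by lia
    exact (pow_dvd_pow _ (by lia)).trans hy.ord0
  all_goals push_cast; ring

section Block

variable {S t : ℕ} {y : ℕ → PowerSeries ℂ} {c3 h1 h0 : ℝ}

lemma coeff_opT_self_one (h : ∀ j ≤ 1, PowerSeries.X ^ t ∣ y j) :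
    PowerSeries.coeff t (opT S t c3 h1 h0 y 1) = h0 * PowerSeries.coeff t (y 1) +
      h1 * PowerSeries.coeff t (y 0) := by
  rw [opT, coeff_opR_one h, sym, dsym]
  ring

lemma coeff_opT_self_two (h : ∀ j ≤ 2, PowerSeries.X ^ t ∣ y j) :
    PowerSeries.coeff t (opT S t c3 h1 h0 y 2) = h0 * PowerSeries.coeff t (y 2) +
      h1 * PowerSeries.coeff t (y 1) -
      c3 * (3 * S / 4 - 1 / 4 - 3 * t) * PowerSeries.coeff t (y 0) := by
  rw [opT, coeff_opR_two h, sym, dsym, ddsym]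
  ring

lemma coeff_opT_self_three (h : ∀ j ≤ 3, PowerSeries.X ^ t ∣ y j) :
    PowerSeries.coeff t (opT S t c3 h1 h0 y 3) = h0 * PowerSeries.coeff t (y 3) +
      h1 * PowerSeries.coeff t (y 2) -
      c3 * (3 * S / 4 - 1 / 4 - 3 * t) * PowerSeries.coeff t (y 1) +
      c3 * PowerSeries.coeff t (y 0) := by
  rw [opT, coeff_opR_three h, sym, dsym, ddsym]
  ring

end Block

lemma Bal.eq_zero_of_eq {t : ℕ} {y : ℕ → PowerSeries ℂ} (hy : Bal t t t t y) :
    y 1 = 0 ∧ y 2 = 0 ∧ y 3 = 0 := by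
  obtain ⟨h, hh, -, e1, e2, e3⟩ := hy.isQ
  have key : ∀ ℓ ≤ 3, 1 ≤ ℓ → ∀ r : ℂ, PowerSeries.X ^ t ∣ PowerSeries.C r * h ℓ → r ≠ 0 →
      h ℓ = 0 := by
    intro ℓ hℓ hℓ1 r hd hr
    refine MF.sturm (hh ℓ hℓ) (n := t) (by push_cast; lia) ?_
    have := hd.mul_left (PowerSeries.C r⁻¹)
    rwa [← mul_assoc, ← map_mul, inv_mul_cancel₀ hr, map_one, one_mul] at this
  have z3 : h 3 = 0 := key 3 le_rfl (by lia) 288 (by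
    have := hy.ord3; rw [e3] at this; rwa [map_ofNat]) (by norm_num)
  have z2 : h 2 = 0 := key 2 (by lia) (by lia) 24 (by
    have := hy.ord2; rw [e2, z3, mul_zero, add_zero] at this; rwa [map_ofNat]) (by norm_num)
  have z1 : h 1 = 0 := key 1 (by lia) (by lia) 4 (by
    have := hy.ord1; rw [e1, z2, z3, mul_zero, mul_zero, add_zero, add_zero] at this; rwa [map_ofNat]) (by norm_num)
  rw [e1, e2, e3, z1, z2, z3]
  simp

lemma leadRatio_one_one (t : ℕ) : LeadRatio (Bal (t + 1) (t + 1) t t) 2 t 4 := by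
  obtain ⟨y, hy⟩ := exists_bal (a := t) (b := t) (c := t) (d := t) le_rfl le_rfl le_rfl (by grind)
  obtain ⟨z1, z2, z3⟩ := hy.eq_zero_of_eq
  have hS : (((t + t + t + t : ℕ) : ℝ)) = 4 * t + 0 + 0 := by push_cast; ring
  have o := ordGE_seq4.1 (ord_opT (S := t + t + t + t) (t := t) hy (c3 := 1)
    (h1 := 0 * 0 - (0 + 0 + 1) / 4 * (0 + 0)) (h0 := 0 * 0 * ((0 + 0 + 1) / 4)))
  have e2 : PowerSeries.coeff t (opOne (t + t + t + t) t 0 0 y 2) =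
      PowerSeries.coeff t (y 0) / 4 := by
    rw [opOne, coeff_opT_self_two hy.dvd2, z1, z2]
    push_cast
    simp only [map_zero]
    ring
  have e3 : PowerSeries.coeff t (opOne (t + t + t + t) t 0 0 y 3) = PowerSeries.coeff t (y 0) := by
    rw [opOne, coeff_opT_self_three hy.dvd3, z1, z2, z3]
    push_cast
    simp only [map_zero]
    ring
  have hb : Bal (t + 1) (t + 1) t t (opOne (t + t + t + t) t 0 0 y) :=
    bal_opT (n := t) (ℓ := 3) hy rfl (by lia) le_rfl (by lia) le_rfl le_rfl
      (by rw [opOne] at e3; rw [e3]; exact hy.coeff0_ne)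
      (ordGE_seq4.2 ⟨X_pow_succ_dvd_opOne hS (by lia) o.1 hy.ord0 (by simp) (by simp),
        X_pow_succ_dvd_opOne_succ (ℓ := 0) hS (by lia) o.2.1 hy.ord0 hy.ord1 (by simp) (by simp),
        o.2.2⟩)
  intro v hv
  obtain ⟨s, hs⟩ := hb.eq_mul hv
  rw [hs 2 (by lia), hs 3 le_rfl, PowerSeries.coeff_C_mul, PowerSeries.coeff_C_mul, e2, e3]
  push_cast
  ring

/-- The last two leading coefficients of a vector in `Bal (t + k) t t t` relative to the
second one. -/
def TripleHigh (t k : ℕ) (u v : ℝ) : Prop := ∀ y, Bal (t + k) t t t y →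
  PowerSeries.coeff t (y 2) = u * PowerSeries.coeff t (y 1) ∧
  PowerSeries.coeff t (y 3) = v * PowerSeries.coeff t (y 1)

lemma tripleHigh_two (t : ℕ) : TripleHigh t 2 (15 / 2) 30 := by
  obtain ⟨y, hy⟩ := exists_bal (a := t) (b := t) (c := t) (d := t) le_rfl le_rfl le_rfl (by grind)
  obtain ⟨z1, z2, z3⟩ := hy.eq_zero_of_eq
  have o : OrdGE (seq4 (t + 2) t t t) (opTwo (t + t + t + t) t (0 : ℤ) (0 : ℤ) y) :=
    ord_opTwo_top hy (by simp) (by simp) (by simp) (by push_cast; ring) (by simp)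
  have e1 : PowerSeries.coeff t (opTwo (t + t + t + t) t (0 : ℤ) (0 : ℤ) y 1) =
      2 * PowerSeries.coeff t (y 0) := by
    rw [opTwo, coeff_opT_self_one hy.dvd1, z1, raiseN, raiseD]
    push_cast
    simp only [map_zero]
    ring
  have e2 : PowerSeries.coeff t (opTwo (t + t + t + t) t (0 : ℤ) (0 : ℤ) y 2) =
      15 * PowerSeries.coeff t (y 0) := by
    rw [opTwo, coeff_opT_self_two hy.dvd2, z1, z2, raiseN, raiseD]
    push_cast
    simp only [map_zero]
    ring
  have e3 : PowerSeries.coeff t (opTwo (t + t + t + t) t (0 : ℤ) (0 : ℤ) y 3) =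
      60 * PowerSeries.coeff t (y 0) := by
    rw [opTwo, coeff_opT_self_three hy.dvd3, z1, z2, z3, raiseN, raiseD]
    push_cast
    simp only [map_zero]
    ring
  have hb : Bal (t + 2) t t t (opTwo (t + t + t + t) t (0 : ℤ) (0 : ℤ) y) :=
    bal_opT (n := t) (ℓ := 3) hy rfl (by lia) (by lia) le_rfl le_rfl le_rfl
      (by rw [opTwo] at e3; rw [e3]; exact mul_ne_zero (by norm_num) hy.coeff0_ne) o
  intro v hv
  obtain ⟨s, hs⟩ := hb.eq_mul hv
  rw [hs 1 (by lia), hs 2 (by lia), hs 3 le_rfl, PowerSeries.coeff_C_mul, PowerSeries.coeff_C_mul,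
    PowerSeries.coeff_C_mul, e1, e2, e3]
  push_cast
  constructor <;> ring

/-- Second order shift of leading coefficients produced by `opTwo`. -/
noncomputable def twoShiftSnd (x : ℝ) : ℝ := (twoShift x 0 + 1 / x) * (3 * x - 1) / (x * (x + 1))

lemma coeff_opTwo_self {X : ℤ} (hX : X ≠ 0) (hX1 : X + 1 ≠ 0) (hE : Even X) {S t : ℕ}
    (hS : (S : ℤ) = 4 * t + X) : ∃ h : ℂ, h ≠ 0 ∧ ∀ y : ℕ → PowerSeries ℂ,
    (PowerSeries.X ^ t ∣ y 0 → PowerSeries.coeff t (opTwo S t X (0 : ℤ) y 0) =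
      h * PowerSeries.coeff t (y 0)) ∧
    ((∀ j ≤ 1, PowerSeries.X ^ t ∣ y j) → PowerSeries.coeff t (opTwo S t X (0 : ℤ) y 1) =
      h * (PowerSeries.coeff t (y 1) + twoShift X 0 * PowerSeries.coeff t (y 0))) ∧
    ((∀ j ≤ 2, PowerSeries.X ^ t ∣ y j) → PowerSeries.coeff t (opTwo S t X (0 : ℤ) y 2) =
      h * (PowerSeries.coeff t (y 2) + twoShift X 0 * PowerSeries.coeff t (y 1) +
        twoShiftSnd X * PowerSeries.coeff t (y 0))) ∧
    ((∀ j ≤ 3, PowerSeries.X ^ t ∣ y j) → PowerSeries.coeff t (y 0) = 0 →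
      PowerSeries.coeff t (opTwo S t X (0 : ℤ) y 3) =
      h * (PowerSeries.coeff t (y 3) + twoShift X 0 * PowerSeries.coeff t (y 2) +
        twoShiftSnd X * PowerSeries.coeff t (y 1))) := by
  have hE' : Even (X + 0) := by simpa using hE
  have hh := opTwo_const_ne hX hX1 hE'
  have k1 := (eq_div_iff hh).1 (twoShift_eq hX hX1 hE')
  have k2 := (div_eq_iff (raiseD_ne hX1 hE')).1 (raiseN_div_raiseD hX hX1 hE')
  have hS' : (S : ℂ) = 4 * t + X := by exact_mod_cast congrArg ((↑) : ℤ → ℂ) hS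
  have hx0 : (X : ℂ) ≠ 0 := by exact_mod_cast hX
  have hx1 : (X : ℂ) + 1 ≠ 0 := by exact_mod_cast hX1
  have k3 : ((raiseN X (0 : ℤ) : ℝ) : ℂ) * (3 * S / 4 - 1 / 4 - 3 * t) =
      -(((X : ℝ) * ((3 * (0 : ℤ) - X - 1) / 4) * raiseD X (0 : ℤ) : ℝ) : ℂ) * twoShiftSnd X := by
    rw [k2, hS', twoShiftSnd, Int.cast_zero]
    push_cast
    field_simp
    ring
  refine ⟨((X : ℝ) * ((3 * (0 : ℤ) - X - 1) / 4) * raiseD X (0 : ℤ) : ℝ), by exact_mod_cast hh,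
    fun y => ⟨fun h => ?_, fun h => ?_, fun h => ?_, fun h h0 => ?_⟩⟩
  · rw [opTwo, coeff_opT_of_lt (by lia) h (by simp) (r := 0) (by simp)]
    simp
  · rw [opTwo, coeff_opT_self_one h, ← k1, Int.cast_zero]
    push_cast
    ring
  · rw [opTwo, coeff_opT_self_two h, ← k1, k3, Int.cast_zero]
    push_cast
    ring
  · rw [opTwo, coeff_opT_self_three h, ← k1, k3, h0, Int.cast_zero]
    push_cast
    ring

lemma TripleHigh.add_two {t k : ℕ} {u v : ℝ} (h : TripleHigh t k u v) (hk : 1 ≤ k) (he : Even k) :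
    TripleHigh t (k + 2) (u + twoShift k 0) (v + twoShift k 0 * u + twoShiftSnd k) := by
  obtain ⟨y, hy⟩ := exists_bal (a := t + k) (b := t) (c := t) (d := t) (by lia) le_rfl le_rfl
    (by grind)
  obtain ⟨y2, y3⟩ := h y hy
  have hX : (k : ℤ) ≠ 0 := by lia
  have hX1 : (k : ℤ) + 1 ≠ 0 := by lia
  have hE : Even (k : ℤ) := by exact_mod_cast he
  have o : OrdGE (seq4 (t + k + 2) t t t) (opTwo (t + k + t + t + t) t (k : ℤ) (0 : ℤ) y) :=
    ord_opTwo_top hy (by push_cast; ring) hX1 (by simpa using hE) (by push_cast; ring) (by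
      apply opL_congr <;> push_cast <;> ring)
  obtain ⟨r, hr, H⟩ := coeff_opTwo_self hX hX1 hE (S := t + k + t + t + t) (t := t)
    (by push_cast; ring)
  obtain ⟨-, e1, e2, e3⟩ := H y
  have y0 : PowerSeries.coeff t (y 0) = 0 := coeff_eq_zero_of_dvd hy.ord0 (by lia)
  have f1 := e1 hy.dvd1
  have f2 := e2 hy.dvd2
  have f3 := e3 hy.dvd3 y0
  rw [y0, mul_zero, add_zero] at f1
  rw [y0, y2, mul_zero, add_zero] at f2
  rw [y2, y3] at f3
  have hb : Bal (t + k + 2) t t t (opTwo (t + k + t + t + t) t (k : ℤ) (0 : ℤ) y) :=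
    bal_opT (n := t) (ℓ := 1) hy rfl (by lia) (by lia) le_rfl le_rfl (by lia)
      (by rw [opTwo] at f1; rw [f1]; exact mul_ne_zero hr (hy.coeff1_ne (by lia))) o
  intro v' hv
  obtain ⟨s, hs⟩ := hb.eq_mul hv
  rw [hs 1 (by lia), hs 2 (by lia), hs 3 le_rfl, PowerSeries.coeff_C_mul, PowerSeries.coeff_C_mul,
    PowerSeries.coeff_C_mul, f1, f2, f3]
  push_cast
  constructor <;> ring

/-- The leading coefficients of a vector in `Bal t t t d` relative to the first one. -/
def TripleLow (t d : ℕ) (u v : ℝ) : Prop := ∀ y, Bal t t t d y →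
  PowerSeries.coeff t (y 1) = u * PowerSeries.coeff t (y 0) ∧
  PowerSeries.coeff t (y 2) = v * PowerSeries.coeff t (y 0)

lemma tripleLow_self (t : ℕ) : TripleLow t t 0 0 := by
  intro y hy
  obtain ⟨z1, z2, -⟩ := hy.eq_zero_of_eq
  simp [z1, z2]

lemma TripleLow.sub_two {t d : ℕ} {u v : ℝ} (h : TripleLow t (d + 2) u v) (hd : d + 2 ≤ t)
    (he : Even (t + d)) : TripleLow t d (u - twoShift (d - t) 0)
      (v - twoShift (d - t) 0 * (u - twoShift (d - t) 0) - twoShiftSnd (d - t)) := by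
  intro y hy
  have hX : (d : ℤ) - t ≠ 0 := by lia
  have hX1 : (d : ℤ) - t + 1 ≠ 0 := by lia
  have hE : Even ((d : ℤ) - t) := by grind
  have o : OrdGE (seq4 t t t (d + 2))
      (opTwo (t + t + t + d) t ((d - t : ℤ) : ℝ) ((0 : ℤ) : ℝ) y) :=
    ord_opTwo_bot hy hd (by ring) hX1 (by simpa using hE) (by push_cast; ring) (by
      apply opL_congr <;> push_cast <;> ring)
  obtain ⟨r, hr, H⟩ := coeff_opTwo_self hX hX1 hE (S := t + t + t + d) (t := t)
    (by push_cast; ring)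
  obtain ⟨e0, e1, e2, -⟩ := H y
  have f0 := e0 hy.ord0
  have f1 := e1 hy.dvd1
  have f2 := e2 hy.dvd2
  have hb : Bal t t t (d + 2) (opTwo (t + t + t + d) t ((d - t : ℤ) : ℝ) ((0 : ℤ) : ℝ) y) :=
    bal_opT (n := t) (ℓ := 0) hy rfl (by lia) le_rfl le_rfl hd (by lia)
      (by rw [opTwo] at f0; rw [f0]; exact mul_ne_zero hr hy.coeff0_ne) o
  obtain ⟨g1, g2⟩ := h _ hb
  rw [f0, f1] at g1
  rw [f0, f2] at g2
  push_cast at g1 g2 ⊢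
  have g1' : PowerSeries.coeff t (y 1) =
      (u - twoShift (d - t) 0) * PowerSeries.coeff t (y 0) :=
    mul_left_cancel₀ hr (by linear_combination g1)
  refine ⟨g1', mul_left_cancel₀ hr ?_⟩
  linear_combination g2 - r * (twoShift (d - t) 0 : ℝ) * g1'

lemma twoShift_zero_pos {x : ℝ} (hx : 1 ≤ x) : 0 < twoShift x 0 := by
  have h1 : 0 < 6 / (3 * x - 3 * 0 + 2) := by apply div_pos <;> linarith
  have h2 : 0 < 6 / (3 * x - 3 * 0 + 4) := by apply div_pos <;> linarith
  have h3 : 2 / (2 * x) ≤ 3 / (x + 0 + 1) := by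
    rw [div_le_div_iff₀ (by linarith) (by linarith)]; linarith
  have h4 : 1 / x = 2 / (2 * x) := by field_simp
  have h5 : 4 / (x + 0 + 1) = 3 / (x + 0 + 1) + 1 / (x + 1) := by rw [add_zero]; ring
  rw [twoShift, h4, h5]
  linarith

lemma twoShiftSnd_pos {x : ℝ} (hx : 1 ≤ x) : 0 < twoShiftSnd x := by
  have := twoShift_zero_pos hx
  rw [twoShiftSnd]
  have : 0 < 3 * x - 1 := by linarith
  positivity

lemma tripleHigh_exists (t n : ℕ) :
    ∃ u v : ℝ, 0 < u ∧ 0 < v ∧ TripleHigh t (2 + 2 * n) u v := by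
  induction n with
  | zero => exact ⟨_, _, by norm_num, by norm_num, tripleHigh_two t⟩
  | succ n ih =>
    obtain ⟨u, v, hu, hv, h⟩ := ih
    have hx : (1 : ℝ) ≤ (2 + 2 * n : ℕ) := by push_cast; linarith [(n.cast_nonneg : (0 : ℝ) ≤ n)]
    have h1 := twoShift_zero_pos hx
    have h2 := twoShiftSnd_pos hx
    exact ⟨_, _, by positivity, by positivity, h.add_two (by lia) (by grind)⟩

lemma twoShift_neg_zero {m : ℝ} (hm : 2 ≤ m) : twoShift (-m) 0 < 0 ∧
    0 < twoShift (-m) 0 ^ 2 - twoShiftSnd (-m) := by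
  obtain ⟨q, hq⟩ : ∃ q, q = 6 / (3 * m - 2) + 6 / (3 * m - 4) + 3 / (m - 1) := ⟨_, rfl⟩
  have e : twoShift (-m) 0 = 1 / m - q := by
    have i1 : (3 * -m - 3 * 0 + 2) = -(3 * m - 2) := by ring
    have i2 : (3 * -m - 3 * 0 + 4) = -(3 * m - 4) := by ring
    have i3 : (-m + 0 + 1) = -(m - 1) := by ring
    have i4 : (-m + 1) = -(m - 1) := by ring
    rw [twoShift, hq, i1, i2, i3, i4]
    simp only [div_neg]
    ring
  have b1 : 1 / m < 6 / (3 * m - 2) := by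
    rw [div_lt_div_iff₀ (by linarith) (by linarith)]; linarith
  have b2 : 1 / (m - 1) < 6 / (3 * m - 4) := by
    rw [div_lt_div_iff₀ (by linarith) (by linarith)]; linarith
  have b3 : 0 < 1 / (m - 1) := by apply div_pos <;> linarith
  have b4 : 3 / (m - 1) = 3 * (1 / (m - 1)) := by ring
  have b5 : 0 < 1 / m := by positivity
  have e2 : twoShiftSnd (-m) = q * (3 * (1 / (m - 1)) + (1 / (m - 1) - 1 / m)) := by
    have : m - 1 ≠ 0 := by linarith
    have h' : -m + 1 ≠ 0 := by linarith
    rw [twoShiftSnd, e, show -m + 1 = -(m - 1) by ring]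
    field_simp
    ring
  rw [e2, e]
  have hq' : 0 < q - 4 * (1 / (m - 1)) - 1 / m := by rw [hq, b4]; linarith
  refine ⟨by linarith, ?_⟩
  have : (1 / m - q) ^ 2 - q * (3 * (1 / (m - 1)) + (1 / (m - 1) - 1 / m)) =
      q * (q - 4 * (1 / (m - 1)) - 1 / m) + (1 / m) ^ 2 := by ring
  rw [this]
  have : 0 < q := by linarith
  positivity

lemma tripleLow_exists (n : ℕ) : ∀ t d : ℕ, d + 2 * n = t →
    ∃ u v : ℝ, 0 ≤ u ∧ 0 ≤ v ∧ (d < t → 0 < u ∧ 0 < v) ∧ TripleLow t d u v := by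
  induction n with
  | zero =>
    rintro t d rfl
    exact ⟨0, 0, le_rfl, le_rfl, by simp, tripleLow_self _⟩
  | succ n ih =>
    intro t d h
    obtain ⟨u, v, hu, hv, -, hT⟩ := ih t (d + 2) (by lia)
    have hm : (2 : ℝ) ≤ t - d := by
      rw [← h]; push_cast; linarith [(n.cast_nonneg : (0 : ℝ) ≤ n)]
    obtain ⟨h1, h2⟩ := twoShift_neg_zero hm
    rw [neg_sub] at h1 h2
    have p1 : 0 < u - twoShift (d - t) 0 := by linarith
    have p2 : 0 < v - twoShift (d - t) 0 * (u - twoShift (d - t) 0) - twoShiftSnd (d - t) := by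
      nlinarith
    exact ⟨_, _, p1.le, p2.le, fun _ => ⟨p1, p2⟩, hT.sub_two (by lia) (by grind)⟩

lemma leadRatio_low_diag (n : ℕ) : ∀ t c : ℕ, c + n = t →
    ∃ r : ℝ, 0 ≤ r ∧ (c < t → 0 < r) ∧ LeadRatio (Bal t t c c) 0 t r := by
  induction n with
  | zero =>
    rintro t c rfl
    refine ⟨0, le_rfl, by simp, fun y hy => ?_⟩
    rw [add_zero] at hy ⊢
    rw [hy.eq_zero_of_eq.1]
    simp
  | succ n ih =>
    intro t c h
    obtain ⟨r, hr, -, hR⟩ := ih t (c + 1) (by lia)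
    have hx : (c : ℝ) - t = -(n + 1) := by rw [← h]; push_cast; ring
    have hn : (0 : ℝ) ≤ n := n.cast_nonneg
    have key : 0 < r - (4 / (2 * ((c : ℝ) - t) + 1) - 2 / ((c : ℝ) - t)) := by
      rw [hx, show (2 * -((n : ℝ) + 1) + 1) = -(2 * n + 1) by ring, div_neg, div_neg]
      have : 2 / ((n : ℝ) + 1) < 4 / (2 * n + 1) := by
        rw [div_lt_div_iff₀ (by linarith) (by linarith)]; linarith
      linarith
    exact ⟨_, key.le, fun _ => key, hR.backward (shift_one_low (by lia))⟩

lemma leadRatio_low (n : ℕ) : ∀ t c d : ℕ, d + 2 * n = c → c ≤ t →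
    ∃ r : ℝ, 0 ≤ r ∧ (d < t → 0 < r) ∧ LeadRatio (Bal t t c d) 0 t r := by
  induction n with
  | zero =>
    rintro t c d rfl hc
    exact leadRatio_low_diag (t - d) t _ (by lia)
  | succ n ih =>
    intro t c d h hc
    obtain ⟨r, hr, -, hR⟩ := ih t c (d + 2) (by lia) hc
    obtain ⟨i, rfl⟩ := Nat.exists_eq_add_of_le hc
    have hn : (0 : ℝ) ≤ n := n.cast_nonneg
    have hi : (0 : ℝ) ≤ i := i.cast_nonneg
    have hx : (d : ℝ) - (c + i : ℕ) = -(i + 2 * n + 2) := by rw [← h]; push_cast; ring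
    have hz : (c : ℝ) - (c + i : ℕ) = -i := by push_cast; ring
    have key : 0 < r - twoShift ((d : ℝ) - (c + i : ℕ)) ((c : ℝ) - (c + i : ℕ)) := by
      rw [hx, hz, twoShift,
        show 3 * -((i : ℝ) + 2 * n + 2) - 3 * -(i : ℝ) + 2 = -(6 * n + 4) by ring,
        show 3 * -((i : ℝ) + 2 * n + 2) - 3 * -(i : ℝ) + 4 = -(6 * n + 2) by ring,
        show -((i : ℝ) + 2 * n + 2) + -(i : ℝ) + 1 = -(2 * i + 2 * n + 1) by ring,
        show -((i : ℝ) + 2 * n + 2) + 1 = -(i + 2 * n + 1) by ring]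
      simp only [div_neg]
      have b1 : 1 / ((i : ℝ) + 2 * n + 1) < 2 / (2 * i + 2 * n + 1) := by
        rw [div_lt_div_iff₀ (by linarith) (by linarith)]; linarith
      have b2 : 1 / ((i : ℝ) + 2 * n + 2) < 2 / (2 * i + 2 * n + 1) := by
        rw [div_lt_div_iff₀ (by linarith) (by linarith)]; linarith
      have b3 : 4 / (2 * (i : ℝ) + 2 * n + 1) = 2 / (2 * i + 2 * n + 1) + 2 / (2 * i + 2 * n + 1) := by
        ring
      have b4 : 0 < 6 / (6 * (n : ℝ) + 4) := by positivity
      have b5 : 0 < 6 / (6 * (n : ℝ) + 2) := by positivity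
      linarith
    exact ⟨_, key.le, fun _ => key, hR.backward (shift_two_bot (by lia) (by lia) (by grind))⟩

lemma leadRatio_high_diag (t m : ℕ) :
    ∃ r : ℝ, 2 / ((m : ℝ) + 1) ≤ r ∧
      LeadRatio (Bal (t + (m + 1)) (t + (m + 1)) t t) 2 t r := by
  induction m with
  | zero => exact ⟨4, by norm_num, leadRatio_one_one t⟩
  | succ m ih =>
    obtain ⟨r, hr, hR⟩ := ih
    refine ⟨_, ?_, hR.forward (shift_one_high (by lia))
      (exists_bal le_rfl (by lia) le_rfl (by grind)) (by lia)⟩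
    have hm : (0 : ℝ) ≤ m := m.cast_nonneg
    push_cast
    have : 2 / ((m : ℝ) + 1 + 1) ≤ 4 / (2 * (m + 1) + 1) := by
      rw [div_le_div_iff₀ (by linarith) (by linarith)]; linarith
    linarith

lemma leadRatio_high (t m n : ℕ) : ∃ r : ℝ, 0 < r ∧
    LeadRatio (Bal (t + (m + 1 + 2 * n)) (t + (m + 1)) t t) 2 t r := by
  induction n with
  | zero =>
    obtain ⟨r, hr, hR⟩ := leadRatio_high_diag t m
    exact ⟨r, lt_of_lt_of_le (by positivity) hr, hR⟩
  | succ n ih =>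
    obtain ⟨r, hr, hR⟩ := ih
    refine ⟨_, ?_, hR.forward (shift_two_top_high (by lia) (by lia) (by grind))
      (exists_bal (by lia) (by lia) le_rfl (by grind)) (by lia)⟩
    have hm : (0 : ℝ) ≤ m := m.cast_nonneg
    have hn : (0 : ℝ) ≤ n := n.cast_nonneg
    have : 0 < twoShift ((m + 1 + 2 * n : ℕ) : ℝ) ((m + 1 : ℕ) : ℝ) := by
      push_cast
      rw [twoShift, show 3 * ((m : ℝ) + 1 + 2 * n) - 3 * (m + 1) + 2 = 6 * n + 2 by ring,
        show 3 * ((m : ℝ) + 1 + 2 * n) - 3 * (m + 1) + 4 = 6 * n + 4 by ring]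
      have b1 : 1 / ((m : ℝ) + 1 + 2 * n) < 3 / (6 * n + 2) := by
        rw [div_lt_div_iff₀ (by linarith) (by linarith)]; linarith
      have b2 : 1 / ((m : ℝ) + 1 + 2 * n + 1) < 3 / (6 * n + 2) := by
        rw [div_lt_div_iff₀ (by linarith) (by linarith)]; linarith
      have b3 : 6 / (6 * (n : ℝ) + 2) = 3 / (6 * n + 2) + 3 / (6 * n + 2) := by ring
      have b4 : 0 < 6 / (6 * (n : ℝ) + 4) := by positivity
      have b5 : 0 < 4 / ((m : ℝ) + 1 + 2 * n + (m + 1) + 1) := by positivity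
      linarith
    linarith

lemma leadRatio_mid_diag (e : ℕ) : ∀ t d : ℕ, d + (e + 1) = t →
    ∃ r : ℝ, 1 / ((e : ℝ) + 1) ≤ r ∧ LeadRatio (Bal (t + (e + 1)) t t d) 1 t r := by
  induction e with
  | zero =>
    rintro t d rfl
    have h : LeadRatio (Bal (d + (0 + 1) + 2) (d + (0 + 1)) (d + (0 + 1)) (d + (0 + 1))) 1
        (d + (0 + 1)) (15 / 2) := fun y hy => (tripleHigh_two _ y hy).1
    refine ⟨_, ?_, h.backward (shift_one_mid (k := 1) le_rfl (by lia) (by grind))⟩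
    push_cast
    norm_num
  | succ e ih =>
    intro t d h
    obtain ⟨r, hr, hR⟩ := ih t (d + 1) (by lia)
    have h1 := hR.forward (shift_two_top_mid (by lia) (by lia) (by grind))
      (exists_bal (by lia) le_rfl (by lia) (by grind)) (by lia)
    refine ⟨_, ?_, h1.backward (shift_one_mid (k := e + 1 + 1) (by lia) (by lia) (by grind))⟩
    have he : (0 : ℝ) ≤ e := e.cast_nonneg
    have ht : (t : ℝ) = d + (e + 1 + 1) := by rw [← h]; push_cast; ring
    push_cast
    rw [ht, twoShift, show 3 * ((e : ℝ) + 1) - 3 * (d + 1 - (d + (e + 1 + 1))) + 2 = 6 * e + 8 by ring,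
      show 3 * ((e : ℝ) + 1) - 3 * (d + 1 - (d + (e + 1 + 1))) + 4 = 6 * e + 10 by ring,
      show (e : ℝ) + 1 + (d + 1 - (d + (e + 1 + 1))) + 1 = 1 by ring,
      show (e : ℝ) + 1 + 1 - (d + (e + 1 + 1) - d) + 1 = 1 by ring,
      show (d : ℝ) + (e + 1 + 1) - d = e + 1 + 1 by ring]
    have b1 : 1 / ((e : ℝ) + 1 + 1) ≤ 6 / (6 * e + 8) := by
      rw [div_le_div_iff₀ (by linarith) (by linarith)]; linarith
    have b2 : 1 / ((e : ℝ) + 1 + 1) ≤ 6 / (6 * e + 10) := by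
      rw [div_le_div_iff₀ (by linarith) (by linarith)]; linarith
    linarith

lemma leadRatio_mid_up (n e t d : ℕ) (h : d + (e + 1) = t) :
    ∃ r : ℝ, 0 < r ∧ LeadRatio (Bal (t + (e + 1 + 2 * n)) t t d) 1 t r := by
  induction n with
  | zero =>
    obtain ⟨r, hr, hR⟩ := leadRatio_mid_diag e t d h
    exact ⟨r, lt_of_lt_of_le (by positivity) hr, hR⟩
  | succ n ih =>
    obtain ⟨r, hr, hR⟩ := ih
    refine ⟨_, ?_, hR.forward (shift_two_top_mid (by lia) (by lia) (by grind))
      (exists_bal (by lia) le_rfl (by lia) (by grind)) (by lia)⟩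
    have he : (0 : ℝ) ≤ e := e.cast_nonneg
    have hn : (0 : ℝ) ≤ n := n.cast_nonneg
    have hz : (d : ℝ) - t = -(e + 1) := by rw [← h]; push_cast; ring
    have : 0 < twoShift ((e + 1 + 2 * n : ℕ) : ℝ) (d - t) := by
      push_cast
      rw [hz, twoShift, show (e : ℝ) + 1 + 2 * n + -(e + 1) + 1 = 2 * n + 1 by ring]
      have b1 : 1 / ((e : ℝ) + 1 + 2 * n) < 2 / (2 * n + 1) := by
        rw [div_lt_div_iff₀ (by linarith) (by linarith)]; linarith
      have b2 : 1 / ((e : ℝ) + 1 + 2 * n + 1) < 2 / (2 * n + 1) := by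
        rw [div_lt_div_iff₀ (by linarith) (by linarith)]; linarith
      have b3 : 4 / (2 * (n : ℝ) + 1) = 2 / (2 * n + 1) + 2 / (2 * n + 1) := by ring
      have b4 : 0 < 6 / (3 * ((e : ℝ) + 1 + 2 * n) - 3 * -(e + 1) + 2) := by
        apply div_pos <;> linarith
      have b5 : 0 < 6 / (3 * ((e : ℝ) + 1 + 2 * n) - 3 * -(e + 1) + 4) := by
        apply div_pos <;> linarith
      linarith
    linarith

lemma leadRatio_mid_down (n : ℕ) : ∀ t d k : ℕ, d + (k + 1 + 2 * n) = t →
    ∃ r : ℝ, 0 < r ∧ LeadRatio (Bal (t + (k + 1)) t t d) 1 t r := by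
  induction n with
  | zero =>
    intro t d k h
    exact leadRatio_mid_up 0 k t d (by lia)
  | succ n ih =>
    intro t d k h
    obtain ⟨r, hr, hR⟩ := ih t (d + 1) (k + 1) (by lia)
    refine ⟨_, ?_, hR.backward (shift_one_mid (by lia) (by lia) (by grind))⟩
    have hk : (0 : ℝ) ≤ k := k.cast_nonneg
    have hn : (0 : ℝ) ≤ n := n.cast_nonneg
    have hz : (t : ℝ) - d = k + 2 * n + 3 := by rw [← h]; push_cast; ring
    push_cast
    rw [hz, show (k : ℝ) + 1 - (k + 2 * n + 3) + 1 = -(2 * n + 1) by ring, div_neg]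
    have b1 : 1 / ((k : ℝ) + 2 * n + 3) < 1 / (k + 1) := by
      rw [div_lt_div_iff₀ (by linarith) (by linarith)]; linarith
    have b2 : 0 < 4 / (2 * (n : ℝ) + 1) := by positivity
    linarith

/-- Leading coefficients of balanced vectors do not vanish unless all exponents agree. -/
lemma Bal.coeff_ne {a b c d : ℕ} {y : ℕ → PowerSeries ℂ} (hy : Bal a b c d y)
    (he : Even (a + b + c + d)) (hne : ¬(a = b ∧ b = c ∧ c = d)) :
    PowerSeries.coeff b (y 1) ≠ 0 ∧ PowerSeries.coeff c (y 2) ≠ 0 ∧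
      PowerSeries.coeff d (y 3) ≠ 0 := by
  have hab := hy.le_ab
  have hbc := hy.le_bc
  have hcd := hy.le_cd
  have cast_ne : ∀ r : ℝ, 0 < r → (r : ℂ) ≠ 0 := fun r hr => by exact_mod_cast hr.ne'
  refine ⟨?_, ?_, ?_⟩
  · rcases hab.lt_or_eq with h | rfl
    · exact hy.coeff1_ne h
    obtain ⟨n, hn⟩ : ∃ n, d + 2 * n = c := ⟨(c - d) / 2, by grind⟩
    obtain ⟨r, -, hr, hR⟩ := leadRatio_low n b c d hn hbc
    rw [hR y hy]
    exact mul_ne_zero (cast_ne r (hr (by lia))) hy.coeff0_ne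
  · rcases hbc.lt_or_eq with h | rfl
    · exact hy.coeff2_ne h
    rcases hab.lt_or_eq with h | rfl
    · obtain ⟨r, hr, hR⟩ : ∃ r : ℝ, 0 < r ∧ LeadRatio (Bal a c c d) 1 c r := by
        obtain ⟨k, rfl⟩ : ∃ k, a = c + (k + 1) := ⟨a - c - 1, by lia⟩
        obtain ⟨j, rfl⟩ := Nat.exists_eq_add_of_le hcd
        rcases Nat.eq_zero_or_pos j with rfl | hj
        · obtain ⟨n, rfl⟩ : ∃ n, k = 1 + 2 * n := ⟨(k - 1) / 2, by grind⟩
          obtain ⟨u, v, hu, -, hT⟩ := tripleHigh_exists d n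
          refine ⟨u, hu, fun z hz => (hT z ?_).1⟩
          convert! hz using 1
          lia
        · rcases le_or_gt j (k + 1) with hjk | hjk
          · obtain ⟨e, rfl⟩ : ∃ e, j = e + 1 := ⟨j - 1, by lia⟩
            obtain ⟨n, rfl⟩ : ∃ n, k = e + 2 * n := ⟨(k - e) / 2, by grind⟩
            obtain ⟨r, hr, hR⟩ := leadRatio_mid_up n e (d + (e + 1)) d rfl
            refine ⟨r, hr, ?_⟩
            rwa [show e + 2 * n + 1 = e + 1 + 2 * n by lia]
          · exact leadRatio_mid_down ((j - k - 1) / 2) _ _ _ (by grind)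
      rw [hR y hy]
      exact mul_ne_zero (cast_ne r hr) (hy.coeff1_ne h)
    · obtain ⟨u, v, -, -, hv, hT⟩ := tripleLow_exists ((c - d) / 2) c d (by grind)
      rw [(hT y hy).2]
      exact mul_ne_zero (cast_ne v (hv (by lia)).2) hy.coeff0_ne
  · rcases hcd.lt_or_eq with h | rfl
    · exact hy.coeff3_ne h
    rcases hbc.lt_or_eq with h | rfl
    · obtain ⟨m, rfl⟩ : ∃ m, b = d + (m + 1) := ⟨b - d - 1, by lia⟩
      obtain ⟨n, rfl⟩ : ∃ n, a = d + (m + 1 + 2 * n) := ⟨(a - (d + (m + 1))) / 2, by grind⟩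
      obtain ⟨r, hr, hR⟩ := leadRatio_high d m n
      rw [hR y hy]
      exact mul_ne_zero (cast_ne r hr) (hy.coeff2_ne h)
    · obtain ⟨n, rfl⟩ : ∃ n, a = d + (2 + 2 * n) := ⟨(a - d - 2) / 2, by grind⟩
      obtain ⟨u, v, -, hv, hT⟩ := tripleHigh_exists d n
      rw [(hT y hy).2]
      exact mul_ne_zero (cast_ne v hv) (hy.coeff1_ne (by lia))

lemma serrePS_sub_C_mul (k t : ℂ) (F G : PowerSeries ℂ) :
    serrePS k (F - PowerSeries.C t * G) = serrePS k F - PowerSeries.C t * serrePS k G := by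
  rw [serrePS_eq, serrePS_eq, serrePS_eq, ← PowerSeries.smul_eq_C_mul, map_sub, Derivation.map_smul,
    PowerSeries.smul_eq_C_mul, PowerSeries.smul_eq_C_mul]
  ring

lemma serreVecIter_sub_C_mul (k t : ℂ) (u y : ℕ → PowerSeries ℂ) (j : ℕ) :
    ∀ ℓ, serreVecIter k (fun ℓ => u ℓ - PowerSeries.C t * y ℓ) j ℓ =
      serreVecIter k u j ℓ - PowerSeries.C t * serreVecIter k y j ℓ := by
  induction j with
  | zero => exact fun ℓ => rfl
  | succ j ih =>
    intro ℓ
    cases ℓ with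
    | zero => simp only [serreVecIter, serreVec, ih, serrePS_sub_C_mul]
    | succ ℓ => simp only [serreVecIter, serreVec, ih, serrePS_sub_C_mul]; ring

lemma opL_sub_C_mul (a b c d t : ℂ) (u y : ℕ → PowerSeries ℂ) (ℓ : ℕ) :
    opL a b c d (fun ℓ => u ℓ - PowerSeries.C t * y ℓ) ℓ =
      opL a b c d u ℓ - PowerSeries.C t * opL a b c d y ℓ := by
  simp only [opL, serreVecIter_sub_C_mul]
  ring

lemma eq_zero_of_opL_eq_zero {a b c d : ℕ} {u : ℕ → PowerSeries ℂ} (hb : b ≤ a) (hc : c ≤ a)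
    (hd : d ≤ a) (hu : opL a b c d u 0 = 0) (h : PowerSeries.X ^ (a + 1) ∣ u 0) : u 0 = 0 := by
  have key : ∀ n, PowerSeries.X ^ (a + 1 + n) ∣ u 0 := by
    intro n
    induction n with
    | zero => exact h
    | succ n ih =>
      refine X_pow_succ_dvd ih ?_
      have h0 := coeff_opL_zero (a := a) (b := b) (c := c) (d := d) ih
      rw [hu, map_zero, eq_comm] at h0
      have ne : ∀ x : ℕ, x ≤ a → ((a + 1 + n : ℕ) : ℂ) - x ≠ 0 := fun x hx =>
        sub_ne_zero.2 (Nat.cast_injective.ne (by lia))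
      exact (mul_eq_zero.1 h0).resolve_left
        (mul_ne_zero (mul_ne_zero (mul_ne_zero (ne a le_rfl) (ne b hb)) (ne c hc)) (ne d hd))
  ext n
  exact coeff_eq_zero_of_dvd (key n) (by lia)

lemma IsQS.hasQExpansionAt {f : ℍ → ℂ} {F : PowerSeries ℂ} {n : ℕ} (hf : IsQS f F)
    (h : PowerSeries.X ^ n ∣ F) (h0 : PowerSeries.coeff n F ≠ 0) : HasQExpansionAt f n := by
  refine ⟨fun j => PowerSeries.coeff (n + j) F, h0, fun z => ?_⟩
  refine (Function.Injective.hasSum_iff (add_right_injective n) fun j hj => ?_).2 (hf z)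
  rw [coeff_eq_zero_of_dvd h (not_le.1 fun hle => hj ⟨j - n, by simp; lia⟩), zero_mul]

lemma isQS_X_pow_mul {f : ℍ → ℂ} {n : ℕ} {c : ℕ → ℂ}
    (h : ∀ z : ℍ, HasSum (fun j : ℕ => c j * qexp z ^ (n + j)) (f z)) :
    IsQS f (PowerSeries.X ^ n * PowerSeries.mk c) := fun z => by
  refine (Function.Injective.hasSum_iff (add_right_injective n) fun j hj => ?_).1 ?_
  · rw [coeff_eq_zero_of_dvd (Dvd.intro _ rfl) (not_le.1 fun hle => hj ⟨j - n, by simp; lia⟩),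
      zero_mul]
  · convert! h z using 2 with j
    simp [add_comm n, PowerSeries.coeff_X_pow_mul]

lemma IsQS.serre {f : ℍ → ℂ} {F : PowerSeries ℂ} (hf : IsQS f F) (k : ℤ) :
    IsQS (serre k f) (serrePS k F) := by
  convert! hf.qderiv.sub (((isQS_Eis (k := 2) (by norm_num)).mul hf).smul ((k : ℂ) / 12)) using 1
  funext z
  rw [_root_.serre, mul_assoc]

lemma IsQS.serreIter {f : ℍ → ℂ} {y : ℕ → PowerSeries ℂ} (hf : IsQS f (y 0)) (k : ℤ) (j : ℕ) :
    IsQS (serreIter k j f) (serreVecIter k y j 0) := by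
  induction j with
  | zero => exact hf
  | succ j ih =>
    convert! ih.serre (k + 2 * j) using 1
    simp [serreVecIter, serreVec]

lemma isQS_gOf {f : ℕ → ℍ → ℂ} {h : ℕ → PowerSeries ℂ} (hf : ∀ ℓ ≤ 3, IsQS (f ℓ) (h ℓ)) {ℓ : ℕ}
    (hℓ : ℓ ≤ 3) : IsQS (gOf 3 f ℓ) ((((Nat.choose 3 ℓ : ℂ))⁻¹ *
      (6 / ((Real.pi : ℂ) * Complex.I)) ^ ℓ) • ∑ m ∈ Finset.range (3 - ℓ + 1),
        (((ℓ + m).choose m : ℕ) : ℂ) • (eisSeries 2 ^ m * h (ℓ + m))) := by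
  refine IsQS.smul _ ?_
  simp only [mul_assoc]
  refine IsQS.sum _ fun m hm => IsQS.smul _ (((isQS_Eis (by norm_num)).pow m).mul (hf _ ?_))
  have := Finset.mem_range.1 hm
  lia

lemma dimQM_six_mul_add_six (n : ℕ) {ℓ : ℕ} (hℓ : ℓ ≤ 3) :
    dimQM (6 * n + 6 - 2 * ℓ) (3 - ℓ) = ∑ i ∈ Finset.range (3 - ℓ + 1),
      if (6 * n + 6 - 2 * (ℓ + i)) % 12 = 2 then (6 * n + 6 - 2 * (ℓ + i)) / 12
      else (6 * n + 6 - 2 * (ℓ + i)) / 12 + 1 := by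
  rw [dimQM_eq, Finset.sum_range]
  refine Finset.sum_congr rfl fun i _ => ?_
  have := i.2
  exact finrank_modularForm _ (by lia) ⟨3 * n + 3 - (ℓ + i), by lia⟩

lemma dimQM_three (n : ℕ) : dimQM (6 * n + 6) 3 = 2 * n + 3 := by
  have := dimQM_six_mul_add_six n (ℓ := 0) (by lia)
  norm_num [Finset.sum_range_succ] at this
  rw [this]
  split_ifs <;> lia

lemma seq4_lt_dimQM {n a b c d ℓ : ℕ} (h1 : b ≤ a) (h2 : c ≤ b) (h3 : d ≤ c)
    (hne : ¬(a = b ∧ b = c ∧ c = d)) (hs : a + b + c + d = 2 * n + 2) (hℓ : ℓ ≤ 3) :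
    seq4 a b c d ℓ < dimQM (6 * n + 6 - 2 * ℓ) (3 - ℓ) := by
  rw [dimQM_six_mul_add_six n hℓ]
  interval_cases ℓ <;> simp only [seq4, Finset.sum_range_succ, Finset.sum_range_zero] <;>
    split_ifs <;> lia

lemma IsVecOf.exists_C_mul_eq {h y : ℕ → PowerSeries ℂ} (hv : IsVecOf h y) {ℓ : ℕ} (hℓ : ℓ ≤ 3) :
    ∃ κ : ℂ, κ ≠ 0 ∧ PowerSeries.C κ * y ℓ = ∑ m ∈ Finset.range (3 - ℓ + 1),
      (((ℓ + m).choose m : ℕ) : ℂ) • (eisSeries 2 ^ m * h (ℓ + m)) := by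
  obtain ⟨v0, v1, v2, v3⟩ := hv
  have hC : ∀ (k : ℕ) [k.AtLeastTwo] (F : PowerSeries ℂ),
      PowerSeries.C ((OfNat.ofNat k : ℂ)⁻¹) * (OfNat.ofNat k * F) = F := fun k _ F => by
    rw [← map_ofNat (PowerSeries.C (R := ℂ)) k, ← mul_assoc, ← map_mul,
      inv_mul_cancel₀ (OfNat.ofNat_ne_zero k), map_one, one_mul]
  interval_cases ℓ
  · refine ⟨1, one_ne_zero, ?_⟩
    rw [v0]
    simp [Finset.sum_range_succ]
  · refine ⟨4⁻¹, by norm_num, ?_⟩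
    rw [v1, hC]
    simp [Finset.sum_range_succ, PowerSeries.smul_eq_C_mul, mul_assoc]
  · refine ⟨24⁻¹, by norm_num, ?_⟩
    rw [v2, hC]
    simp [Finset.sum_range_succ, PowerSeries.smul_eq_C_mul, mul_assoc]
  · refine ⟨288⁻¹, by norm_num, ?_⟩
    rw [v3, hC]
    simp

lemma Bal.isBalancedQM {a b c d : ℕ} {y : ℕ → PowerSeries ℂ} (hy : Bal a b c d y) {w : ℤ}
    (hw : w = 3 * (a + b + c + d : ℕ)) (he : Even (a + b + c + d))
    (hne : ¬(a = b ∧ b = c ∧ c = d)) {f : ℍ → ℂ} {t : ℂ} (ht : t ≠ 0)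
    (hf : IsQS f (PowerSeries.C t * y 0)) : IsBalancedQM w 3 f := by
  obtain ⟨n, hn⟩ : ∃ n, a + b + c + d = 2 * n + 2 := by
    obtain ⟨m, hm⟩ := he
    exact ⟨m - 1, by have := hy.le_ab; have := hy.le_bc; have := hy.le_cd; lia⟩
  obtain ⟨n1, n2, n3⟩ := hy.coeff_ne he hne
  have n0 := hy.coeff0_ne
  obtain ⟨h, hh, hv⟩ := hy.isQ
  rw [← hw] at hh
  have hex : ∀ ℓ : ℕ, ∃ g : ℍ → ℂ, ℓ ≤ 3 →
      g ∈ Mset (w - 2 * ℓ) ∧ IsQS g (PowerSeries.C t * h ℓ) := fun ℓ => by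
    by_cases hℓ : ℓ ≤ 3
    · obtain ⟨F, hF⟩ := MF.C_mul (hh ℓ hℓ) t
      exact ⟨F, fun _ => ⟨mem_Mset_iff.2 ⟨F, rfl⟩, hF⟩⟩
    · exact ⟨0, fun h => absurd h hℓ⟩
  choose g hg using hex
  have hpi : (6 / ((Real.pi : ℂ) * Complex.I)) ≠ 0 := by
    simp [Real.pi_ne_zero]
  have hG : ∀ ℓ ≤ 3, ∃ s : ℂ, s ≠ 0 ∧ IsQS (gOf 3 g ℓ) (PowerSeries.C s * y ℓ) := fun ℓ hℓ => by
    have hq := isQS_gOf (fun ℓ hℓ => (hg ℓ hℓ).2) hℓ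
    obtain ⟨κ, hκ, hy'⟩ := hv.exists_C_mul_eq hℓ
    refine ⟨_, mul_ne_zero (mul_ne_zero (mul_ne_zero (inv_ne_zero (Nat.cast_ne_zero.2
      (Nat.choose_pos hℓ).ne')) (pow_ne_zero ℓ hpi)) ht) hκ, ?_⟩
    convert! hq using 1
    rw [map_mul, mul_assoc, hy', map_mul, mul_assoc, PowerSeries.smul_eq_C_mul, Finset.mul_sum]
    congr 1
    refine Finset.sum_congr rfl fun m _ => ?_
    simp only [PowerSeries.smul_eq_C_mul]
    ring
  obtain ⟨v0, -, -, v3⟩ := hv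
  refine ⟨g, seq4 a b c d, fun ℓ hℓ => (hg ℓ hℓ).1, fun h0 => ?_, ?_, fun ℓ hℓ => ?_, ?_,
    fun ℓ hℓ => ?_, ?_⟩
  · have := (hg 3 le_rfl).2.unique (by rw [h0]; exact IsQS.zero)
    rw [v3, (mul_eq_zero.1 this).resolve_left (by simpa using ht), mul_zero, map_zero] at n3
    exact n3 rfl
  · refine congrFun (hf.funext_of_eq ?_)
    convert! IsQS.sum (Finset.range (3 + 1)) fun ℓ hℓ =>
      ((isQS_Eis (k := 2) (by norm_num)).pow ℓ).mul
        (hg ℓ (by have := Finset.mem_range.1 hℓ; lia)).2 using 1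
    rw [v0]
    simp only [Finset.sum_range_succ, Finset.sum_range_zero]
    ring
  · obtain ⟨s, hs, hq⟩ := hG ℓ hℓ
    refine hq.hasQExpansionAt ((hy.ord ℓ hℓ).mul_left _) ?_
    rw [PowerSeries.coeff_C_mul]
    refine mul_ne_zero hs ?_
    interval_cases ℓ
    exacts [n0, n1, n2, n3]
  · have := hy.le_ab
    have := hy.le_bc
    have := hy.le_cd
    intro i j hij hj
    interval_cases j <;> interval_cases i <;> simp only [seq4] <;> lia
  · convert seq4_lt_dimQM hy.le_ab hy.le_bc hy.le_cd hne hn hℓ using 2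
    lia
  · rw [show w = 6 * n + 6 by lia, dimQM_three]
    simp only [Finset.sum_range_succ, Finset.sum_range_zero, seq4]
    lia

/-- The solution with the largest exponent is determined up to a scalar. -/
lemma Bal.exists_eq_C_mul {a b c d : ℕ} {y u : ℕ → PowerSeries ℂ} (hy : Bal a b c d y)
    (hu : opL a b c d u 0 = 0) (h : PowerSeries.X ^ a ∣ u 0) (h0 : PowerSeries.coeff a (u 0) ≠ 0) :
    ∃ t : ℂ, t ≠ 0 ∧ u 0 = PowerSeries.C t * y 0 := by
  have hn := hy.coeff0_ne
  have hbc := hy.le_bc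
  have hcd := hy.le_cd
  have hab := hy.le_ab
  refine ⟨PowerSeries.coeff a (u 0) / PowerSeries.coeff a (y 0), div_ne_zero h0 hn, ?_⟩
  refine sub_eq_zero.1 (eq_zero_of_opL_eq_zero (a := a) (b := b) (c := c) (d := d)
    (u := fun ℓ => u ℓ - PowerSeries.C _ * y ℓ) hab (by lia) (by lia) ?_ ?_)
  · rw [opL_sub_C_mul, hu, hy.opL_eq_zero 0 (by lia), mul_zero, sub_zero]
  · refine X_pow_succ_dvd (dvd_sub h (hy.ord0.mul_left _)) ?_
    rw [map_sub, PowerSeries.coeff_C_mul, div_mul_cancel₀ _ hn, sub_self]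

/-- Theorem 5 of the paper, case `w ≡ 0 (mod 6)`: modular differential
equation with balanced quasimodular solution of depth `3`. -/
theorem depth_three_equation (w : ℤ) (hw : w % 6 = 0)
    (l0 l1 l2 l3 : ℕ) (h32 : l3 ≤ l2) (h21 : l2 ≤ l1) (h10 : l1 ≤ l0)
    (hne : ¬(l0 = l1 ∧ l1 = l2 ∧ l2 = l3))
    (hsum : (l0 : ℤ) + l1 + l2 + l3 = w / 3)
    (σ2 σ3 : ℚ)
    (hσ2 : σ2 = (l0 : ℚ) * l1 + (l0 : ℚ) * l2 + (l0 : ℚ) * l3 +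
      (l1 : ℚ) * l2 + (l1 : ℚ) * l3 + (l2 : ℚ) * l3)
    (hσ3 : σ3 = (l0 : ℚ) * l1 * l2 + (l0 : ℚ) * l1 * l3 +
      (l0 : ℚ) * l2 * l3 + (l1 : ℚ) * l2 * l3)
    (A0 B0 C0 : ℚ)
    (hA0 : A0 = -(w : ℚ) ^ 2 / 24 + σ2 + 5 / 72)
    (hB0 : B0 = -(w : ℚ) ^ 3 / 216 + (w : ℚ) ^ 2 / 72 + ((w : ℚ) - 2) / 6 * σ2 - σ3 - 5 / 216)
    (hC0 : C0 = ((l0 : ℚ) - ((w : ℚ) - 3) / 12) * ((l1 : ℚ) - ((w : ℚ) - 3) / 12) *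
      ((l2 : ℚ) - ((w : ℚ) - 3) / 12) * ((l3 : ℚ) - ((w : ℚ) - 3) / 12))
    (f : ℍ → ℂ) (hfhol : MDifferentiable 𝓘(ℂ) 𝓘(ℂ) f)
    (c : ℕ → ℂ) (hc0 : c 0 ≠ 0)
    (hq : ∀ z : ℍ, HasSum (fun n : ℕ => c n * qexp z ^ (l0 + n)) (f z))
    (hsol : ∀ z : ℍ,
      serreIter (w - 3) 4 f z + (A0 : ℂ) * Eis 4 z * serreIter (w - 3) 2 f z +
        (B0 : ℂ) * Eis 6 z * serre (w - 3) f z + (C0 : ℂ) * Eis 4 z ^ 2 * f z = 0) :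
    IsBalancedQM w 3 f := by
  have hw3 : w = 3 * (l0 + l1 + l2 + l3 : ℕ) := by lia
  have he : Even (l0 + l1 + l2 + l3) := (Nat.even_iff).2 (by lia)
  obtain ⟨y, hy⟩ := exists_bal h10 h21 h32 he
  have hF := isQS_X_pow_mul hq
  set u : ℕ → PowerSeries ℂ := fun _ => PowerSeries.X ^ l0 * PowerSeries.mk c with hu
  have hit := IsQS.serreIter (y := u) hF (w - 3)
  have e4 := isQS_Eis (k := 4) (by norm_num)
  have e6 := isQS_Eis (k := 6) (by norm_num)
  have hwc : ((w - 3 : ℤ) : ℂ) = 3 * ((l0 : ℂ) + l1 + l2 + l3) - 3 := by rw [hw3]; push_cast; ring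
  have hop : opL l0 l1 l2 l3 u 0 = 0 := by
    have hs := (((hit 4).add ((e4.mul (hit 2)).smul (A0 : ℂ))).add
      ((e6.mul (hit 1)).smul (B0 : ℂ))).add (((e4.pow 2).mul (hit 0)).smul (C0 : ℂ))
    have h0 := hs.unique (G := 0) (by
      convert! IsQS.zero using 1
      funext z
      rw [← hsol z]
      simp only [serreIter, mul_assoc]
      norm_num)
    rw [← h0, opL, ← hwc]
    simp only [PowerSeries.smul_eq_C_mul]
    have hwq : (w : ℂ) = 3 * ((l0 : ℂ) + l1 + l2 + l3) := by rw [hw3]; push_cast; ring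
    subst hσ2 hσ3 hA0 hB0 hC0
    push_cast
    rw [hwq]
  obtain ⟨t, ht, htu⟩ := hy.exists_eq_C_mul hop (Dvd.intro _ rfl) (by
    simpa [hu, PowerSeries.coeff_X_pow_mul'] using hc0)
  exact hy.isBalancedQM hw3 he hne ht (htu ▸ hF)
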